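/- Let Γ be an icc countable group, let Γ↷X be a free ergodic pmp action, and set M = L∞(X)⋊Γ. Then: (1) for any intermediate von Neumann subalgebra L(Γ) ⊆ N ⊆ M with N ⊆ QN_M(L(Γ))'' there exists a factor Γ↷X₀ of Γ↷X such that N = L∞(X₀)⋊Γ; (2) for any intermediate subfactor L(Γ) ⊆ N ⊆ M with Jones index [N : L(Γ)] < ∞ there is a finite transitive factor Γ↷X₀ of Γ↷X with N = L∞(X₀)⋊Γ, and in particular [N : L(Γ)] ∈ ℕ; consequently, for subfactors L(Γ) ⊆ N₁ ⊆ N₂ ⊆ M with either [N₁ : L(Γ)] < ∞ or Γ↷X compact, one has [N₂ : N₁] ∈ ℕ ∪ {∞}; (3) if Γ has no proper finite index subgroups then there are no nontrivial intermediate subfactors L(Γ) ⊆ N ⊆ M with [N : L(Γ)] < ∞. -/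

import Mathlib

/-!
Common framework: we model tracial von Neumann algebras concretely, as von Neumann
algebras `M ⊆ B(H)` (Mathlib's `VonNeumannAlgebra H`, i.e. star-subalgebras equal to
their double commutant) equipped with a faithful tracial state, and we model the
crossed product `A ⋊ Γ` of a trace-preserving action axiomatically: `M` contains a
copy of `A` and a group `(u γ)` of unitaries normalizing `A`, such that the canonical
trace-preserving conditional expectation `E_A` kills `u γ` for `γ ≠ 1`, and such that
an element of `M` all of whose Fourier coefficients `E_A (x (u γ)*)` vanish is `0`.
Probability-measure-preserving actions `Γ ↷ (X, μ)` are modelled via the associated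
trace-preserving action on the abelian von Neumann algebra `A = L^∞(X)`.
-/

noncomputable section

open scoped Classical

namespace CD

/-- A group has infinite conjugacy classes (icc) if every nontrivial conjugacy
class is infinite. -/
def IsICC (Γ : Type) [Group Γ] : Prop :=
  ∀ γ : Γ, γ ≠ 1 → {g : Γ | ∃ h : Γ, g = h * γ * h⁻¹}.Infinite

/-- A faithful tracial state on (the elements of) a set `M ⊆ B(H)` (in applications,
a von Neumann algebra), given as a globally defined linear functional whose
axioms are imposed on `M`. -/
structure TraceOn (H : Type) [NormedAddCommGroup H] [InnerProductSpace ℂ H] [CompleteSpace H]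
    (M : Set (H →L[ℂ] H)) : Type where
  τ : (H →L[ℂ] H) →ₗ[ℂ] ℂ
  unital : τ 1 = 1
  tracial : ∀ x ∈ M, ∀ y ∈ M, τ (x * y) = τ (y * x)
  star_eq : ∀ x ∈ M, τ (star x) = starRingEnd ℂ (τ x)
  nonneg : ∀ x ∈ M, 0 ≤ (τ (star x * x)).re ∧ (τ (star x * x)).im = 0
  faithful : ∀ x ∈ M, τ (star x * x) = 0 → x = 0

variable {H : Type} [NormedAddCommGroup H] [InnerProductSpace ℂ H] [CompleteSpace H]

/-- The 2-norm `‖x‖₂ = τ(x* x)^{1/2}` associated with a trace. -/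
def TraceOn.norm2 {M : Set (H →L[ℂ] H)} (tr : TraceOn H M) (x : H →L[ℂ] H) : ℝ :=
  Real.sqrt (tr.τ (star x * x)).re

/-- The (unique) trace-preserving conditional expectation from `M` onto a
von Neumann subalgebra `N ⊆ M`. -/
structure CondExpOn (H : Type) [NormedAddCommGroup H] [InnerProductSpace ℂ H] [CompleteSpace H]
    (M N : Set (H →L[ℂ] H)) (tr : TraceOn H M) : Type where
  E : (H →L[ℂ] H) →ₗ[ℂ] (H →L[ℂ] H)
  mem : ∀ x ∈ M, E x ∈ N
  fix : ∀ x ∈ N, E x = x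
  bimod : ∀ a ∈ N, ∀ b ∈ N, ∀ x ∈ M, E (a * x * b) = a * E x * b
  star_map : ∀ x ∈ M, E (star x) = star (E x)
  trace_eq : ∀ x ∈ M, tr.τ (E x) = tr.τ x
  contractive : ∀ x ∈ M, tr.norm2 (E x) ≤ tr.norm2 x

/-- The double commutant of a subset of `B(H)`: the von Neumann algebra
generated by `S` (for `S` a star-closed unital set). -/
def vnGen (S : Set (H →L[ℂ] H)) : Set (H →L[ℂ] H) :=
  Set.centralizer (Set.centralizer S)

/-- Model of the crossed product von Neumann algebra `M = A ⋊ Γ` of a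
trace-preserving action `Γ ↷ (A, τ)`: `M` is generated by a copy of `A`
and canonical unitaries `(u γ)` implementing the action, with its canonical
conditional expectation `E_A` onto `A` (characterising the Fourier coefficients),
together with the group von Neumann algebra `L(Γ) = {u γ : γ}'' ⊆ M` and the
conditional expectation onto it. -/
structure CrossedProduct (Γ : Type) [Group Γ]
    (H : Type) [NormedAddCommGroup H] [InnerProductSpace ℂ H] [CompleteSpace H] : Type where
  M : VonNeumannAlgebra H
  A : VonNeumannAlgebra H
  A_sub : (A : Set (H →L[ℂ] H)) ⊆ (M : Set (H →L[ℂ] H))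
  tr : TraceOn H (M : Set (H →L[ℂ] H))
  u : Γ → (H →L[ℂ] H)
  u_mem : ∀ γ, u γ ∈ M
  u_one : u 1 = 1
  u_mul : ∀ γ δ, u γ * u δ = u (γ * δ)
  u_star : ∀ γ, star (u γ) = u γ⁻¹
  conj_mem : ∀ (γ : Γ), ∀ a ∈ A, u γ * a * star (u γ) ∈ A
  EA : CondExpOn H (M : Set (H →L[ℂ] H)) (A : Set (H →L[ℂ] H)) tr
  EA_u : ∀ γ : Γ, γ ≠ 1 → EA.E (u γ) = 0
  fourier_sep : ∀ x ∈ M, (∀ γ : Γ, EA.E (x * star (u γ)) = 0) → x = 0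
  Lg : VonNeumannAlgebra H
  Lg_eq : (Lg : Set (H →L[ℂ] H)) = vnGen (Set.range u)
  Lg_sub : (Lg : Set (H →L[ℂ] H)) ⊆ (M : Set (H →L[ℂ] H))
  EL : CondExpOn H (M : Set (H →L[ℂ] H)) (Lg : Set (H →L[ℂ] H)) tr

variable {Γ : Type} [Group Γ]

/-- The action `σ_γ = Ad(u γ)` of `Γ` on `B(H)`, restricting to the given
action on `A`. -/
def CrossedProduct.σ (X : CrossedProduct Γ H) (γ : Γ) (x : H →L[ℂ] H) : H →L[ℂ] H :=
  X.u γ * x * star (X.u γ)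

/-- The action is properly outer over the center of `P`; for abelian `P` this is
the usual freeness of the action. -/
def ProperlyOuterOn (X : CrossedProduct Γ H) (P : Set (H →L[ℂ] H)) : Prop :=
  ∀ γ : Γ, γ ≠ 1 → ∀ a ∈ P, (∀ b ∈ P, X.σ γ b * a = a * b) → a = 0

/-- Freeness of the action `Γ ↷ A`. -/
def IsFree (X : CrossedProduct Γ H) : Prop := ProperlyOuterOn X (X.A : Set (H →L[ℂ] H))

/-- Ergodicity of the action `Γ ↷ A`: the fixed points are the scalars. -/
def IsErgodic (X : CrossedProduct Γ H) : Prop :=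
  ∀ a ∈ X.A, (∀ γ : Γ, X.σ γ a = a) → ∃ c : ℂ, a = c • (1 : H →L[ℂ] H)

def IsAbelianSet (S : Set (H →L[ℂ] H)) : Prop := ∀ x ∈ S, ∀ y ∈ S, x * y = y * x

/-- `Q` is a `Γ`-invariant subset (in applications, subalgebra). -/
def InvariantUnder (X : CrossedProduct Γ H) (Q : Set (H →L[ℂ] H)) : Prop :=
  ∀ (γ : Γ), ∀ q ∈ Q, X.σ γ q ∈ Q

/-- The intermediate crossed product `Q ⋊ Γ ⊆ A ⋊ Γ` of a (`Γ`-invariant)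
subalgebra `Q ⊆ A`: those elements all of whose Fourier coefficients lie in `Q`. -/
def midCP (X : CrossedProduct Γ H) (Q : Set (H →L[ℂ] H)) : Set (H →L[ℂ] H) :=
  {x | x ∈ X.M ∧ ∀ γ : Γ, X.EA.E (x * star (X.u γ)) ∈ Q}

/-- The intermediate crossed product `A ⋊ K ⊆ A ⋊ Γ` of a subgroup `K ≤ Γ`:
those elements whose Fourier coefficients are supported on `K`. -/
def subgpCP (X : CrossedProduct Γ H) (K : Subgroup Γ) : Set (H →L[ℂ] H) :=
  {x | x ∈ X.M ∧ ∀ γ : Γ, γ ∉ K → X.EA.E (x * star (X.u γ)) = 0}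

/-- The quasinormalizer `QN_M(P)` of `P` inside `M`. -/
def QNset (M P : Set (H →L[ℂ] H)) : Set (H →L[ℂ] H) :=
  {x | x ∈ M ∧ ∃ (n : ℕ) (y : Fin n → (H →L[ℂ] H)), (∀ i, y i ∈ M) ∧
    (∀ p ∈ P, ∃ q : Fin n → (H →L[ℂ] H), (∀ i, q i ∈ P) ∧ p * x = ∑ i, y i * q i) ∧
    (∀ p ∈ P, ∃ q : Fin n → (H →L[ℂ] H), (∀ i, q i ∈ P) ∧ x * p = ∑ i, q i * y i)}

def IsUnitaryIn (S : Set (H →L[ℂ] H)) (x : H →L[ℂ] H) : Prop :=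
  x ∈ S ∧ star x * x = 1 ∧ x * star x = 1

def IsProjIn (S : Set (H →L[ℂ] H)) (p : H →L[ℂ] H) : Prop :=
  p ∈ S ∧ star p = p ∧ p * p = p

/-- The relative commutant `N' ∩ S`. -/
def commutantIn (N S : Set (H →L[ℂ] H)) : Set (H →L[ℂ] H) :=
  {x | x ∈ S ∧ ∀ y ∈ N, x * y = y * x}

/-- Conjugation `w ( · ) w*` applied to a set. -/
def conjSet (w : H →L[ℂ] H) (S : Set (H →L[ℂ] H)) : Set (H →L[ℂ] H) :=
  (fun y => w * y * star w) '' S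

/-- The scalars `ℂ 1 ⊆ B(H)`. -/
def scalars (H : Type) [NormedAddCommGroup H] [InnerProductSpace ℂ H] [CompleteSpace H] :
    Set (H →L[ℂ] H) :=
  Set.range (fun c : ℂ => c • (1 : H →L[ℂ] H))

/-- The extension `P₀ ⊆ P` of `Γ`-algebras is compact: there is a family `F ⊆ P`
with dense `‖·‖₂`-span in `P` such that the `Γ`-orbit of each `f ∈ F` can be
uniformly approximated by finitely many "`P₀`-finite rank modules". -/
def IsCompactExt (X : CrossedProduct Γ H) (P₀ P : Set (H →L[ℂ] H)) : Prop :=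
  ∃ F : Set (H →L[ℂ] H), F ⊆ P ∧
    (∀ p ∈ P, ∀ ε : ℝ, 0 < ε → ∃ (n : ℕ) (c : Fin n → ℂ) (f : Fin n → (H →L[ℂ] H)),
      (∀ i, f i ∈ F) ∧ X.tr.norm2 (p - ∑ i, c i • f i) ≤ ε) ∧
    (∀ f ∈ F, ∀ ε : ℝ, 0 < ε → ∃ (n : ℕ) (ξ : Fin n → (H →L[ℂ] H)) (C : ℝ),
      (∀ i, ξ i ∈ P) ∧
      ∀ γ : Γ, ∃ κ : Fin n → (H →L[ℂ] H), (∀ i, κ i ∈ P₀) ∧ (∀ i, ‖κ i‖ ≤ C) ∧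
        X.tr.norm2 (X.σ γ f - ∑ i, κ i * ξ i) ≤ ε)

/-- The action `Γ ↷ A` is compact: the extension over the scalars is compact. -/
def IsCompactAction (X : CrossedProduct Γ H) : Prop :=
  IsCompactExt X (scalars H) (X.A : Set (H →L[ℂ] H))

/-- The `Γ`-invariant subalgebra `B ⊆ A` gives a mixing extension: for
`t, z ∈ A ⊖ B` one has `‖E_B(t σ_γ(z))‖₂ → 0` as `γ → ∞`. -/
def IsMixingExt (X : CrossedProduct Γ H) (B : Set (H →L[ℂ] H))
    (EB : CondExpOn H (X.M : Set (H →L[ℂ] H)) B X.tr) : Prop :=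
  ∀ t ∈ X.A, ∀ z ∈ X.A, EB.E t = 0 → EB.E z = 0 →
    Filter.Tendsto (fun γ : Γ => X.tr.norm2 (EB.E (t * X.σ γ z))) Filter.cofinite (nhds 0)

/-- A `*`-isomorphism from (the von Neumann algebra with underlying set) `M ⊆ B(H₁)`
onto `N ⊆ B(H₂)`, given as a globally defined map with all axioms imposed on `M`. -/
structure StarIsoOn {H₁ : Type} [NormedAddCommGroup H₁] [InnerProductSpace ℂ H₁]
    [CompleteSpace H₁] {H₂ : Type} [NormedAddCommGroup H₂] [InnerProductSpace ℂ H₂]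
    [CompleteSpace H₂] (M : Set (H₁ →L[ℂ] H₁)) (N : Set (H₂ →L[ℂ] H₂)) : Type where
  Θ : (H₁ →L[ℂ] H₁) → (H₂ →L[ℂ] H₂)
  mem : ∀ x ∈ M, Θ x ∈ N
  map_one : Θ 1 = 1
  map_add : ∀ x ∈ M, ∀ y ∈ M, Θ (x + y) = Θ x + Θ y
  map_smul : ∀ (c : ℂ), ∀ x ∈ M, Θ (c • x) = c • Θ x
  map_mul : ∀ x ∈ M, ∀ y ∈ M, Θ (x * y) = Θ x * Θ y
  map_star : ∀ x ∈ M, Θ (star x) = star (Θ x)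
  inj : ∀ x ∈ M, ∀ y ∈ M, Θ x = Θ y → x = y
  surj : ∀ y ∈ N, ∃ x ∈ M, Θ x = y

/-- `r` is the (Pimsner–Popa/Jones) index of the inclusion `N ⊆ M`, witnessed by a
finite Pimsner–Popa basis `m₁, …, m_k` with `E_N (m_i m_j*) = δ_{ij} p_i`,
`x = ∑ᵢ E_N(x mᵢ*) mᵢ` for `x ∈ M`, and `r = ∑ᵢ τ(pᵢ)`. -/
def HasPPIndex {Mamb : Set (H →L[ℂ] H)} (tr : TraceOn H Mamb)
    (M N : Set (H →L[ℂ] H)) (r : ℝ) : Prop :=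
  ∃ E : (H →L[ℂ] H) →ₗ[ℂ] (H →L[ℂ] H),
    (∀ x ∈ M, E x ∈ N) ∧ (∀ x ∈ N, E x = x) ∧
    (∀ a ∈ N, ∀ b ∈ N, ∀ x ∈ M, E (a * x * b) = a * E x * b) ∧
    (∀ x ∈ M, tr.τ (E x) = tr.τ x) ∧
    ∃ (k : ℕ) (m p : Fin k → (H →L[ℂ] H)),
      (∀ i, m i ∈ M) ∧ (∀ i, p i ∈ N ∧ star (p i) = p i ∧ p i * p i = p i) ∧
      (∀ i j, E (m i * star (m j)) = if i = j then p i else 0) ∧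
      (∀ x ∈ M, x = ∑ i, E (x * star (m i)) * m i) ∧
      r = (∑ i, tr.τ (p i)).re

/-- The inclusion `N ⊆ M` has finite (Pimsner–Popa/Jones) index. -/
def FiniteIndexIn {Mamb : Set (H →L[ℂ] H)} (tr : TraceOn H Mamb)
    (M N : Set (H →L[ℂ] H)) : Prop :=
  ∃ r : ℝ, HasPPIndex tr M N r

/-- `S` (a von Neumann algebra) is a factor: trivial center. -/
def IsFactorSet (S : Set (H →L[ℂ] H)) : Prop :=
  ∀ x ∈ S, (∀ y ∈ S, x * y = y * x) → ∃ c : ℂ, x = c • (1 : H →L[ℂ] H)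

/-- `S` is a II₁ factor (with respect to the trace `tr`): a factor whose
projections realize every trace value in `[0,1]`. -/
def IsII1On {Mamb : Set (H →L[ℂ] H)} (tr : TraceOn H Mamb) (S : Set (H →L[ℂ] H)) : Prop :=
  IsFactorSet S ∧ ∀ r : ℝ, 0 ≤ r → r ≤ 1 →
    ∃ p ∈ S, star p = p ∧ p * p = p ∧ tr.τ p = (r : ℂ)

def IsFinDimSet (S : Set (H →L[ℂ] H)) : Prop :=
  ∃ (n : ℕ) (v : Fin n → (H →L[ℂ] H)), (∀ i, v i ∈ S) ∧
    ∀ x ∈ S, ∃ c : Fin n → ℂ, x = ∑ i, c i • v i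

def IsStarSubalgSet (S : Set (H →L[ℂ] H)) : Prop :=
  (1 : H →L[ℂ] H) ∈ S ∧ (∀ x ∈ S, ∀ y ∈ S, x + y ∈ S) ∧ (∀ x ∈ S, ∀ y ∈ S, x * y ∈ S) ∧
    (∀ (c : ℂ), ∀ x ∈ S, c • x ∈ S) ∧ (∀ x ∈ S, star x ∈ S)

/-- `S` is approximately finite dimensional (with respect to `‖·‖₂`); by Connes'
theorem this is equivalent to amenability for (separable, tracial) von Neumann
algebras. -/
def IsAFD {Mamb : Set (H →L[ℂ] H)} (tr : TraceOn H Mamb) (S : Set (H →L[ℂ] H)) : Prop :=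
  ∃ Q : ℕ → Set (H →L[ℂ] H), (∀ n, Q n ⊆ S) ∧ (∀ n, Q n ⊆ Q (n + 1)) ∧
    (∀ n, IsFinDimSet (Q n)) ∧ (∀ n, IsStarSubalgSet (Q n)) ∧
    ∀ x ∈ S, ∀ ε : ℝ, 0 < ε → ∃ n, ∃ y ∈ Q n, tr.norm2 (x - y) ≤ ε

/-- `S` is diffuse: it has no minimal projections. -/
def IsDiffuseSet (S : Set (H →L[ℂ] H)) : Prop :=
  ∀ p, IsProjIn S p → p ≠ 0 →
    ∃ q, IsProjIn S q ∧ q ≠ 0 ∧ q ≠ p ∧ q * p = q ∧ p * q = q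

/-- The (trace-preserving) action of `Γ` on the subalgebra `Q` is transitive:
`Q` is spanned by finitely many orthogonal minimal projections summing to `1`
which are permuted transitively by `Γ`. -/
def IsTransitiveOn (X : CrossedProduct Γ H) (Q : Set (H →L[ℂ] H)) : Prop :=
  ∃ (n : ℕ) (e : Fin n → (H →L[ℂ] H)),
    (∀ i, e i ∈ Q ∧ star (e i) = e i ∧ e i * e i = e i) ∧
    (∀ i j, i ≠ j → e i * e j = 0) ∧ (∑ i, e i = 1) ∧
    (∀ q ∈ Q, ∃ c : Fin n → ℂ, q = ∑ i, c i • e i) ∧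
    (∀ i j, ∃ γ : Γ, X.σ γ (e i) = e j)

/-- An abelian von Neumann algebra `S` is completely atomic: every nonzero
projection dominates a minimal projection. -/
def IsCompletelyAtomic (S : Set (H →L[ℂ] H)) : Prop :=
  ∀ p, IsProjIn S p → p ≠ 0 →
    ∃ q, IsProjIn S q ∧ q ≠ 0 ∧ q * p = q ∧
      ∀ r, IsProjIn S r → r * q = r → r = 0 ∨ r = q

end CD

section helpers
open Filter Topology
set_option linter.all false

namespace CD

section vnbasics
variable {H : Type} [NormedAddCommGroup H] [InnerProductSpace ℂ H] [CompleteSpace H]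

theorem vn_mem_of (N : VonNeumannAlgebra H) {x : H →L[ℂ] H}
    (h : ∀ y ∈ N.commutant, y * x = x * y) : x ∈ N := by
  have : x ∈ N.commutant.commutant := VonNeumannAlgebra.mem_commutant_iff.2 h
  rwa [VonNeumannAlgebra.commutant_commutant] at this

theorem vn_comm (N : VonNeumannAlgebra H) {x y : H →L[ℂ] H} (hx : x ∈ N)
    (hy : y ∈ N.commutant) : x * y = y * x :=
  VonNeumannAlgebra.mem_commutant_iff.1 hy x hx

theorem vn_smul_mem (N : VonNeumannAlgebra H) {x : H →L[ℂ] H} (c : ℂ) (hx : x ∈ N) :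
    c • x ∈ N := N.toStarSubalgebra.smul_mem hx c

theorem vn_rsmul_mem (N : VonNeumannAlgebra H) {x : H →L[ℂ] H} (c : ℝ) (hx : x ∈ N) :
    c • x ∈ N := by
  have := vn_smul_mem N (c : ℂ) hx
  have e : (c : ℂ) • x = c • x := by
    ext v; simp
  rwa [e] at this

theorem vn_strong_limit (N : VonNeumannAlgebra H) {ι : Type*} {l : Filter ι} [l.NeBot]
    {b : ι → (H →L[ℂ] H)}
    (hb : ∀ n, b n ∈ N) {x : H →L[ℂ] H}
    (h : ∀ ξ, Filter.Tendsto (fun n => b n ξ) l (nhds (x ξ))) : x ∈ N := by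
  apply vn_mem_of
  intro y hy
  ext ξ
  have h1 : Filter.Tendsto (fun n => y (b n ξ)) l (nhds (y (x ξ))) :=
    (y.continuous.tendsto _).comp (h ξ)
  have h2 := h (y ξ)
  refine tendsto_nhds_unique h1 (h2.congr fun n => ?_)
  have := vn_comm N (hb n) hy
  exact congrArg (fun T : H →L[ℂ] H => T ξ) this

theorem vn_closed (N : VonNeumannAlgebra H) : IsClosed (N : Set (H →L[ℂ] H)) := by
  rw [← N.centralizer_centralizer]
  exact Set.isClosed_centralizer _

theorem vn_cfc_mem (N : VonNeumannAlgebra H) {x : H →L[ℂ] H} (hx : x ∈ N) (f : ℝ → ℝ) :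
    cfc f x ∈ N := by
  apply vn_mem_of
  intro y hy
  have : Commute x y := vn_comm N hx hy
  exact (this.cfc_real f).symm

/-- range projection -/
def rp (x : H →L[ℂ] H) : H →L[ℂ] H :=
  (LinearMap.range (x : H →ₗ[ℂ] H)).topologicalClosure.starProjection

theorem proj_mem_of_invariant (N : VonNeumannAlgebra H) (V : Submodule ℂ H)
    [V.HasOrthogonalProjection]
    (h : ∀ y ∈ N.commutant, ∀ v ∈ V, y v ∈ V) : V.starProjection ∈ N := by
  rw [VonNeumannAlgebra.IsStarProjection.mem_iff isStarProjection_starProjection]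
  intro y hy
  rw [Module.End.mem_invtSubmodule]
  intro v hv
  have e : V.starProjection.range = V := Submodule.range_starProjection V
  rw [e] at hv
  simp only [Submodule.mem_comap]
  rw [e]
  exact h y hy v hv

theorem rp_mem (N : VonNeumannAlgebra H) {x : H →L[ℂ] H} (hx : x ∈ N) : rp x ∈ N := by
  apply proj_mem_of_invariant
  intro y hy v hv
  have : (LinearMap.range (x : H →ₗ[ℂ] H)) ≤
      (LinearMap.range (x : H →ₗ[ℂ] H)).topologicalClosure.comap (y : H →ₗ[ℂ] H) := by
    rintro _ ⟨w, rfl⟩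
    apply Submodule.le_topologicalClosure
    refine ⟨y w, ?_⟩
    exact congrArg (fun T : H →L[ℂ] H => T w) (vn_comm N hx hy)
  have h2 := Submodule.topologicalClosure_minimal _ this
    (IsClosed.preimage y.continuous (Submodule.isClosed_topologicalClosure _))
  exact h2 hv

theorem rp_star (x : H →L[ℂ] H) : star (rp x) = rp x :=
  (isStarProjection_starProjection).isSelfAdjoint.star_eq

theorem rp_idem (x : H →L[ℂ] H) : rp x * rp x = rp x :=
  (isStarProjection_starProjection).isIdempotentElem

theorem rp_mul_self (x : H →L[ℂ] H) : rp x * x = x := by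
  ext v
  change rp x (x v) = x v
  unfold rp
  rw [Submodule.starProjection_eq_self_iff]
  exact Submodule.le_topologicalClosure _ ⟨v, rfl⟩

theorem mul_rp_of_mul_eq_zero {x y : H →L[ℂ] H} (h : y * x = 0) : y * rp x = 0 := by
  ext v
  change y (rp x v) = 0
  have h1 : rp x v ∈ (LinearMap.range (x : H →ₗ[ℂ] H)).topologicalClosure :=
    Submodule.starProjection_apply_mem _ v
  have : (LinearMap.range (x : H →ₗ[ℂ] H)) ≤ LinearMap.ker (y : H →ₗ[ℂ] H) := by
    rintro _ ⟨w, rfl⟩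
    exact congrArg (fun T : H →L[ℂ] H => T w) h
  exact Submodule.topologicalClosure_minimal _ this (y.isClosed_ker) h1

theorem mul_rp_of_mul_eq_self {x y : H →L[ℂ] H} (h : y * x = x) : y * rp x = rp x := by
  have := mul_rp_of_mul_eq_zero (x := x) (y := y - 1) (by rw [sub_mul, h, one_mul, sub_self])
  rw [sub_mul, one_mul, sub_eq_zero] at this
  exact this

theorem rp_eq_zero {x : H →L[ℂ] H} (h : rp x = 0) : x = 0 := by
  rw [← rp_mul_self x, h, zero_mul]

theorem rp_isProj (N : VonNeumannAlgebra H) {x : H →L[ℂ] H} (hx : x ∈ N) :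
    IsProjIn (N : Set (H →L[ℂ] H)) (rp x) := ⟨rp_mem N hx, rp_star x, rp_idem x⟩

theorem proj_nonneg {e : H →L[ℂ] H} (h1 : star e = e) (h2 : e * e = e) : 0 ≤ e := by
  have : e = star e * e := by rw [h1, h2]
  rw [this]; exact star_mul_self_nonneg e

theorem conj_nonneg {e y : H →L[ℂ] H} (h1 : star e = e) (h : 0 ≤ y) : 0 ≤ e * y * e := by
  have := star_left_conjugate_nonneg h e
  rwa [h1] at this

/-- one step of the spectral decomposition. -/
theorem spectral_step (N : VonNeumannAlgebra H) {x : H →L[ℂ] H} (hx : x ∈ N) (c : ℝ)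
    (hc : 0 < c) (h0 : 0 ≤ x) (h1 : x ≤ algebraMap ℝ _ (2 * c)) :
    ∃ e, IsProjIn (N : Set (H →L[ℂ] H)) e ∧ (∀ p : H →L[ℂ] H, p * x = x → p * e = e) ∧
      0 ≤ x - c • e ∧ x - c • e ≤ algebraMap ℝ _ c := by
  have hsa : IsSelfAdjoint x := IsSelfAdjoint.of_nonneg h0
  have hspec : ∀ t ∈ spectrum ℝ x, 0 ≤ t ∧ t ≤ 2 * c := by
    intro t ht
    exact ⟨spectrum_nonneg_of_nonneg h0 ht,
      (le_algebraMap_iff_spectrum_le (a := x) (r := 2 * c)).1 h1 t ht⟩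
  set P : H →L[ℂ] H := cfc (fun t : ℝ => max (t - c) 0) x with hP
  set Q : H →L[ℂ] H := cfc (fun t : ℝ => max (c - t) 0) x with hQ
  set e := rp P with he
  have hPm : P ∈ N := vn_cfc_mem N hx _
  have heP := rp_isProj N hPm
  have hQP : Q * P = 0 := by
    rw [hP, hQ, ← cfc_mul _ _ x (by fun_prop) (by fun_prop)]
    rw [← cfc_zero ℝ x]
    apply cfc_congr
    intro t _
    simp only [Pi.zero_apply]
    rcases le_total t c with h | h
    · rw [max_eq_right (sub_nonpos.2 h)]; ring
    · rw [max_eq_right (a := c - t) (sub_nonpos.2 h)]; ring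
  have hPQ : x - algebraMap ℝ _ c = P - Q := by
    rw [hP, hQ, ← cfc_sub _ _ x (by fun_prop) (by fun_prop)]
    conv_lhs => rw [← cfc_id' ℝ x, ← cfc_const c x, ← cfc_sub _ _ x (by fun_prop) (by fun_prop)]
    apply cfc_congr
    intro t _
    rcases le_total t c with h | h
    · simp [h]
    · simp [h]
  have hP0 : 0 ≤ P := cfc_nonneg fun t _ => le_max_right _ _
  have hQ0 : 0 ≤ Q := cfc_nonneg fun t _ => le_max_right _ _
  have hPc : 0 ≤ algebraMap ℝ _ c - P := by
    rw [sub_nonneg, hP]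
    refine cfc_le_algebraMap _ _ _ ?_ (by fun_prop) hsa
    intro t ht
    have := hspec t ht
    exact max_le (by linarith) hc.le
  have hQc : 0 ≤ algebraMap ℝ _ c - Q := by
    rw [sub_nonneg, hQ]
    refine cfc_le_algebraMap _ _ _ ?_ (by fun_prop) hsa
    intro t ht
    have := hspec t ht
    exact max_le (by linarith) hc.le
  have hPs : star P = P := (IsSelfAdjoint.of_nonneg hP0).star_eq
  have hQs : star Q = Q := (IsSelfAdjoint.of_nonneg hQ0).star_eq
  have heP1 : e * P = P := rp_mul_self P
  have heP2 : P * e = P := by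
    have := congrArg star heP1
    rwa [star_mul, hPs, heP.2.1] at this
  have hQe : Q * e = 0 := mul_rp_of_mul_eq_zero hQP
  have heQ : e * Q = 0 := by
    have := congrArg star hQe
    rwa [star_mul, hQs, heP.2.1, star_zero] at this
  have hee : e * e = e := heP.2.2
  have alg : (algebraMap ℝ (H →L[ℂ] H)) c = c • 1 := Algebra.algebraMap_eq_smul_one c
  refine ⟨e, heP, ?_, ?_, ?_⟩
  · intro p hp
    apply mul_rp_of_mul_eq_self
    have : P = x * cfc (fun t : ℝ => max (t - c) 0 / max t c) x := by
      conv_rhs => rw [← cfc_id' ℝ x]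
      rw [cfc_id' ℝ x]
      conv_rhs => enter [1]; rw [← cfc_id' ℝ x]
      have hcont : Continuous (fun t : ℝ => max (t - c) 0 / max t c) :=
        Continuous.div (by fun_prop) (by fun_prop)
          (fun t => (lt_of_lt_of_le hc (le_max_right _ _)).ne')
      rw [← cfc_mul _ _ x (by fun_prop) hcont.continuousOn, hP]
      apply cfc_congr
      intro t _
      simp only
      rcases le_total t c with h | h
      · rw [max_eq_right (sub_nonpos.2 h)]; simp
      · rw [max_eq_left h]
        field_simp [(lt_of_lt_of_le hc h).ne']
    rw [this, ← mul_assoc, hp]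
  · have : x - c • e = P + (1 - e) * (algebraMap ℝ _ c - Q) * (1 - e) := by
      have hx' : x = P - Q + c • 1 := by rw [← hPQ, alg]; abel
      rw [hx', alg]
      simp only [mul_sub, sub_mul, one_mul, mul_one, heQ, hQe, smul_mul_assoc, mul_smul_comm, hee,
        zero_mul, smul_sub, sub_self, smul_zero]
      abel
    rw [this]
    refine add_nonneg hP0 (conj_nonneg ?_ hQc)
    rw [star_sub, star_one, heP.2.1]
  · rw [← sub_nonneg]
    have : algebraMap ℝ _ c - (x - c • e) = Q + e * (algebraMap ℝ _ c - P) * e := by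
      have hx' : x = P - Q + c • 1 := by rw [← hPQ, alg]; abel
      rw [hx', alg]
      simp only [mul_sub, sub_mul, one_mul, mul_one, heP1, heP2, smul_mul_assoc, mul_smul_comm, hee]
      abel
    rw [this]
    exact add_nonneg hQ0 (conj_nonneg heP.2.1 hPc)

/-- spectral approximation by projections. -/
theorem spectral_approx (N : VonNeumannAlgebra H) (n : ℕ) : ∀ {x : H →L[ℂ] H} (_ : x ∈ N) (c : ℝ)
    (_ : 0 < c) (_ : 0 ≤ x) (_ : x ≤ algebraMap ℝ _ c) (p : H →L[ℂ] H) (_ : p * x = x),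
    ∃ (e : Fin n → (H →L[ℂ] H)) (w : Fin n → ℝ), (∀ i, 0 ≤ w i) ∧
      (∀ i, IsProjIn (N : Set (H →L[ℂ] H)) (e i) ∧ p * e i = e i) ∧
      0 ≤ x - ∑ i, w i • e i ∧ x - ∑ i, w i • e i ≤ algebraMap ℝ _ (c / 2 ^ n) := by
  induction n with
  | zero =>
    intro x hx c hc h0 h1 p hp
    exact ⟨Fin.elim0, Fin.elim0, fun i => i.elim0, fun i => i.elim0, by simpa using h0,
      by simpa using h1⟩
  | succ n ih =>
    intro x hx c hc h0 h1 p hp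
    obtain ⟨e, he, hpe, h2, h3⟩ := spectral_step N hx (c / 2) (by positivity) h0
      (by convert h1 using 2; ring)
    obtain ⟨e', w, hw, he', h4, h5⟩ := ih (x := x - (c / 2) • e)
      (sub_mem hx (vn_rsmul_mem N _ he.1)) (c / 2) (by positivity) h2 h3 p
      (by rw [mul_sub, hp, mul_smul_comm, hpe p hp])
    refine ⟨Fin.cons e e', Fin.cons (c / 2) w, ?_, ?_, ?_, ?_⟩
    · intro i
      refine Fin.cases ?_ (fun j => ?_) i
      · simp; positivity
      · simpa using hw j
    · intro i
      refine Fin.cases ?_ (fun j => ?_) i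
      · simpa using ⟨he, hpe p hp⟩
      · simpa using he' j
    · rw [Fin.sum_univ_succ]
      simp only [Fin.cons_zero, Fin.cons_succ]
      rw [← sub_sub]; exact h4
    · rw [Fin.sum_univ_succ]
      simp only [Fin.cons_zero, Fin.cons_succ]
      rw [← sub_sub]; convert h5 using 2; rw [pow_succ]; field_simp

end vnbasics
end CD

namespace CD

section traceL2
variable {H : Type} [NormedAddCommGroup H] [InnerProductSpace ℂ H] [CompleteSpace H]

/-- The underlying submodule of a von Neumann algebra. -/
def vnSub (M : VonNeumannAlgebra H) : Submodule ℂ (H →L[ℂ] H) :=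
  Subalgebra.toSubmodule M.toStarSubalgebra.toSubalgebra

theorem mem_vnSub {M : VonNeumannAlgebra H} {x : H →L[ℂ] H} : x ∈ vnSub M ↔ x ∈ M := Iff.rfl

variable (M : VonNeumannAlgebra H) (tr : TraceOn H (M : Set (H →L[ℂ] H)))

/-- Pre-Hilbert space of a trace. -/
def L2pre (_ : TraceOn H (M : Set (H →L[ℂ] H))) : Type := ↥(vnSub M)

instance : AddCommGroup (L2pre M tr) := inferInstanceAs (AddCommGroup ↥(vnSub M))
instance : Module ℂ (L2pre M tr) := inferInstanceAs (Module ℂ ↥(vnSub M))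

/-- inclusion -/
def L2pre.val : L2pre M tr →ₗ[ℂ] (H →L[ℂ] H) := (vnSub M).subtype

/-- constructor -/
def L2pre.mk (x : H →L[ℂ] H) (hx : x ∈ M) : L2pre M tr := (⟨x, hx⟩ : ↥(vnSub M))

theorem L2pre.val_mk (x : H →L[ℂ] H) (hx : x ∈ M) : L2pre.val M tr (L2pre.mk M tr x hx) = x := rfl

theorem L2pre.val_mem (x : L2pre M tr) : L2pre.val M tr x ∈ M := Subtype.property (p := _) x

theorem L2pre.val_inj {x y : L2pre M tr} (h : L2pre.val M tr x = L2pre.val M tr y) : x = y :=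
  Subtype.ext h

/-- core -/
abbrev L2core : InnerProductSpace.Core ℂ (L2pre M tr) where
  inner x y := tr.τ (star (L2pre.val M tr x) * (L2pre.val M tr y))
  conj_inner_symm x y := by
    rw [← tr.star_eq _ (mul_mem (star_mem (L2pre.val_mem M tr y)) (L2pre.val_mem M tr x))]
    rw [star_mul, star_star]
  re_inner_nonneg x := (tr.nonneg _ (L2pre.val_mem M tr x)).1
  add_left x y z := by
    simp only [map_add, star_add, add_mul]
  smul_left x y r := by
    simp only [map_smul, star_smul, smul_mul_assoc]
    rfl
  definite x h := by
    apply L2pre.val_inj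
    rw [map_zero]
    exact tr.faithful _ (L2pre.val_mem M tr x) h

instance : NormedAddCommGroup (L2pre M tr) := (L2core M tr).toNormedAddCommGroup
instance : InnerProductSpace ℂ (L2pre M tr) := InnerProductSpace.ofCore (L2core M tr).toCore

theorem L2pre.inner_def (x y : L2pre M tr) :
    inner ℂ x y = tr.τ (star (L2pre.val M tr x) * (L2pre.val M tr y)) := rfl

/-- The GNS space. -/
def L2 : Type := UniformSpace.Completion (L2pre M tr)

instance : NormedAddCommGroup (L2 M tr) :=
  inferInstanceAs (NormedAddCommGroup (UniformSpace.Completion (L2pre M tr)))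
instance : InnerProductSpace ℂ (L2 M tr) :=
  inferInstanceAs (InnerProductSpace ℂ (UniformSpace.Completion (L2pre M tr)))
instance : CompleteSpace (L2 M tr) :=
  inferInstanceAs (CompleteSpace (UniformSpace.Completion (L2pre M tr)))

/-- canonical isometry -/
def L2.coe : L2pre M tr →ₗᵢ[ℂ] L2 M tr := UniformSpace.Completion.toComplₗᵢ

theorem L2.coe_dense : DenseRange (L2.coe M tr) := UniformSpace.Completion.denseRange_coe

theorem exists_retract : ∃ g : (H →L[ℂ] H) →ₗ[ℂ] L2pre M tr, g ∘ₗ L2pre.val M tr = LinearMap.id :=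
  LinearMap.exists_leftInverse_of_injective _
    (LinearMap.ker_eq_bot.2 fun _ _ h => L2pre.val_inj M tr h)

/-- The map `x ↦ x̂` -/
def io : (H →L[ℂ] H) →ₗ[ℂ] L2 M tr :=
  (L2.coe M tr).toLinearMap ∘ₗ (exists_retract M tr).choose

theorem io_mk (x : H →L[ℂ] H) (hx : x ∈ M) : io M tr x = L2.coe M tr (L2pre.mk M tr x hx) := by
  have := LinearMap.congr_fun (exists_retract M tr).choose_spec (L2pre.mk M tr x hx)
  simp only [LinearMap.comp_apply, LinearMap.id_apply, L2pre.val_mk] at this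
  simp only [io, LinearMap.comp_apply, this]
  rfl

variable {M}

theorem io_inner {x y : H →L[ℂ] H} (hx : x ∈ M) (hy : y ∈ M) :
    inner ℂ (io M tr x) (io M tr y) = tr.τ (star x * y) := by
  rw [io_mk M tr x hx, io_mk M tr y hy, LinearIsometry.inner_map_map]; rfl

theorem io_norm_sq {x : H →L[ℂ] H} (hx : x ∈ M) : ‖io M tr x‖ ^ 2 = (tr.τ (star x * x)).re := by
  rw [← io_inner tr hx hx, @norm_sq_eq_re_inner ℂ]; rfl

theorem io_norm {x : H →L[ℂ] H} (hx : x ∈ M) : ‖io M tr x‖ = tr.norm2 x := by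
  rw [TraceOn.norm2, ← io_norm_sq tr hx, Real.sqrt_sq (norm_nonneg _)]

theorem io_inj {x : H →L[ℂ] H} (hx : x ∈ M) (h : io M tr x = 0) : x = 0 := by
  apply tr.faithful x hx
  rw [← io_inner tr hx hx, h, inner_zero_left]

theorem io_inj2 {x y : H →L[ℂ] H} (hx : x ∈ M) (hy : y ∈ M) (h : io M tr x = io M tr y) :
    x = y := by
  rw [← sub_eq_zero]
  apply io_inj tr (sub_mem hx hy)
  rw [map_sub, h, sub_self]

theorem io_one_norm : ‖io M tr 1‖ = 1 := by
  have := io_norm_sq tr (one_mem M)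
  rw [star_one, one_mul, tr.unital, Complex.one_re] at this
  nlinarith [norm_nonneg (io M tr 1)]

theorem io_induction (p : L2 M tr → Prop) (hp : IsClosed {k | p k})
    (h : ∀ x ∈ M, p (io M tr x)) (k : L2 M tr) : p k := by
  refine (L2.coe_dense M tr).induction_on k hp fun a => ?_
  have := h _ (L2pre.val_mem M tr a)
  rw [io_mk M tr _ (L2pre.val_mem M tr a)] at this
  exact this

theorem io_dense (k : L2 M tr) {ε : ℝ} (hε : 0 < ε) : ∃ x ∈ M, ‖k - io M tr x‖ < ε := by
  obtain ⟨a, ha⟩ := (L2.coe_dense M tr).exists_dist_lt k hε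
  refine ⟨L2pre.val M tr a, L2pre.val_mem M tr a, ?_⟩
  rw [io_mk M tr _ (L2pre.val_mem M tr a), ← dist_eq_norm]
  exact ha

theorem io_ext {V : Type*} [NormedAddCommGroup V] [NormedSpace ℂ V] {S T : L2 M tr →L[ℂ] V}
    (h : ∀ x ∈ M, S (io M tr x) = T (io M tr x)) : S = T := by
  ext k
  exact io_induction tr (fun k => S k = T k) (isClosed_eq S.continuous T.continuous) h k

/-! ### positivity -/

theorem exists_sqrt (N : VonNeumannAlgebra H) {x : H →L[ℂ] H} (hx : x ∈ N) (h : 0 ≤ x) :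
    ∃ s ∈ N, star s = s ∧ s * s = x := by
  refine ⟨cfc Real.sqrt x, vn_cfc_mem N hx _, ?_, ?_⟩
  · exact (cfc_predicate Real.sqrt x : IsSelfAdjoint _).star_eq
  · rw [← cfc_mul _ _ x (by fun_prop) (by fun_prop)]
    have hsa : IsSelfAdjoint x := IsSelfAdjoint.of_nonneg h
    conv_rhs => rw [← cfc_id' ℝ x]
    apply cfc_congr
    intro t ht
    exact Real.mul_self_sqrt (spectrum_nonneg_of_nonneg h ht)

theorem tau_nonneg {x : H →L[ℂ] H} (hx : x ∈ M) (h : 0 ≤ x) :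
    0 ≤ (tr.τ x).re ∧ (tr.τ x).im = 0 := by
  obtain ⟨s, hs, h1, h2⟩ := exists_sqrt M hx h
  have := tr.nonneg s hs
  rwa [h1, h2] at this

theorem tau_mono {x y : H →L[ℂ] H} (hx : x ∈ M) (hy : y ∈ M) (h : x ≤ y) :
    (tr.τ x).re ≤ (tr.τ y).re := by
  have := (tau_nonneg tr (sub_mem hy hx) (sub_nonneg.2 h)).1
  rw [map_sub, Complex.sub_re] at this
  linarith

theorem tau_eq_zero {x : H →L[ℂ] H} (hx : x ∈ M) (h : 0 ≤ x) (h0 : (tr.τ x).re = 0) : x = 0 := by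
  obtain ⟨s, hs, h1, h2⟩ := exists_sqrt M hx h
  have h3 := tau_nonneg tr hx h
  have : s = 0 := by
    apply tr.faithful s hs
    rw [h1, h2]
    exact Complex.ext h0 h3.2
  rw [← h2, this, zero_mul]

theorem tau_real {x : H →L[ℂ] H} (hx : x ∈ M) (h : star x = x) : tr.τ x = ((tr.τ x).re : ℂ) := by
  have := tr.star_eq x hx
  rw [h] at this
  exact (Complex.conj_eq_iff_real.1 this.symm).elim fun r hr => by rw [hr]; simp

theorem tau_rsmul (c : ℝ) (x : H →L[ℂ] H) : tr.τ (c • x) = c * tr.τ x := by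
  have e : (c : ℂ) • x = c • x := by
    ext v; simp
  rw [← e, map_smul, smul_eq_mul]

theorem tau_rsmul_re (c : ℝ) (x : H →L[ℂ] H) : (tr.τ (c • x)).re = c * (tr.τ x).re := by
  rw [tau_rsmul]; simp

theorem tau_algebraMap (c : ℝ) : (tr.τ (algebraMap ℝ _ c)).re = c := by
  rw [Algebra.algebraMap_eq_smul_one, tau_rsmul_re, tr.unital]; simp

theorem algMap_mem (N : VonNeumannAlgebra H) (c : ℝ) : algebraMap ℝ (H →L[ℂ] H) c ∈ N := by
  rw [Algebra.algebraMap_eq_smul_one]; exact vn_rsmul_mem N c (one_mem N)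

theorem star_mul_le (y : H →L[ℂ] H) : star y * y ≤ algebraMap ℝ _ (‖y‖ ^ 2) :=
  CStarAlgebra.star_mul_le_algebraMap_norm_sq

theorem io_norm_mul_left {x y : H →L[ℂ] H} (hx : x ∈ M) (hy : y ∈ M) :
    ‖io M tr (y * x)‖ ≤ ‖y‖ * ‖io M tr x‖ := by
  apply le_of_sq_le_sq _ (by positivity)
  rw [mul_pow, io_norm_sq tr (mul_mem hy hx), io_norm_sq tr hx, ← tau_rsmul_re]
  apply tau_mono tr
  · exact mul_mem (star_mem (mul_mem hy hx)) (mul_mem hy hx)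
  · exact vn_rsmul_mem M _ (mul_mem (star_mem hx) hx)
  have := star_left_conjugate_le_conjugate (star_mul_le y) x
  rw [Algebra.algebraMap_eq_smul_one] at this
  simpa [mul_assoc] using this

theorem io_norm_star {x : H →L[ℂ] H} (hx : x ∈ M) : ‖io M tr (star x)‖ = ‖io M tr x‖ := by
  have h : ‖io M tr (star x)‖ ^ 2 = ‖io M tr x‖ ^ 2 := by
    rw [io_norm_sq tr hx, io_norm_sq tr (star_mem hx), star_star, tr.tracial x hx _ (star_mem hx)]
  exact (sq_eq_sq₀ (norm_nonneg _) (norm_nonneg _)).1 h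

theorem io_norm_mul_right {x y : H →L[ℂ] H} (hx : x ∈ M) (hy : y ∈ M) :
    ‖io M tr (x * y)‖ ≤ ‖y‖ * ‖io M tr x‖ := by
  rw [← io_norm_star tr (mul_mem hx hy), star_mul, ← io_norm_star tr hx, ← norm_star y]
  exact io_norm_mul_left tr (star_mem hx) (star_mem hy)

theorem io_norm_le {x : H →L[ℂ] H} (hx : x ∈ M) : ‖io M tr x‖ ≤ ‖x‖ := by
  have := io_norm_mul_left tr (one_mem M) hx
  rwa [mul_one, io_one_norm, mul_one] at this

/-- Left multiplication on the pre-Hilbert space. -/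
def preL (y : H →L[ℂ] H) (hy : y ∈ M) : L2pre M tr →L[ℂ] L2pre M tr :=
  LinearMap.mkContinuous
    { toFun := fun x => L2pre.mk M tr (y * L2pre.val M tr x) (mul_mem hy (L2pre.val_mem M tr x))
      map_add' := fun a b => by
        apply L2pre.val_inj; simp only [L2pre.val_mk, map_add, mul_add]
      map_smul' := fun c a => by
        apply L2pre.val_inj; simp only [L2pre.val_mk, map_smul, mul_smul_comm, RingHom.id_apply] }
    ‖y‖ (fun x => by
      have := io_norm_mul_left tr (L2pre.val_mem M tr x) hy
      rw [io_mk M tr _ (mul_mem hy (L2pre.val_mem M tr x)), io_mk M tr _ (L2pre.val_mem M tr x),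
        LinearIsometry.norm_map, LinearIsometry.norm_map] at this
      exact this)

/-- Right multiplication on the pre-Hilbert space. -/
def preR (y : H →L[ℂ] H) (hy : y ∈ M) : L2pre M tr →L[ℂ] L2pre M tr :=
  LinearMap.mkContinuous
    { toFun := fun x => L2pre.mk M tr (L2pre.val M tr x * y) (mul_mem (L2pre.val_mem M tr x) hy)
      map_add' := fun a b => by
        apply L2pre.val_inj; simp only [L2pre.val_mk, map_add, add_mul]
      map_smul' := fun c a => by
        apply L2pre.val_inj; simp only [L2pre.val_mk, map_smul, smul_mul_assoc, RingHom.id_apply] }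
    ‖y‖ (fun x => by
      have := io_norm_mul_right tr (L2pre.val_mem M tr x) hy
      rw [io_mk M tr _ (mul_mem (L2pre.val_mem M tr x) hy), io_mk M tr _ (L2pre.val_mem M tr x),
        LinearIsometry.norm_map, LinearIsometry.norm_map] at this
      exact this)

/-- Extension to the completion. -/
def complMap (T : L2pre M tr →L[ℂ] L2pre M tr) : L2 M tr →L[ℂ] L2 M tr := T.completion

theorem complMap_coe (T : L2pre M tr →L[ℂ] L2pre M tr) (x : L2pre M tr) :
    complMap tr T (L2.coe M tr x) = L2.coe M tr (T x) :=
  UniformSpace.Completion.map_coe T.uniformContinuous _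

/-- Left multiplication. -/
def lam (y : H →L[ℂ] H) : L2 M tr →L[ℂ] L2 M tr :=
  if hy : y ∈ M then complMap tr (preL tr y hy) else 0

/-- Right multiplication. -/
def rho (y : H →L[ℂ] H) : L2 M tr →L[ℂ] L2 M tr :=
  if hy : y ∈ M then complMap tr (preR tr y hy) else 0

theorem lam_io {x y : H →L[ℂ] H} (hy : y ∈ M) (hx : x ∈ M) :
    lam tr y (io M tr x) = io M tr (y * x) := by
  rw [lam, dif_pos hy, io_mk M tr x hx, io_mk M tr _ (mul_mem hy hx), complMap_coe]
  rfl

theorem rho_io {x y : H →L[ℂ] H} (hy : y ∈ M) (hx : x ∈ M) :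
    rho tr y (io M tr x) = io M tr (x * y) := by
  rw [rho, dif_pos hy, io_mk M tr x hx, io_mk M tr _ (mul_mem hx hy), complMap_coe]
  rfl

theorem lam_norm {y : H →L[ℂ] H} (hy : y ∈ M) (k : L2 M tr) : ‖lam tr y k‖ ≤ ‖y‖ * ‖k‖ := by
  refine io_induction tr (fun k => ‖lam tr y k‖ ≤ ‖y‖ * ‖k‖)
    (isClosed_le (by fun_prop) (by fun_prop)) (fun x hx => ?_) k
  rw [lam_io tr hy hx]; exact io_norm_mul_left tr hx hy

theorem rho_norm {y : H →L[ℂ] H} (hy : y ∈ M) (k : L2 M tr) : ‖rho tr y k‖ ≤ ‖y‖ * ‖k‖ := by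
  refine io_induction tr (fun k => ‖rho tr y k‖ ≤ ‖y‖ * ‖k‖)
    (isClosed_le (by fun_prop) (by fun_prop)) (fun x hx => ?_) k
  rw [rho_io tr hy hx]; exact io_norm_mul_right tr hx hy

theorem lam_one : lam tr (1 : H →L[ℂ] H) = 1 := by
  apply io_ext; intro x hx; rw [lam_io tr (one_mem M) hx, one_mul]; rfl

theorem rho_one : rho tr (1 : H →L[ℂ] H) = 1 := by
  apply io_ext; intro x hx; rw [rho_io tr (one_mem M) hx, mul_one]; rfl

theorem lam_mul {y z : H →L[ℂ] H} (hy : y ∈ M) (hz : z ∈ M) (k : L2 M tr) :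
    lam tr y (lam tr z k) = lam tr (y * z) k := by
  have : (lam tr y).comp (lam tr z) = lam tr (y * z) := by
    apply io_ext; intro x hx
    rw [ContinuousLinearMap.comp_apply, lam_io tr hz hx, lam_io tr hy (mul_mem hz hx),
      lam_io tr (mul_mem hy hz) hx, mul_assoc]
  rw [← this]; rfl

theorem rho_mul {y z : H →L[ℂ] H} (hy : y ∈ M) (hz : z ∈ M) (k : L2 M tr) :
    rho tr y (rho tr z k) = rho tr (z * y) k := by
  have : (rho tr y).comp (rho tr z) = rho tr (z * y) := by
    apply io_ext; intro x hx
    rw [ContinuousLinearMap.comp_apply, rho_io tr hz hx, rho_io tr hy (mul_mem hx hz),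
      rho_io tr (mul_mem hz hy) hx, mul_assoc]
  rw [← this]; rfl

theorem lam_rho {y z : H →L[ℂ] H} (hy : y ∈ M) (hz : z ∈ M) (k : L2 M tr) :
    lam tr y (rho tr z k) = rho tr z (lam tr y k) := by
  have : (lam tr y).comp (rho tr z) = (rho tr z).comp (lam tr y) := by
    apply io_ext; intro x hx
    rw [ContinuousLinearMap.comp_apply, ContinuousLinearMap.comp_apply, rho_io tr hz hx,
      lam_io tr hy (mul_mem hx hz), lam_io tr hy hx, rho_io tr hz (mul_mem hy hx), mul_assoc]
  exact congrArg (fun T : L2 M tr →L[ℂ] L2 M tr => T k) this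

theorem lam_inner {y : H →L[ℂ] H} (hy : y ∈ M) (k l : L2 M tr) :
    inner ℂ (lam tr y k) l = inner ℂ k (lam tr (star y) l) := by
  refine io_induction tr (fun k => inner ℂ (lam tr y k) l = inner ℂ k (lam tr (star y) l))
    (isClosed_eq (by fun_prop) (by fun_prop)) (fun x hx => ?_) k
  refine io_induction tr (fun l => inner ℂ (lam tr y (io M tr x)) l =
    inner ℂ (io M tr x) (lam tr (star y) l))
    (isClosed_eq (by fun_prop) (by fun_prop)) (fun z hz => ?_) l
  rw [lam_io tr hy hx, lam_io tr (star_mem hy) hz, io_inner tr (mul_mem hy hx) hz,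
    io_inner tr hx (mul_mem (star_mem hy) hz), star_mul, mul_assoc]

theorem rho_inner {y : H →L[ℂ] H} (hy : y ∈ M) (k l : L2 M tr) :
    inner ℂ (rho tr y k) l = inner ℂ k (rho tr (star y) l) := by
  refine io_induction tr (fun k => inner ℂ (rho tr y k) l = inner ℂ k (rho tr (star y) l))
    (isClosed_eq (by fun_prop) (by fun_prop)) (fun x hx => ?_) k
  refine io_induction tr (fun l => inner ℂ (rho tr y (io M tr x)) l =
    inner ℂ (io M tr x) (rho tr (star y) l))
    (isClosed_eq (by fun_prop) (by fun_prop)) (fun z hz => ?_) l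
  rw [rho_io tr hy hx, rho_io tr (star_mem hy) hz, io_inner tr (mul_mem hx hy) hz,
    io_inner tr hx (mul_mem hz (star_mem hy)), star_mul, mul_assoc,
    tr.tracial _ (star_mem hy) _ (mul_mem (star_mem hx) hz), mul_assoc]

theorem lam_adj {y : H →L[ℂ] H} (hy : y ∈ M) :
    ContinuousLinearMap.adjoint (lam tr y) = lam tr (star y) := by
  symm
  rw [ContinuousLinearMap.eq_adjoint_iff]
  intro k l
  rw [lam_inner tr (star_mem hy), star_star]

theorem tau_norm_le {x : H →L[ℂ] H} (hx : x ∈ M) : ‖tr.τ x‖ ≤ ‖x‖ := by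
  have h := norm_inner_le_norm (𝕜 := ℂ) (io M tr 1) (io M tr x)
  rw [io_inner tr (one_mem M) hx, star_one, one_mul, io_one_norm, one_mul] at h
  exact h.trans (io_norm_le tr hx)

end traceL2
end CD

namespace CD

section exhaustion

theorem exhaust {α : Type*} (r : α → α → Prop) (hrefl : ∀ a, r a a)
    (htrans : ∀ a b c, r a b → r b c → r a c)
    (φ : α → ℝ) (B : ℝ) (hB : ∀ a, φ a ≤ B) (hmono : ∀ a b, r a b → φ a ≤ φ b)
    (hseq : ∀ s : ℕ → α, (∀ n, r (s n) (s (n + 1))) → ∃ u, ∀ n, r (s n) u) (a₀ : α) :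
    ∃ a, r a₀ a ∧ ∀ b, r a b → φ b = φ a := by
  have hnext : ∀ a, ∃ b, r a b ∧ ∀ c, r a c → φ c ≤ 2 * φ b - φ a := by
    intro a
    set S := sSup {t | ∃ c, r a c ∧ φ c = t} with hS
    have hbdd : BddAbove {t | ∃ c, r a c ∧ φ c = t} := ⟨B, by rintro _ ⟨c, _, rfl⟩; exact hB c⟩
    have hne : {t | ∃ c, r a c ∧ φ c = t}.Nonempty := ⟨φ a, a, hrefl a, rfl⟩
    have hle : ∀ c, r a c → φ c ≤ S := fun c hc => le_csSup hbdd ⟨c, hc, rfl⟩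
    rcases (hle a (hrefl a)).eq_or_lt with h | h
    · exact ⟨a, hrefl a, fun c hc => by have := hle c hc; linarith⟩
    · obtain ⟨_, ⟨b, hb, rfl⟩, hb2⟩ := exists_lt_of_lt_csSup hne
        (show (φ a + S) / 2 < S by linarith)
      exact ⟨b, hb, fun c hc => by have := hle c hc; linarith⟩
  choose nx h1 h2 using hnext
  let s : ℕ → α := fun n => Nat.rec a₀ (fun _ a => nx a) n
  have hs : ∀ n, s (n + 1) = nx (s n) := fun n => rfl
  obtain ⟨u, hu⟩ := hseq s (fun n => by rw [hs]; exact h1 _)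
  refine ⟨u, hu 0, fun b hb => le_antisymm ?_ (hmono _ _ hb)⟩
  have hm : Monotone (fun n => φ (s n)) :=
    monotone_nat_of_le_succ fun n => hmono _ _ (by rw [hs]; exact h1 _)
  have hlim : Tendsto (fun n => φ (s n)) atTop (𝓝 (⨆ n, φ (s n))) :=
    tendsto_atTop_ciSup hm ⟨B, by rintro _ ⟨n, rfl⟩; exact hB _⟩
  have h3 : Tendsto (fun n => 2 * φ (s (n + 1)) - φ (s n)) atTop
      (𝓝 (2 * (⨆ n, φ (s n)) - ⨆ n, φ (s n))) :=
    ((hlim.comp (tendsto_add_atTop_nat 1)).const_mul 2).sub hlim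
  have h4 : φ b ≤ 2 * (⨆ n, φ (s n)) - ⨆ n, φ (s n) :=
    ge_of_tendsto' h3 fun n => by
      rw [hs]; exact h2 _ _ (htrans _ _ _ (hu n) hb)
  have h5 : (⨆ n, φ (s n)) ≤ φ u := le_of_tendsto' hlim fun n => hmono _ _ (hu n)
  linarith

end exhaustion

section partiso
variable {H : Type} [NormedAddCommGroup H] [InnerProductSpace ℂ H] [CompleteSpace H]

theorem mulA (x y : H →L[ℂ] H) (v : H) : (x * y) v = x (y v) := rfl

theorem oneA (v : H) : (1 : H →L[ℂ] H) v = v := rfl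

theorem inner_star_left (x : H →L[ℂ] H) (v w : H) : inner ℂ (star x v) w = inner ℂ v (x w) := by
  rw [ContinuousLinearMap.star_eq_adjoint, ContinuousLinearMap.adjoint_inner_left]

theorem inner_star_right (x : H →L[ℂ] H) (v w : H) : inner ℂ v (star x w) = inner ℂ (x v) w := by
  rw [ContinuousLinearMap.star_eq_adjoint, ContinuousLinearMap.adjoint_inner_right]

theorem norm_sq_apply (x : H →L[ℂ] H) (v : H) : ‖x v‖ ^ 2 = (inner ℂ v ((star x * x) v)).re := by
  rw [@norm_sq_eq_re_inner ℂ, mulA, inner_star_right]; rfl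

theorem ext_quad {x y : H →L[ℂ] H} (h : ∀ v, inner ℂ v (x v) = inner ℂ v (y v)) : x = y := by
  have := (ext_inner_map (x : H →ₗ[ℂ] H) (y : H →ₗ[ℂ] H)).1 (fun v => by
    rw [← inner_conj_symm, ← inner_conj_symm (_ : H) v]
    exact congrArg _ (h v))
  ext v
  exact LinearMap.congr_fun this v

/-- `v` is a partial isometry -/
def IsPI (v : H →L[ℂ] H) : Prop := v * star v * v = v

theorem IsPI.star {v : H →L[ℂ] H} (h : IsPI v) : IsPI (star v) := by
  have := congrArg Star.star h
  simp only [IsPI, star_mul, star_star] at this ⊢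
  rwa [mul_assoc]

theorem IsPI.proj {v : H →L[ℂ] H} (h : IsPI v) :
    Star.star (Star.star v * v) = Star.star v * v ∧
      (Star.star v * v) * (Star.star v * v) = Star.star v * v := by
  refine ⟨by rw [star_mul, star_star], ?_⟩
  have : (Star.star v * v) * (Star.star v * v) = Star.star v * (v * Star.star v * v) := by
    simp only [mul_assoc]
  rw [this, h]

theorem isPI_of_proj {e : H →L[ℂ] H} (h1 : star e = e) (h2 : e * e = e) : IsPI e := by
  rw [IsPI, h1, h2, h2]

theorem eq_zero_of_star_mul {x : H →L[ℂ] H} (h : star x * x = 0) : x = 0 :=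
  CStarRing.star_mul_self_eq_zero_iff x |>.1 h

theorem pi_le {v w : H →L[ℂ] H} (hv : IsPI v) (hw : IsPI w) (h : w * (star v * v) = v) :
    (star w * w) * (star v * v) = star v * v := by
  have hev := hv.proj
  have hew := hw.proj
  set e := star v * v with he
  set f := star w * w with hf
  have h1 : e * f * e = e := by
    have : star (w * e) * (w * e) = e := by rw [h]
    rw [star_mul, hev.1] at this
    rw [hf]; simpa only [mul_assoc] using this
  have h2 : star ((1 - f) * e) * ((1 - f) * e) = 0 := by
    rw [star_mul, star_sub, star_one, hew.1, hev.1]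
    have : e * (1 - f) * ((1 - f) * e) = e * e - e * f * e - e * f * e + e * (f * f) * e := by
      noncomm_ring
    rw [this, hew.2, hev.2, h1]; abel
  have h3 := eq_zero_of_star_mul h2
  rw [sub_mul, one_mul, sub_eq_zero] at h3
  exact h3.symm

theorem pi_pyth {v w : H →L[ℂ] H} (hv : IsPI v) (hw : IsPI w) (h : w * (star v * v) = v) (x : H) :
    ‖w x‖ ^ 2 = ‖(w x - v x)‖ ^ 2 + ‖v x‖ ^ 2 := by
  have h1 := pi_le hv hw h
  have h2 : star v * w = star v * v := by
    have e1 : star v = (star v * v) * star w := by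
      conv_lhs => rw [← h]
      rw [star_mul, hv.proj.1]
    have e2 : (star v * v) * (star w * w) = star v * v := by
      have := congrArg Star.star h1
      rwa [star_mul, hv.proj.1, hw.proj.1] at this
    conv_lhs => rw [e1]
    rw [mul_assoc, e2]
  have h3 : inner ℂ (v x) (w x - v x) = 0 := by
    rw [← inner_star_right, map_sub]
    have := congrArg (fun T : H →L[ℂ] H => T x) h2
    simp only [mulA] at this
    rw [this, sub_self, inner_zero_right]
  have := norm_add_sq_eq_norm_sq_add_norm_sq_of_inner_eq_zero (𝕜 := ℂ) _ _ h3
  rw [add_sub_cancel] at this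
  rw [pow_two, pow_two, pow_two, this]; ring

theorem pi_norm_le {v : H →L[ℂ] H} (hv : IsPI v) (x : H) : ‖v x‖ ≤ ‖x‖ := by
  have h := pi_pyth (isPI_of_proj hv.proj.1 hv.proj.2) (isPI_of_proj (e := 1) (star_one _) (one_mul 1))
    (by rw [hv.proj.1, hv.proj.2, one_mul]) x
  have h2 : ‖v x‖ ^ 2 = ‖(star v * v) x‖ ^ 2 := by
    rw [norm_sq_apply, norm_sq_apply, hv.proj.1, hv.proj.2]
  rw [← h2] at h
  apply le_of_sq_le_sq _ (norm_nonneg _)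
  rw [oneA] at h
  rw [h]
  nlinarith [sq_nonneg ‖x - (star v * v) x‖]

theorem pi_seq_tendsto {v : ℕ → (H →L[ℂ] H)} (hv : ∀ n, IsPI (v n))
    (hle : ∀ n m, n ≤ m → v m * (star (v n) * v n) = v n) :
    ∃ w : H →L[ℂ] H, ∀ x, Tendsto (fun n => v n x) atTop (𝓝 (w x)) := by
  have hc : ∀ x, ∃ y, Tendsto (fun n => v n x) atTop (𝓝 y) := by
    intro x
    apply cauchySeq_tendsto_of_complete
    have hm : Monotone (fun n => ‖v n x‖ ^ 2) := by
      intro n m hnm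
      have := pi_pyth (hv n) (hv m) (hle n m hnm) x
      simp only
      rw [this]
      nlinarith [sq_nonneg ‖v m x - v n x‖]
    have hlim := tendsto_atTop_ciSup hm ⟨‖x‖ ^ 2, by
      rintro _ ⟨n, rfl⟩; exact pow_le_pow_left₀ (norm_nonneg _) (pi_norm_le (hv n) x) 2⟩
    have hcau := hlim.cauchySeq
    rw [Metric.cauchySeq_iff'] at hcau ⊢
    intro ε hε
    obtain ⟨n₀, hn₀⟩ := hcau (ε ^ 2) (by positivity)
    refine ⟨n₀, fun n hn => ?_⟩
    have h1 := hn₀ n hn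
    rw [Real.dist_eq, pi_pyth (hv n₀) (hv n) (hle n₀ n hn) x, add_sub_cancel_right,
      abs_of_nonneg (by positivity)] at h1
    rw [dist_eq_norm]
    exact lt_of_pow_lt_pow_left₀ 2 hε.le h1
  choose w hw using hc
  refine ⟨continuousLinearMapOfTendsto (l := atTop) v (f := w) ?_, fun x => hw x⟩
  rw [tendsto_pi_nhds]; exact hw

theorem pi_sup {v : ℕ → (H →L[ℂ] H)} (hv : ∀ n, IsPI (v n))
    (hle : ∀ n, v (n + 1) * (star (v n) * v n) = v n) :
    ∃ w : H →L[ℂ] H, (∀ x, Tendsto (fun n => v n x) atTop (𝓝 (w x))) ∧ IsPI w ∧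
      ∀ n, w * (star (v n) * v n) = v n := by
  have hle' : ∀ n m, n ≤ m → v m * (star (v n) * v n) = v n := by
    intro n m hnm
    induction m, hnm using Nat.le_induction with
    | base => rw [← mul_assoc]; exact hv n
    | succ m hm ih =>
      have h1 := pi_le (hv n) (hv m) ih
      calc v (m + 1) * (star (v n) * v n) = v (m + 1) * ((star (v m) * v m) * (star (v n) * v n)) := by
            rw [h1]
        _ = v m * (star (v n) * v n) := by rw [← mul_assoc, hle m]
        _ = v n := ih
  obtain ⟨w, hw⟩ := pi_seq_tendsto hv hle'
  have hev : ∀ n, IsPI (star (v n) * v n) := fun n => isPI_of_proj (hv n).proj.1 (hv n).proj.2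
  obtain ⟨e, he⟩ := pi_seq_tendsto hev (fun n m hnm => by
    rw [(hv n).proj.1, (hv n).proj.2]; exact pi_le (hv n) (hv m) (hle' n m hnm))
  have hwv : ∀ n, w * (star (v n) * v n) = v n := by
    intro n
    ext x
    refine tendsto_nhds_unique (hw ((star (v n) * v n) x)) ?_
    refine tendsto_const_nhds.congr' ?_
    filter_upwards [eventually_ge_atTop n] with m hm
    exact (congrArg (fun T : H →L[ℂ] H => T x) (hle' n m hm)).symm
  have hwe : w * e = w := by
    ext x
    refine tendsto_nhds_unique ((w.continuous.tendsto _).comp (he x)) ((hw x).congr fun n => ?_)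
    exact (congrArg (fun T : H →L[ℂ] H => T x) (hwv n)).symm
  have hww : star w * w = e := by
    apply ext_quad
    intro x
    have h1 : Tendsto (fun n => inner ℂ x ((star (v n) * v n) x)) atTop (𝓝 (inner ℂ x (e x))) :=
      (tendsto_const_nhds).inner (he x)
    have h2 : Tendsto (fun n => inner ℂ (v n x) (v n x)) atTop (𝓝 (inner ℂ (w x) (w x))) :=
      (hw x).inner (hw x)
    rw [mulA, inner_star_right]
    refine tendsto_nhds_unique h2 (h1.congr fun n => ?_)
    rw [mulA, inner_star_right]
  refine ⟨w, hw, ?_, hwv⟩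
  rw [IsPI, mul_assoc, hww, hwe]

end partiso
end CD

namespace CD

section comparison
variable {H : Type} [NormedAddCommGroup H] [InnerProductSpace ℂ H] [CompleteSpace H]

theorem factor_connect (M : VonNeumannAlgebra H) (hM : IsFactorSet (M : Set (H →L[ℂ] H)))
    {p q : H →L[ℂ] H} (hp : p ∈ M) (hp0 : p ≠ 0) (hq0 : q ≠ 0) :
    ∃ y ∈ M, q * y * p ≠ 0 := by
  by_contra hcon
  push Not at hcon
  set V : Submodule ℂ H := (Submodule.span ℂ {v | ∃ y ∈ M, ∃ w, v = y (p w)}).topologicalClosure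
    with hV
  have inv : ∀ T : H →L[ℂ] H, (∀ y ∈ M, ∀ w, T (y (p w)) ∈
      Submodule.span ℂ {v | ∃ y ∈ M, ∃ w, v = y (p w)}) → ∀ v ∈ V, T v ∈ V := by
    intro T hT v hv
    have h1 : Submodule.span ℂ {v | ∃ y ∈ M, ∃ w, v = y (p w)} ≤ V.comap (T : H →ₗ[ℂ] H) := by
      rw [Submodule.span_le]
      rintro _ ⟨y, hy, w, rfl⟩
      exact Submodule.le_topologicalClosure _ (hT y hy w)
    exact Submodule.topologicalClosure_minimal _ h1
      (IsClosed.preimage T.continuous (Submodule.isClosed_topologicalClosure _)) hv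
  have hz1 : V.starProjection ∈ M := by
    apply proj_mem_of_invariant
    intro T hT
    apply inv
    intro y hy w
    refine Submodule.subset_span ⟨y, hy, T w, ?_⟩
    have := vn_comm M (mul_mem hy hp) hT
    exact (congrArg (fun S : H →L[ℂ] H => S w) this).symm
  have hz2 : V.starProjection ∈ M.commutant := by
    apply proj_mem_of_invariant
    intro T hT
    rw [VonNeumannAlgebra.commutant_commutant] at hT
    apply inv
    intro y hy w
    exact Submodule.subset_span ⟨T * y, mul_mem hT hy, w, rfl⟩
  obtain ⟨c, hc⟩ := hM _ hz1 (fun y hy => (vn_comm M hy hz2).symm)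
  have hzp : V.starProjection * p = p := by
    ext w
    change V.starProjection (p w) = p w
    rw [Submodule.starProjection_eq_self_iff]
    exact Submodule.le_topologicalClosure _ (Submodule.subset_span ⟨1, one_mem M, w, rfl⟩)
  have hqz : q * V.starProjection = 0 := by
    ext w
    change q (V.starProjection w) = 0
    have h1 : V ≤ LinearMap.ker (q : H →ₗ[ℂ] H) := by
      refine Submodule.topologicalClosure_minimal _ ?_ q.isClosed_ker
      rw [Submodule.span_le]
      rintro _ ⟨y, hy, w, rfl⟩
      exact congrArg (fun S : H →L[ℂ] H => S w) (hcon y hy)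
    exact h1 (Submodule.starProjection_apply_mem _ w)
  rw [hc, mul_smul_comm, mul_one] at hqz
  rw [hc, smul_mul_assoc, one_mul] at hzp
  have hc0 : c = 0 := (smul_eq_zero.1 hqz).resolve_right hq0
  rw [hc0, zero_smul] at hzp
  exact hp0 hzp.symm

/-- from a nonzero element get a nonzero partial isometry -/
theorem exists_pi (M : VonNeumannAlgebra H) {x p q : H →L[ℂ] H} (hx : x ∈ M) (hx0 : x ≠ 0)
    (hps : star p = p) (hxp : x * p = x) (hqx : q * x = x) :
    ∃ v ∈ M, v ≠ 0 ∧ IsPI v ∧ v * p = v ∧ q * v = v := by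
  set h := star x * x with hh
  have hhm : h ∈ M := mul_mem (star_mem hx) hx
  have hnn : 0 ≤ h := star_mul_self_nonneg x
  have hsa : IsSelfAdjoint h := IsSelfAdjoint.of_nonneg hnn
  have hh0 : h ≠ 0 := fun h' => hx0 (eq_zero_of_star_mul h')
  set c := ‖h‖ / 2 with hc
  have hc0 : 0 < c := by have := norm_pos_iff.2 hh0; positivity
  set P : H →L[ℂ] H := cfc (fun t : ℝ => max (t - c) 0) h with hP
  have hP0 : P ≠ 0 := by
    intro h0
    have h1 : h ≤ algebraMap ℝ _ c := by
      rw [le_algebraMap_iff_spectrum_le]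
      intro t ht
      by_contra hlt
      push Not at hlt
      have h2 : (fun t : ℝ => max (t - c) 0) t ∈ spectrum ℝ P := by
        rw [hP, cfc_map_spectrum (R := ℝ) (fun t : ℝ => max (t - c) 0) h hsa (by fun_prop)]
        exact ⟨t, ht, rfl⟩
      rw [h0] at h2
      have hnt : Nontrivial (H →L[ℂ] H) := ⟨h, 0, hh0⟩
      rw [spectrum.zero_eq] at h2
      simp only [Set.mem_singleton_iff] at h2
      have := le_max_left (t - c) 0
      linarith
    have h3 := (CStarAlgebra.norm_le_iff_le_algebraMap h hc0.le hnn).2 h1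
    have := norm_pos_iff.2 hh0
    linarith
  set e := rp P with he
  have hPm : P ∈ M := vn_cfc_mem M hhm _
  have heM : e ∈ M := rp_mem M hPm
  have hes : star e = e := rp_star P
  have hee : e * e = e := rp_idem P
  have he0 : e ≠ 0 := fun h' => hP0 (rp_eq_zero h')
  have hcont : Continuous (fun t : ℝ => (Real.sqrt (max t c))⁻¹) :=
    Continuous.inv₀ (by fun_prop) (fun t => (Real.sqrt_pos.2 (lt_of_lt_of_le hc0 (le_max_right _ _))).ne')
  have hcont2 : Continuous (fun t : ℝ => t / max t c) :=
    Continuous.div (by fun_prop) (by fun_prop) (fun t => (lt_of_lt_of_le hc0 (le_max_right _ _)).ne')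
  have hcont3 : Continuous (fun t : ℝ => max (t - c) 0 / max t c) :=
    Continuous.div (by fun_prop) (by fun_prop) (fun t => (lt_of_lt_of_le hc0 (le_max_right _ _)).ne')
  set k : H →L[ℂ] H := cfc (fun t : ℝ => (Real.sqrt (max t c))⁻¹) h with hk
  have hks : star k = k := (cfc_predicate _ h : IsSelfAdjoint _).star_eq
  set g : H →L[ℂ] H := cfc (fun t : ℝ => t / max t c) h with hg
  have hkhk : k * h * k = g := by
    have e1 : k * cfc (fun t : ℝ => t) h * k = g := by
      rw [hk, hg, ← cfc_mul _ _ h hcont.continuousOn (by fun_prop),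
        ← cfc_mul _ _ h (by fun_prop) hcont.continuousOn]
      apply cfc_congr
      intro t _
      have hm : 0 < max t c := lt_of_lt_of_le hc0 (le_max_right _ _)
      simp only
      have h5 : (√(max t c))⁻¹ * (√(max t c))⁻¹ = (max t c)⁻¹ := by
        rw [← mul_inv, Real.mul_self_sqrt hm.le]
      rw [mul_comm ((√(max t c))⁻¹) t, mul_assoc, h5, div_eq_mul_inv]
    rwa [cfc_id' ℝ h] at e1
  have hgP : g * P = P := by
    rw [hg, hP, ← cfc_mul _ _ h hcont2.continuousOn (by fun_prop)]
    apply cfc_congr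
    intro t _
    simp only
    rcases le_total t c with h' | h'
    · rw [max_eq_right (sub_nonpos.2 h')]; simp
    · rw [max_eq_left (a := t) h', div_self (lt_of_lt_of_le hc0 h').ne', one_mul]
  have hge : g * e = e := mul_rp_of_mul_eq_self hgP
  have hpe : p * e = e := by
    apply mul_rp_of_mul_eq_self
    have : P = h * cfc (fun t : ℝ => max (t - c) 0 / max t c) h := by
      have e1 : P = cfc (fun t : ℝ => t) h * cfc (fun t : ℝ => max (t - c) 0 / max t c) h := by
        rw [← cfc_mul _ _ h (by fun_prop) hcont3.continuousOn, hP]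
        apply cfc_congr
        intro t _
        simp only
        rcases le_total t c with h | h
        · rw [max_eq_right (sub_nonpos.2 h)]; simp
        · rw [max_eq_left h]
          field_simp [(lt_of_lt_of_le hc0 h).ne']
      rwa [cfc_id' ℝ h] at e1
    have hph : p * h = h := by
      have := congrArg star hxp
      rw [star_mul, hps] at this
      rw [hh, ← mul_assoc, this]
    rw [this, ← mul_assoc, hph]
  have hep : e * p = e := by
    have := congrArg star hpe
    rwa [star_mul, hps, hes] at this
  have hvv : star (x * k * e) * (x * k * e) = e := by
    have : star (x * k * e) * (x * k * e) = e * ((k * h * k) * e) := by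
      rw [star_mul, star_mul, hes, hks, hh]; simp only [mul_assoc]
    rw [this, hkhk, hge, hee]
  refine ⟨x * k * e, mul_mem (mul_mem hx (vn_cfc_mem M hhm _)) heM, ?_, ?_, ?_, ?_⟩
  · intro h0
    rw [h0, mul_zero] at hvv
    exact he0 hvv.symm
  · rw [IsPI, mul_assoc, hvv, mul_assoc, hee]
  · rw [mul_assoc, hep]
  · rw [← mul_assoc, ← mul_assoc, hqx]

theorem pi_add {v w : H →L[ℂ] H} (hv : IsPI v) (hw : IsPI w) (h1 : star v * w = 0)
    (h2 : v * star w = 0) : IsPI (v + w) := by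
  have h3 : star w * v = 0 := by
    have := congrArg star h1
    rwa [star_mul, star_star, star_zero] at this
  have h4 : w * star v = 0 := by
    have := congrArg star h2
    rwa [star_mul, star_star, star_zero] at this
  unfold IsPI at *
  have : (v + w) * star (v + w) * (v + w) = v * star v * v + v * (star v * w) + (v * star w) * (v + w)
      + (w * star v) * (v + w) + w * (star w * v) + w * star w * w := by
    rw [star_add]; noncomm_ring
  rw [this, h1, h2, h3, h4, hv, hw]; simp

variable {M : VonNeumannAlgebra H} (tr : TraceOn H (M : Set (H →L[ℂ] H)))

theorem proj_tau_pos {p : H →L[ℂ] H} (hp : IsProjIn (M : Set (H →L[ℂ] H)) p) (h0 : p ≠ 0) :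
    0 < (tr.τ p).re := by
  have h1 := proj_nonneg hp.2.1 hp.2.2
  rcases (tau_nonneg tr hp.1 h1).1.eq_or_lt with h | h
  · exact absurd (tau_eq_zero tr hp.1 h1 h.symm) h0
  · exact h

theorem compl_proj {p q : H →L[ℂ] H} (hp : IsProjIn (M : Set (H →L[ℂ] H)) p)
    (hq : IsProjIn (M : Set (H →L[ℂ] H)) q) (h : p * q = q) :
    IsProjIn (M : Set (H →L[ℂ] H)) (p - q) := by
  have h' : q * p = q := by
    have := congrArg star h
    rwa [star_mul, hp.2.1, hq.2.1] at this
  refine ⟨sub_mem (SetLike.mem_coe.1 hp.1) (SetLike.mem_coe.1 hq.1), by rw [star_sub, hp.2.1, hq.2.1], ?_⟩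
  rw [sub_mul, mul_sub, mul_sub, hp.2.2, hq.2.2, h, h']; abel

theorem proj_le_one_tau {p : H →L[ℂ] H} (hp : IsProjIn (M : Set (H →L[ℂ] H)) p) :
    (tr.τ p).re ≤ 1 := by
  have h := compl_proj (M := M) ⟨one_mem M, star_one _, one_mul 1⟩ hp (one_mul p)
  have := (tau_nonneg tr h.1 (proj_nonneg h.2.1 h.2.2)).1
  rw [map_sub, tr.unital, Complex.sub_re, Complex.one_re] at this
  linarith

theorem isPI_projIn {v : H →L[ℂ] H} (hv : v ∈ M) (h : IsPI v) :
    IsProjIn (M : Set (H →L[ℂ] H)) (star v * v) := ⟨mul_mem (star_mem hv) hv, h.proj.1, h.proj.2⟩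

theorem comparison (tr : TraceOn H (M : Set (H →L[ℂ] H))) (hM : IsFactorSet (M : Set (H →L[ℂ] H))) {p q : H →L[ℂ] H}
    (hp : IsProjIn (M : Set (H →L[ℂ] H)) p) (hq : IsProjIn (M : Set (H →L[ℂ] H)) q) :
    ∃ v ∈ M, IsPI v ∧ v * p = v ∧ q * v = v ∧ (star v * v = p ∨ v * star v = q) := by
  let α := {v : H →L[ℂ] H // v ∈ M ∧ IsPI v ∧ v * p = v ∧ q * v = v}
  obtain ⟨a, -, ha⟩ := exhaust (α := α) (fun v w => w.1 * (star v.1 * v.1) = v.1)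
    (fun v => by rw [← mul_assoc]; exact v.2.2.1)
    (fun a b c hab hbc => by
      have h1 := pi_le a.2.2.1 b.2.2.1 hab
      have : c.1 * (star a.1 * a.1) = (c.1 * (star b.1 * b.1)) * (star a.1 * a.1) := by
        rw [mul_assoc, h1]
      rw [this, hbc, hab])
    (fun v => (tr.τ (star v.1 * v.1)).re) 1
    (fun v => proj_le_one_tau tr (isPI_projIn v.2.1 v.2.2.1))
    (fun v w h => by
      have h1 := compl_proj (isPI_projIn w.2.1 w.2.2.1) (isPI_projIn v.2.1 v.2.2.1)
        (pi_le v.2.2.1 w.2.2.1 h)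
      have := (tau_nonneg tr h1.1 (proj_nonneg h1.2.1 h1.2.2)).1
      rw [map_sub, Complex.sub_re] at this
      linarith)
    (fun s hs => by
      obtain ⟨w, h1, h2, h3⟩ := pi_sup (v := fun n => (s n).1) (fun n => (s n).2.2.1) hs
      refine ⟨⟨w, vn_strong_limit M (fun n => (s n).2.1) h1, h2, ?_, ?_⟩, h3⟩
      · ext x
        refine tendsto_nhds_unique (h1 (p x)) ((h1 x).congr fun n => ?_)
        exact (congrArg (fun T : H →L[ℂ] H => T x) (s n).2.2.2.1).symm
      · ext x
        refine tendsto_nhds_unique ((q.continuous.tendsto _).comp (h1 x)) ((h1 x).congr fun n => ?_)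
        exact (congrArg (fun T : H →L[ℂ] H => T x) (s n).2.2.2.2).symm)
    ⟨0, zero_mem M, by simp [IsPI], by simp, by simp⟩
  obtain ⟨v, hvM, hv, hvp, hqv⟩ := a
  refine ⟨v, hvM, hv, hvp, hqv, ?_⟩
  by_contra hcon
  push Not at hcon
  have hpv : p * star v = star v := by
    have := congrArg star hvp
    rwa [star_mul, hp.2.1] at this
  have hvq : star v * q = star v := by
    have := congrArg star hqv
    rwa [star_mul, hq.2.1] at this
  have hp' := compl_proj hp (isPI_projIn hvM hv) (by rw [← mul_assoc, hpv])
  have hv2 := isPI_projIn (star_mem hvM) hv.star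
  rw [star_star] at hv2
  have hq' := compl_proj hq hv2 (by rw [← mul_assoc, hqv])
  obtain ⟨y, hy, hy0⟩ := factor_connect M hM hp'.1 (sub_ne_zero.2 hcon.1.symm)
    (sub_ne_zero.2 hcon.2.symm)
  obtain ⟨w, hwM, hw0, hw, hwp, hqw⟩ := exists_pi M (mul_mem (mul_mem hq'.1 hy) hp'.1) hy0
    (p := p - star v * v) (q := q - v * star v) hp'.2.1 (by rw [mul_assoc, hp'.2.2])
    (by rw [← mul_assoc, ← mul_assoc, hq'.2.2])
  have h1 : star v * w = 0 := by
    have : star v * (q - v * star v) = 0 := by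
      have h9 := hv.star
      rw [IsPI, star_star] at h9
      rw [mul_sub, hvq, ← mul_assoc, h9, sub_self]
    rw [← hqw, ← mul_assoc, this, zero_mul]
  have h2 : v * star w = 0 := by
    have e1 : (p - star v * v) * star w = star w := by
      have := congrArg star hwp
      rwa [star_mul, hp'.2.1] at this
    have e2 : v * (p - star v * v) = 0 := by
      rw [mul_sub, hvp, ← mul_assoc, hv, sub_self]
    rw [← e1, ← mul_assoc, e2, zero_mul]
  have h3 : w * star v = 0 := by
    have := congrArg star h2
    rwa [star_mul, star_star, star_zero] at this
  have h4 : star w * v = 0 := by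
    have := congrArg star h1
    rwa [star_mul, star_star, star_zero] at this
  have hwp2 : w * p = w := by
    have : w * (p - star v * v) * p = w * (p - star v * v) := by
      rw [mul_assoc, sub_mul, hp.2.2, mul_assoc, hvp]
    rwa [hwp] at this
  have hqw2 : q * w = w := by
    have : q * ((q - v * star v) * w) = (q - v * star v) * w := by
      rw [← mul_assoc, mul_sub, hq.2.2, ← mul_assoc, hqv]
    rwa [hqw] at this
  have hfin := ha ⟨v + w, add_mem hvM hwM, pi_add hv hw h1 h2, by rw [add_mul, hvp, hwp2],
    by rw [mul_add, hqv, hqw2]⟩ (by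
      simp only
      rw [add_mul, ← mul_assoc, ← mul_assoc, h3, zero_mul, add_zero]; exact hv)
  simp only at hfin
  have e3 : star (v + w) * (v + w) = star v * v + star w * w := by
    rw [star_add, add_mul, mul_add, mul_add, h1, h4]; abel
  rw [e3, map_add, Complex.add_re] at hfin
  have h5 := proj_tau_pos tr (isPI_projIn hwM hw) (fun h => hw0 (eq_zero_of_star_mul h))
  linarith

end comparison
end CD

namespace CD

section normality
variable {H : Type} [NormedAddCommGroup H] [InnerProductSpace ℂ H] [CompleteSpace H]

theorem spectral_compare (N : VonNeumannAlgebra H) (f g : (H →L[ℂ] H) →ₗ[ℝ] ℝ) (p : H →L[ℂ] H)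
    (hproj : ∀ e, IsProjIn (N : Set (H →L[ℂ] H)) e → p * e = e → f e ≤ g e)
    (hg : ∀ y ∈ N, 0 ≤ y → 0 ≤ g y)
    (hf : ∀ y ∈ N, ∀ c : ℝ, y ≤ algebraMap ℝ _ c → f y ≤ c)
    {x : H →L[ℂ] H} (hx : x ∈ N) (h0 : 0 ≤ x) (hpx : p * x = x) : f x ≤ g x := by
  have key : ∀ n : ℕ, f x ≤ g x + (‖x‖ + 1) / 2 ^ n := by
    intro n
    have h1 : x ≤ algebraMap ℝ _ (‖x‖ + 1) := by
      refine (IsSelfAdjoint.le_algebraMap_norm_self (IsSelfAdjoint.of_nonneg h0)).trans ?_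
      exact algebraMap_mono _ (by linarith)
    obtain ⟨e, w, hw, he, h2, h3⟩ := spectral_approx N n hx (‖x‖ + 1) (by positivity) h0 h1 p hpx
    have hmem : x - ∑ i, w i • e i ∈ N :=
      sub_mem hx (sum_mem fun i _ => vn_rsmul_mem N _ (he i).1.1)
    have h4 := hf _ hmem _ h3
    have h5 := hg _ hmem h2
    rw [map_sub, map_sum] at h4 h5
    simp only [map_smul, smul_eq_mul] at h4 h5
    have h6 : ∑ i, w i * f (e i) ≤ ∑ i, w i * g (e i) :=
      Finset.sum_le_sum fun i _ => mul_le_mul_of_nonneg_left (hproj _ (he i).1 (he i).2) (hw i)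
    linarith
  have hlim : Tendsto (fun n : ℕ => g x + (‖x‖ + 1) / 2 ^ n) atTop (𝓝 (g x + 0)) := by
    refine tendsto_const_nhds.add ?_
    have := (tendsto_pow_atTop_nhds_zero_of_lt_one (r := (1 / 2 : ℝ)) (by norm_num)
      (by norm_num)).const_mul (‖x‖ + 1)
    simpa [div_eq_mul_inv] using this
  rw [add_zero] at hlim
  exact ge_of_tendsto' hlim key

variable {M : VonNeumannAlgebra H} (tr : TraceOn H (M : Set (H →L[ℂ] H)))

theorem proj_exhaust (tr : TraceOn H (M : Set (H →L[ℂ] H))) (N : VonNeumannAlgebra H) (hNM : (N : Set (H →L[ℂ] H)) ⊆ M)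
    (P : (H →L[ℂ] H) → Prop) (hP0 : P 0)
    (hsup : ∀ (s : ℕ → (H →L[ℂ] H)) (e : H →L[ℂ] H),
      (∀ n, IsProjIn (N : Set (H →L[ℂ] H)) (s n) ∧ P (s n)) →
      IsProjIn (N : Set (H →L[ℂ] H)) e → (∀ n, e * s n = s n) →
      (∀ x, Tendsto (fun n => s n x) atTop (𝓝 (e x))) → P e) :
    ∃ e, IsProjIn (N : Set (H →L[ℂ] H)) e ∧ P e ∧
      ∀ f, IsProjIn (N : Set (H →L[ℂ] H)) f → P f → f * e = e → f = e := by
  have up : ∀ e, IsProjIn (N : Set (H →L[ℂ] H)) e → IsProjIn (M : Set (H →L[ℂ] H)) e :=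
    fun e he => ⟨hNM he.1, he.2⟩
  let α := {v : H →L[ℂ] H // IsProjIn (N : Set (H →L[ℂ] H)) v ∧ P v}
  obtain ⟨a, -, ha⟩ := exhaust (α := α) (fun v w => w.1 * v.1 = v.1)
    (fun v => v.2.1.2.2)
    (fun a b c hab hbc => by rw [← hab, ← mul_assoc, hbc])
    (fun v => (tr.τ v.1).re) 1
    (fun v => proj_le_one_tau tr (up _ v.2.1))
    (fun v w h => by
      have h1 := compl_proj (up _ w.2.1) (up _ v.2.1) h
      have := (tau_nonneg tr h1.1 (proj_nonneg h1.2.1 h1.2.2)).1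
      rw [map_sub, Complex.sub_re] at this
      linarith)
    (fun s hs => by
      obtain ⟨w, h1, h2, h3⟩ := pi_sup (v := fun n => (s n).1)
        (fun n => isPI_of_proj (s n).2.1.2.1 (s n).2.1.2.2)
        (fun n => by rw [(s n).2.1.2.1, (s n).2.1.2.2]; exact hs n)
      have hs' : ∀ n, star (s n).1 = (s n).1 := fun n => (s n).2.1.2.1
      have h3' : ∀ n, w * (s n).1 = (s n).1 := fun n => by
        have := h3 n
        rwa [(s n).2.1.2.1, (s n).2.1.2.2] at this
      have hwN : w ∈ N := vn_strong_limit N (fun n => (s n).2.1.1) h1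
      have hws : star w = w := by
        refine ContinuousLinearMap.ext fun x => ?_
        refine ext_inner_left ℂ fun v => ?_
        rw [inner_star_right]
        refine tendsto_nhds_unique ((h1 v).inner tendsto_const_nhds)
          ((tendsto_const_nhds.inner (h1 x)).congr fun n => ?_)
        rw [← inner_star_right, hs']
      have hww : w * w = w := by
        ext x
        refine tendsto_nhds_unique ((w.continuous.tendsto _).comp (h1 x)) ((h1 x).congr fun n => ?_)
        exact (congrArg (fun T : H →L[ℂ] H => T x) (h3' n)).symm
      have hw : IsProjIn (N : Set (H →L[ℂ] H)) w := ⟨hwN, hws, hww⟩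
      exact ⟨⟨w, hw, hsup (fun n => (s n).1) w (fun n => (s n).2) hw h3' h1⟩, h3'⟩)
    ⟨0, ⟨zero_mem N, star_zero _, zero_mul _⟩, hP0⟩
  refine ⟨a.1, a.2.1, a.2.2, fun f hf hPf hfe => ?_⟩
  have h1 := ha ⟨f, hf, hPf⟩ hfe
  have h2 := compl_proj (up _ hf) (up _ a.2.1) hfe
  by_contra hne
  have := proj_tau_pos tr h2 (sub_ne_zero.2 hne)
  rw [map_sub, Complex.sub_re] at this
  simp only at h1
  linarith

theorem proj_add {N : VonNeumannAlgebra H} {e f : H →L[ℂ] H}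
    (he : IsProjIn (N : Set (H →L[ℂ] H)) e) (hf : IsProjIn (N : Set (H →L[ℂ] H)) f)
    (h : e * f = 0) : IsProjIn (N : Set (H →L[ℂ] H)) (e + f) ∧ (e + f) * e = e ∧ f * e = 0 := by
  have h' : f * e = 0 := by
    have := congrArg star h
    rwa [star_mul, he.2.1, hf.2.1, star_zero] at this
  refine ⟨⟨add_mem (SetLike.mem_coe.1 he.1) (SetLike.mem_coe.1 hf.1), by
    rw [star_add, he.2.1, hf.2.1], ?_⟩, ?_, h'⟩
  · rw [add_mul, mul_add, mul_add, he.2.2, hf.2.2, h, h']; abel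
  · rw [add_mul, he.2.2, h', add_zero]

/-- vector functional -/
def om (ξ : H) : (H →L[ℂ] H) →ₗ[ℝ] ℝ where
  toFun x := (inner ℂ ξ (x ξ)).re
  map_add' x y := by simp [inner_add_right]
  map_smul' c x := by
    simp only [ContinuousLinearMap.smul_apply, inner_smul_right_eq_smul, Complex.real_smul,
      Complex.re_ofReal_mul, RingHom.id_apply, smul_eq_mul]

/-- real part of the trace -/
def taur : (H →L[ℂ] H) →ₗ[ℝ] ℝ where
  toFun x := (tr.τ x).re
  map_add' x y := by simp
  map_smul' c x := by rw [tau_rsmul_re]; rfl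

theorem om_apply (ξ : H) (x : H →L[ℂ] H) : om ξ x = (inner ℂ ξ (x ξ)).re := rfl
theorem taur_apply (x : H →L[ℂ] H) : taur tr x = (tr.τ x).re := rfl

theorem om_nonneg (ξ : H) {x : H →L[ℂ] H} (h : 0 ≤ x) : 0 ≤ om ξ x := by
  have := (ContinuousLinearMap.nonneg_iff_isPositive x).1 h
  have h2 := this.re_inner_nonneg_right ξ
  exact h2

theorem om_algebraMap (ξ : H) (c : ℝ) : om ξ (algebraMap ℝ _ c) = c * ‖ξ‖ ^ 2 := by
  rw [Algebra.algebraMap_eq_smul_one, map_smul, om_apply, oneA, @norm_sq_eq_re_inner ℂ]; rfl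

theorem om_mono (ξ : H) {x y : H →L[ℂ] H} (h : x ≤ y) : om ξ x ≤ om ξ y := by
  have := om_nonneg ξ (sub_nonneg.2 h)
  rw [map_sub] at this; linarith

theorem om_star_mul (ξ : H) (x : H →L[ℂ] H) : om ξ (star x * x) = ‖x ξ‖ ^ 2 := by
  rw [norm_sq_apply]; rfl

theorem om_tendsto (ξ : H) {s : ℕ → (H →L[ℂ] H)} {e : H →L[ℂ] H}
    (h : ∀ x, Tendsto (fun n => s n x) atTop (𝓝 (e x))) :
    Tendsto (fun n => om ξ (s n)) atTop (𝓝 (om ξ e)) :=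
  (Complex.continuous_re.tendsto _).comp (tendsto_const_nhds.inner (h ξ))

theorem local_equiv (ξ : H) (hξ : ‖ξ‖ = 1) : ∃ p, IsProjIn (M : Set (H →L[ℂ] H)) p ∧ p ≠ 0 ∧
    ∃ C : ℝ, 0 ≤ C ∧ ∀ x ∈ M, 0 ≤ x → p * x = x → (tr.τ x).re ≤ 2 * om ξ x ∧
      om ξ x ≤ C * (tr.τ x).re := by
  have hone : IsProjIn (M : Set (H →L[ℂ] H)) 1 := ⟨one_mem M, star_one _, one_mul 1⟩
  have htr : ∀ y ∈ M, ∀ c : ℝ, y ≤ algebraMap ℝ _ c → taur tr y ≤ c := fun y hy c h => by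
    have := tau_mono tr hy (algMap_mem M c) h
    rwa [tau_algebraMap] at this
  have hom : ∀ y ∈ M, ∀ c : ℝ, y ≤ algebraMap ℝ _ c → om ξ y ≤ c := fun y hy c h => by
    have := om_mono ξ h
    rwa [om_algebraMap, hξ, one_pow, mul_one] at this
  obtain ⟨e, he, hPe, hmax⟩ := proj_exhaust tr M (le_refl _) (fun e => 2 * om ξ e ≤ taur tr e)
    (by simp) (fun s e hs he hle hlim => by
      refine le_of_tendsto' ((om_tendsto ξ hlim).const_mul 2) fun n => (hs n).2.trans ?_
      have h1 := compl_proj he (hs n).1 (hle n)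
      have := (tau_nonneg tr h1.1 (proj_nonneg h1.2.1 h1.2.2)).1
      rw [map_sub, Complex.sub_re] at this
      rw [taur_apply, taur_apply]; linarith)
  have hp := compl_proj hone he (one_mul e)
  set p := 1 - e with hpdef
  have hep : e * p = 0 := by rw [hpdef, mul_sub, mul_one, he.2.2, sub_self]
  have hp0 : p ≠ 0 := by
    intro h
    have : e = 1 := (sub_eq_zero.1 h).symm
    rw [this, taur_apply, tr.unital, om_apply, oneA, inner_self_eq_norm_sq_to_K, hξ] at hPe
    norm_num at hPe
  have hA : ∀ x ∈ M, 0 ≤ x → p * x = x → taur tr x ≤ ((2 : ℝ) • om ξ) x := by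
    intro x hx h0 hpx
    refine spectral_compare M _ _ p ?_ ?_ htr hx h0 hpx
    · intro f hf hpf
      by_contra hlt
      push Not at hlt
      have hef : e * f = 0 := by rw [← hpf, ← mul_assoc, hep, zero_mul]
      obtain ⟨h1, h2, h3⟩ := proj_add he hf hef
      have h4 := hmax _ h1 (by
        simp only [map_add]
        simp only [LinearMap.smul_apply, smul_eq_mul] at hlt
        linarith) h2
      have hf0 : f = 0 := by simpa using h4
      rw [hf0] at hlt
      simp at hlt
    · intro y hy h
      have := om_nonneg ξ h
      simp only [LinearMap.smul_apply, smul_eq_mul]; linarith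
  have hA' : ∀ x ∈ M, 0 ≤ x → p * x = x → taur tr x ≤ 2 * om ξ x := hA
  have htp := proj_tau_pos tr hp hp0
  set C := om ξ p / taur tr p + 1 with hC
  have hC0 : 0 ≤ C := by
    have := om_nonneg ξ (proj_nonneg hp.2.1 hp.2.2)
    have : 0 ≤ om ξ p / taur tr p := div_nonneg this htp.le
    linarith
  obtain ⟨e', he', ⟨hPe', hpe'⟩, hmax'⟩ := proj_exhaust tr M (le_refl _)
    (fun e => C * taur tr e ≤ om ξ e ∧ p * e = e)
    (by simp) (fun s e hs he hle hlim => by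
      have hpe : p * e = e := by
        ext x
        refine tendsto_nhds_unique ((p.continuous.tendsto _).comp (hlim x))
          ((hlim x).congr fun n => ?_)
        exact (congrArg (fun T : H →L[ℂ] H => T x) (hs n).2.2).symm
      refine ⟨?_, hpe⟩
      have hlow : ∀ n, C * (taur tr e - 2 * (om ξ e - om ξ (s n))) ≤ om ξ e := by
        intro n
        have h1 := compl_proj he (hs n).1 (hle n)
        have h2 := hA' _ h1.1 (proj_nonneg h1.2.1 h1.2.2) (by rw [mul_sub, hpe, (hs n).2.2])
        rw [map_sub, map_sub] at h2
        have h3 := om_nonneg ξ (proj_nonneg h1.2.1 h1.2.2)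
        rw [map_sub] at h3
        have h4 := (hs n).2.1
        have h5 : C * (taur tr e - 2 * (om ξ e - om ξ (s n))) ≤ C * taur tr (s n) :=
          mul_le_mul_of_nonneg_left (by linarith) hC0
        linarith
      have hl : Tendsto (fun n => C * (taur tr e - 2 * (om ξ e - om ξ (s n)))) atTop
          (𝓝 (C * (taur tr e - 2 * (om ξ e - om ξ e)))) :=
        ((tendsto_const_nhds.sub ((tendsto_const_nhds.sub (om_tendsto ξ hlim)).const_mul 2))).const_mul C
      rw [sub_self, mul_zero, sub_zero] at hl
      exact le_of_tendsto' hl hlow)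
  have hp' := compl_proj hp he' hpe'
  set p' := p - e' with hp'def
  have hpp' : p * p' = p' := by rw [hp'def, mul_sub, hp.2.2, hpe']
  have he'p : e' * p = e' := by
    have := congrArg star hpe'
    rwa [star_mul, hp.2.1, he'.2.1] at this
  have hep' : e' * p' = 0 := by rw [hp'def, mul_sub, he'p, he'.2.2, sub_self]
  refine ⟨p', hp', ?_, C, hC0, fun x hx h0 hpx => ⟨?_, ?_⟩⟩
  · intro h
    have h1 : p = e' := sub_eq_zero.1 h
    rw [← h1, hC] at hPe'
    have h2 : 0 < taur tr p := htp
    have : (om ξ p / taur tr p + 1) * taur tr p = om ξ p + taur tr p := by field_simp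
    linarith
  · exact hA' x hx h0 (by rw [← hpx, ← mul_assoc, hpp'])
  · refine spectral_compare M (om ξ) (C • taur tr) p' ?_ ?_ hom hx h0 hpx
    · intro f hf hpf
      by_contra hlt
      push Not at hlt
      have hef : e' * f = 0 := by rw [← hpf, ← mul_assoc, hep', zero_mul]
      obtain ⟨h1, h2, h3⟩ := proj_add he' hf hef
      have h4 := hmax' _ h1 ⟨by
        simp only [map_add]
        simp only [LinearMap.smul_apply, smul_eq_mul] at hlt
        linarith, by rw [mul_add, hpe', ← hpf, ← mul_assoc, hpp']⟩ h2
      have hf0 : f = 0 := by simpa using h4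
      rw [hf0] at hlt
      simp at hlt
    · intro y hy h
      exact mul_nonneg hC0 (tau_nonneg tr hy h).1

theorem cover (hM : IsFactorSet (M : Set (H →L[ℂ] H))) {p : H →L[ℂ] H}
    (hp : IsProjIn (M : Set (H →L[ℂ] H)) p) (n : ℕ) : ∀ q, IsProjIn (M : Set (H →L[ℂ] H)) q →
    (tr.τ q).re ≤ n * (tr.τ p).re →
    ∃ (k : ℕ) (v : Fin k → (H →L[ℂ] H)), (∀ i, v i ∈ M ∧ v i * p = v i) ∧
      ∑ i, v i * star (v i) = q := by
  induction n with
  | zero =>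
    intro q hq h
    rw [Nat.cast_zero, zero_mul] at h
    have hq0 : q = 0 := by
      by_contra h0
      have := proj_tau_pos tr hq h0
      linarith
    exact ⟨0, Fin.elim0, fun i => i.elim0, by simp [hq0]⟩
  | succ n ih =>
    intro q hq h
    obtain ⟨v, hvM, hv, hvp, hqv, hor⟩ := comparison tr hM hp hq
    rcases hor with h1 | h1
    · have hv2 := isPI_projIn (star_mem hvM) hv.star
      rw [star_star] at hv2
      have hq' := compl_proj hq hv2 (by rw [← mul_assoc, hqv])
      obtain ⟨k, w, hw, hsum⟩ := ih _ hq' (by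
        rw [map_sub, tr.tracial v hvM _ (star_mem hvM), h1, Complex.sub_re]
        push_cast at h
        linarith)
      refine ⟨k + 1, Fin.cons v w, ?_, ?_⟩
      · intro i
        refine Fin.cases ?_ (fun j => ?_) i
        · simpa using ⟨hvM, hvp⟩
        · simpa using hw j
      · rw [Fin.sum_univ_succ]
        simp only [Fin.cons_zero, Fin.cons_succ]
        rw [hsum]; abel
    · exact ⟨1, fun _ => v, fun _ => ⟨hvM, hvp⟩, by simpa using h1⟩

/-- The trace is equivalent to a finite sum of vector states. -/
def NormalData (k : ℕ) (α : Fin k → H) (C : ℝ) : Prop :=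
  0 < C ∧ ∀ x ∈ M, ‖io M tr x‖ ^ 2 ≤ C * ∑ i, ‖x (α i)‖ ^ 2 ∧
    ∑ i, ‖x (α i)‖ ^ 2 ≤ C * ‖io M tr x‖ ^ 2

theorem exists_normalData (hM : IsFactorSet (M : Set (H →L[ℂ] H))) :
    ∃ (k : ℕ) (α : Fin k → H) (C : ℝ), NormalData tr k α C := by
  have hnt : Nontrivial H := by
    by_contra h
    rw [not_nontrivial_iff_subsingleton] at h
    have : (1 : H →L[ℂ] H) = 0 := ContinuousLinearMap.ext fun x => Subsingleton.elim _ _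
    have h2 := tr.unital
    rw [this, map_zero] at h2
    exact zero_ne_one h2
  obtain ⟨ξ, hξ⟩ := exists_norm_eq H (zero_le_one)
  obtain ⟨p, hp, hp0, C, hC, hb⟩ := local_equiv tr ξ hξ
  have hone : IsProjIn (M : Set (H →L[ℂ] H)) 1 := ⟨one_mem M, star_one _, one_mul 1⟩
  have hpos := proj_tau_pos tr hp hp0
  obtain ⟨n, hn⟩ := exists_nat_ge (1 / (tr.τ p).re)
  obtain ⟨k, v, hv, hsum⟩ := cover tr hM hp n 1 hone (by
    rw [tr.unital, Complex.one_re]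
    rwa [div_le_iff₀ hpos] at hn)
  refine ⟨k, fun i => v i ξ, max 2 C, by positivity, fun x hx => ?_⟩
  have hsq : ∀ i, ‖x (v i ξ)‖ ^ 2 = om ξ (star (x * v i) * (x * v i)) := fun i => by
    rw [om_star_mul]; rfl
  have hin : ∀ i, p * (star (x * v i) * (x * v i)) = star (x * v i) * (x * v i) := fun i => by
    have := congrArg star (hv i).2
    rw [star_mul, hp.2.1] at this
    rw [star_mul, mul_assoc, ← mul_assoc p, this]
  have hm : ∀ i, x * v i ∈ M := fun i => mul_mem hx (hv i).1
  have hbi := fun i => hb _ (mul_mem (star_mem (hm i)) (hm i)) (star_mul_self_nonneg _) (hin i)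
  have htot : ‖io M tr x‖ ^ 2 = ∑ i, (tr.τ (star (x * v i) * (x * v i))).re := by
    have e1 : ∀ i, tr.τ (star (x * v i) * (x * v i)) = tr.τ (x * (v i * star (v i)) * star x) := by
      intro i
      rw [tr.tracial _ (star_mem (hm i)) _ (hm i), star_mul]
      simp only [mul_assoc]
    rw [← Complex.re_sum]
    simp_rw [e1]
    rw [← map_sum, ← Finset.sum_mul, ← Finset.mul_sum, hsum, mul_one,
      tr.tracial _ hx _ (star_mem hx), io_norm_sq tr hx]
  simp_rw [hsq]
  rw [htot]
  constructor
  · rw [Finset.mul_sum]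
    refine Finset.sum_le_sum fun i _ => (hbi i).1.trans ?_
    exact mul_le_mul_of_nonneg_right (le_max_left _ _) (om_nonneg ξ (star_mul_self_nonneg _))
  · rw [Finset.mul_sum]
    refine Finset.sum_le_sum fun i _ => (hbi i).2.trans ?_
    exact mul_le_mul_of_nonneg_right (le_max_right _ _) (tr.nonneg _ (hm i)).1

end normality
end CD

namespace CD

section hilb
variable {K : Type*} [NormedAddCommGroup K] [InnerProductSpace ℂ K]

theorem proj_commute (V : Submodule ℂ K) [V.HasOrthogonalProjection] (T S : K →L[ℂ] K)
    (hTS : ∀ x y, inner ℂ (T x) y = inner ℂ x (S y)) (hT : ∀ v ∈ V, T v ∈ V)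
    (hS : ∀ v ∈ V, S v ∈ V) (x : K) : V.starProjection (T x) = T (V.starProjection x) := by
  apply Submodule.eq_starProjection_of_mem_orthogonal
  · exact hT _ (Submodule.starProjection_apply_mem _ _)
  · rw [← map_sub, Submodule.mem_orthogonal']
    intro v hv
    rw [hTS]
    exact (Submodule.mem_orthogonal' _ _).1 (Submodule.sub_starProjection_mem_orthogonal x) _ (hS v hv)

theorem closure_map_mem {V W : Submodule ℂ K} (T : K →L[ℂ] K)
    (h : ∀ v ∈ V, T v ∈ W.topologicalClosure) : ∀ v ∈ V.topologicalClosure,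
    T v ∈ W.topologicalClosure := by
  intro v hv
  have h1 : V ≤ W.topologicalClosure.comap (T : K →ₗ[ℂ] K) := h
  exact Submodule.topologicalClosure_minimal _ h1
    (IsClosed.preimage T.continuous (Submodule.isClosed_topologicalClosure _)) hv

theorem closure_approx {V : Submodule ℂ K} {x : K} (hx : x ∈ V.topologicalClosure) {ε : ℝ}
    (hε : 0 < ε) : ∃ v ∈ V, ‖x - v‖ < ε := by
  have : x ∈ closure (V : Set K) := hx
  obtain ⟨v, hv, h⟩ := Metric.mem_closure_iff.1 this ε hε
  exact ⟨v, hv, by rwa [← dist_eq_norm]⟩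

theorem mem_closure_of_approx {V : Submodule ℂ K} {x : K}
    (h : ∀ ε : ℝ, 0 < ε → ∃ v ∈ V, ‖x - v‖ < ε) : x ∈ V.topologicalClosure := by
  have : x ∈ closure (V : Set K) := Metric.mem_closure_iff.2 fun ε hε => by
    obtain ⟨v, hv, h⟩ := h ε hε
    exact ⟨v, hv, by rwa [dist_eq_norm]⟩
  exact this

end hilb

section L2normal
variable {H : Type} [NormedAddCommGroup H] [InnerProductSpace ℂ H] [CompleteSpace H]
variable {M : VonNeumannAlgebra H} {tr : TraceOn H (M : Set (H →L[ℂ] H))}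
variable {k : ℕ} {α : Fin k → H} {C : ℝ}

theorem nd_dense (nd : NormalData tr k α C) (x : H) :
    x ∈ (Submodule.span ℂ {v | ∃ T ∈ M.commutant, ∃ i, v = T (α i)}).topologicalClosure := by
  set V := (Submodule.span ℂ {v | ∃ T ∈ M.commutant, ∃ i, v = T (α i)}).topologicalClosure with hV
  have h1 : V.starProjection ∈ M := by
    apply proj_mem_of_invariant
    intro S hS
    apply closure_map_mem
    intro v hv
    apply Submodule.le_topologicalClosure
    have h0 : Submodule.span ℂ {v | ∃ T ∈ M.commutant, ∃ i, v = T (α i)} ≤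
        Submodule.comap (S : H →ₗ[ℂ] H)
          (Submodule.span ℂ {v | ∃ T ∈ M.commutant, ∃ i, v = T (α i)}) := by
      rw [Submodule.span_le]
      rintro _ ⟨T, hT, i, rfl⟩
      exact Submodule.subset_span ⟨S * T, mul_mem hS hT, i, rfl⟩
    exact h0 hv
  have h2 : 1 - V.starProjection = 0 := by
    have hm : 1 - V.starProjection ∈ M := sub_mem (one_mem M) h1
    apply io_inj tr hm
    have h3 := (nd.2 _ hm).1
    have h4 : ∑ i, ‖(1 - V.starProjection) (α i)‖ ^ 2 = 0 := by
      apply Finset.sum_eq_zero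
      intro i _
      have : V.starProjection (α i) = α i := by
        rw [Submodule.starProjection_eq_self_iff]
        exact Submodule.le_topologicalClosure _ (Submodule.subset_span ⟨1, one_mem _, i, rfl⟩)
      rw [ContinuousLinearMap.sub_apply, this, oneA, sub_self]; simp
    rw [h4, mul_zero] at h3
    have := sq_nonneg ‖io M tr (1 - V.starProjection)‖
    have h5 : ‖io M tr (1 - V.starProjection)‖ ^ 2 = 0 := le_antisymm h3 this
    exact norm_eq_zero.1 (pow_eq_zero_iff (two_ne_zero) |>.1 h5)
  have h3 : V.starProjection x = x := by
    rw [(sub_eq_zero.1 h2).symm, oneA]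
  rw [← h3]
  exact Submodule.starProjection_apply_mem _ _

theorem nd_tendsto (nd : NormalData tr k α C) {b : ℕ → (H →L[ℂ] H)} {x : H →L[ℂ] H}
    (hb : ∀ n, b n ∈ M) (hx : x ∈ M) (h : ∀ ξ, Tendsto (fun n => b n ξ) atTop (𝓝 (x ξ))) :
    Tendsto (fun n => io M tr (b n)) atTop (𝓝 (io M tr x)) := by
  rw [tendsto_iff_norm_sub_tendsto_zero]
  have h1 : Tendsto (fun n => C * ∑ i, ‖b n (α i) - x (α i)‖ ^ 2) atTop
      (𝓝 (C * ∑ i : Fin k, ‖x (α i) - x (α i)‖ ^ 2)) := by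
    refine Tendsto.const_mul _ (tendsto_finsetSum _ fun i _ => ?_)
    exact (((h (α i)).sub tendsto_const_nhds).norm).pow 2
  have h2 : Tendsto (fun n => ‖io M tr (b n) - io M tr x‖ ^ 2) atTop (𝓝 0) := by
    refine squeeze_zero (fun n => by positivity) (fun n => ?_) (by simpa using h1)
    rw [← map_sub]
    exact (nd.2 _ (sub_mem (hb n) hx)).1
  have h3 := h2.sqrt
  simpa [Real.sqrt_sq] using h3

theorem nd_complete (nd : NormalData tr k α C) {N : VonNeumannAlgebra H}
    (hNM : (N : Set (H →L[ℂ] H)) ⊆ M) {b : ℕ → (H →L[ℂ] H)} {R : ℝ} (hb : ∀ n, b n ∈ N)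
    (hR : ∀ n, ‖b n‖ ≤ R) (hc : CauchySeq fun n => io M tr (b n)) :
    ∃ x ∈ N, ‖x‖ ≤ R ∧ Tendsto (fun n => io M tr (b n)) atTop (𝓝 (io M tr x)) ∧
      ∀ ξ, Tendsto (fun n => b n ξ) atTop (𝓝 (x ξ)) := by
  have hR0 : 0 ≤ R := (norm_nonneg _).trans (hR 0)
  have hα : ∀ i, CauchySeq fun n => b n (α i) := by
    intro i
    rw [Metric.cauchySeq_iff'] at hc ⊢
    intro ε hε
    have hC := nd.1
    obtain ⟨n₀, h⟩ := hc (ε / (Real.sqrt C + 1)) (by positivity)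
    refine ⟨n₀, fun n hn => ?_⟩
    have h1 := h n hn
    rw [dist_eq_norm] at h1 ⊢
    rw [← map_sub] at h1
    have h2 := (nd.2 _ (sub_mem (hNM (hb n)) (hNM (hb n₀)))).2
    have h3 : ‖(b n - b n₀) (α i)‖ ^ 2 ≤ C * ‖io M tr (b n - b n₀)‖ ^ 2 :=
      (Finset.single_le_sum (f := fun i => ‖(b n - b n₀) (α i)‖ ^ 2)
        (fun i _ => by positivity) (Finset.mem_univ i)).trans h2
    have h4 : ‖(b n - b n₀) (α i)‖ ≤ Real.sqrt C * ‖io M tr (b n - b n₀)‖ := by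
      apply le_of_sq_le_sq _ (by positivity)
      rw [mul_pow, Real.sq_sqrt hC.le]; exact h3
    change ‖(b n - b n₀) (α i)‖ < ε
    have h5 : (Real.sqrt C + 1) * ‖io M tr (b n - b n₀)‖ < ε := by
      rw [lt_div_iff₀ (by positivity)] at h1
      linarith
    have := norm_nonneg (io M tr (b n - b n₀))
    linarith
  have hD : ∀ y ∈ Submodule.span ℂ {v | ∃ T ∈ M.commutant, ∃ i, v = T (α i)},
      CauchySeq fun n => b n y := by
    intro y hy
    induction hy using Submodule.span_induction with
    | mem y hy =>
      obtain ⟨T, hT, i, rfl⟩ := hy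
      have : (fun n => b n (T (α i))) = fun n => T (b n (α i)) := by
        funext n
        exact congrArg (fun S : H →L[ℂ] H => S (α i)) (vn_comm M (hNM (hb n)) hT)
      rw [this]
      exact T.uniformContinuous.comp_cauchySeq (hα i)
    | zero => simpa using cauchySeq_const _
    | add y z _ _ h1 h2 =>
      have h3 := h1.add h2
      simp only [map_add]
      exact h3
    | smul c y _ h =>
      have h3 := (uniformContinuous_const_smul c).comp_cauchySeq h
      simp only [map_smul]
      exact h3
  have hall : ∀ y, CauchySeq fun n => b n y := by
    intro y
    rw [Metric.cauchySeq_iff']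
    intro ε hε
    obtain ⟨z, hz, hyz⟩ := closure_approx (nd_dense nd y) (show 0 < ε / (3 * (R + 1)) by positivity)
    obtain ⟨n₀, h⟩ := Metric.cauchySeq_iff'.1 (hD z hz) (ε / 3) (by positivity)
    refine ⟨n₀, fun n hn => ?_⟩
    have h1 := h n hn
    rw [dist_eq_norm] at h1 ⊢
    have h2 : ∀ m, ‖b m (y - z)‖ ≤ ε / 3 := by
      intro m
      calc ‖b m (y - z)‖ ≤ ‖b m‖ * ‖y - z‖ := (b m).le_opNorm _
        _ ≤ (R + 1) * (ε / (3 * (R + 1))) := by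
          apply mul_le_mul ((hR m).trans (by linarith)) hyz.le (norm_nonneg _) (by positivity)
        _ = ε / 3 := by field_simp
    have h3 : b n y - b n₀ y = b n (y - z) + (b n z - b n₀ z) - b n₀ (y - z) := by
      simp only [map_sub]; abel
    rw [h3]
    have h4 := norm_sub_le (b n (y - z) + (b n z - b n₀ z)) (b n₀ (y - z))
    have h5 := norm_add_le (b n (y - z)) (b n z - b n₀ z)
    have h6 := h2 n
    have h7 := h2 n₀
    linarith
  have hc2 : ∀ y, ∃ z, Tendsto (fun n => b n y) atTop (𝓝 z) :=
    fun y => cauchySeq_tendsto_of_complete (hall y)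
  choose w hw using hc2
  let x : H →L[ℂ] H := continuousLinearMapOfTendsto (l := atTop) b (f := w)
    (by rw [tendsto_pi_nhds]; exact hw)
  have hx : ∀ ξ, Tendsto (fun n => b n ξ) atTop (𝓝 (x ξ)) := hw
  have hxN : x ∈ N := vn_strong_limit N hb hx
  refine ⟨x, hxN, ?_, nd_tendsto nd (fun n => hNM (hb n)) (hNM hxN) hx, hx⟩
  refine ContinuousLinearMap.opNorm_le_bound _ hR0 fun ξ => ?_
  refine le_of_tendsto' (hx ξ).norm fun n => ((b n).le_opNorm ξ).trans ?_
  exact mul_le_mul_of_nonneg_right (hR n) (norm_nonneg _)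

/-- L² closure of a submodule -/
def KG (tr : TraceOn H (M : Set (H →L[ℂ] H))) (G : Submodule ℂ (H →L[ℂ] H)) :
    Submodule ℂ (L2 M tr) := (G.map (io M tr)).topologicalClosure

instance (G : Submodule ℂ (H →L[ℂ] H)) : CompleteSpace (KG tr G) := by
  unfold KG; infer_instance

theorem io_mem_KG {G : Submodule ℂ (H →L[ℂ] H)} {x : H →L[ℂ] H} (hx : x ∈ G) :
    io M tr x ∈ KG tr G := Submodule.le_topologicalClosure _ ⟨x, hx, rfl⟩

theorem KG_approx {G : Submodule ℂ (H →L[ℂ] H)} {ξ : L2 M tr} (h : ξ ∈ KG tr G) {ε : ℝ}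
    (hε : 0 < ε) : ∃ g ∈ G, ‖ξ - io M tr g‖ < ε := by
  obtain ⟨_, ⟨g, hg, rfl⟩, h⟩ := closure_approx h hε
  exact ⟨g, hg, h⟩

theorem KG_of_approx {G : Submodule ℂ (H →L[ℂ] H)} {ξ : L2 M tr}
    (h : ∀ ε : ℝ, 0 < ε → ∃ g ∈ G, ‖ξ - io M tr g‖ < ε) : ξ ∈ KG tr G :=
  mem_closure_of_approx fun ε hε => by
    obtain ⟨g, hg, h⟩ := h ε hε
    exact ⟨_, ⟨g, hg, rfl⟩, h⟩

theorem KG_map {G G' : Submodule ℂ (H →L[ℂ] H)} (T : L2 M tr →L[ℂ] L2 M tr)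
    (h : ∀ g ∈ G, T (io M tr g) ∈ KG tr G') : ∀ ξ ∈ KG tr G, T ξ ∈ KG tr G' := by
  apply closure_map_mem
  rintro _ ⟨g, hg, rfl⟩
  exact h g hg

theorem KG_mono {G : Submodule ℂ (H →L[ℂ] H)} {V : Submodule ℂ (L2 M tr)}
    (hV : IsClosed (V : Set (L2 M tr))) (h : ∀ g ∈ G, io M tr g ∈ V) : KG tr G ≤ V := by
  apply Submodule.topologicalClosure_minimal _ _ hV
  rintro _ ⟨g, hg, rfl⟩
  exact h g hg

theorem KG_closed (G : Submodule ℂ (H →L[ℂ] H)) : IsClosed (KG tr G : Set (L2 M tr)) :=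
  Submodule.isClosed_topologicalClosure _

theorem tau_mul_le {h z : H →L[ℂ] H} (hh : h ∈ M) (h0 : 0 ≤ h) (hz : z ∈ M) :
    ‖tr.τ (h * z)‖ ≤ ‖z‖ * (tr.τ h).re := by
  obtain ⟨s, hs, h1, h2⟩ := exists_sqrt M hh h0
  have e1 : tr.τ (h * z) = inner ℂ (io M tr s) (io M tr (s * z)) := by
    rw [io_inner tr hs (mul_mem hs hz), h1, ← mul_assoc, h2]
  have e2 : (tr.τ h).re = ‖io M tr s‖ ^ 2 := by rw [io_norm_sq tr hs, h1, h2]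
  rw [e1, e2]
  refine (norm_inner_le_norm _ _).trans ?_
  have := io_norm_mul_right tr hs hz
  nlinarith [norm_nonneg (io M tr s)]

theorem exists_condExp (nd : NormalData tr k α C) {N : VonNeumannAlgebra H}
    (hNM : (N : Set (H →L[ℂ] H)) ⊆ M) {x : H →L[ℂ] H} (hx : x ∈ M) :
    ∃ b ∈ N, io M tr b = (KG tr (vnSub N)).starProjection (io M tr x) := by
  set R := ‖x‖ with hR
  set ζ := (KG tr (vnSub N)).starProjection (io M tr x) with hζ
  set S : Set (L2 M tr) := {ξ | ∃ b ∈ N, ‖b‖ ≤ R ∧ io M tr b = ξ} with hS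
  have hSne : S.Nonempty := ⟨0, 0, zero_mem N, by simp [hR], by simp⟩
  have hSc : IsComplete S := by
    apply IsClosed.isComplete
    apply isClosed_of_closure_subset
    intro ξ hξ
    obtain ⟨s, hs, hlim⟩ := mem_closure_iff_seq_limit.1 hξ
    choose b hb hbR hbs using hs
    have hc : CauchySeq fun n => io M tr (b n) := by
      simp_rw [hbs]; exact hlim.cauchySeq
    obtain ⟨y, hy, hyR, hyl, -⟩ := nd_complete nd hNM hb hbR hc
    simp_rw [hbs] at hyl
    exact ⟨y, hy, hyR, tendsto_nhds_unique hyl hlim⟩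
  letI : InnerProductSpace ℝ (L2 M tr) := InnerProductSpace.rclikeToReal ℂ (L2 M tr)
  have hconv : Convex ℝ S := by
    rintro _ ⟨b, hb, hbR, rfl⟩ _ ⟨b', hb', hbR', rfl⟩ s t hs ht hst
    refine ⟨s • b + t • b', add_mem (vn_rsmul_mem N _ hb) (vn_rsmul_mem N _ hb'), ?_, ?_⟩
    · refine (norm_add_le _ _).trans ?_
      rw [norm_smul, norm_smul, Real.norm_of_nonneg hs, Real.norm_of_nonneg ht]
      calc s * ‖b‖ + t * ‖b'‖ ≤ s * R + t * R := by gcongr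
        _ = R := by rw [← add_mul, hst, one_mul]
    · have e : ∀ (c : ℝ) (y : H →L[ℂ] H), c • y = (c : ℂ) • y := fun c y => by ext v; simp
      rw [e, e, map_add, map_smul, map_smul]
      rfl
  obtain ⟨c, hcS, hcmin⟩ := exists_norm_eq_iInf_of_complete_convex hSne hSc hconv ζ
  have hvar := (norm_eq_iInf_iff_real_inner_le_zero hconv hcS).1 hcmin
  obtain ⟨b₀, hb₀, hb₀R, hb₀c⟩ := hcS
  refine ⟨b₀, hb₀, ?_⟩
  set η := ζ - c with hη
  have hηK : η ∈ KG tr (vnSub N) :=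
    sub_mem (Submodule.starProjection_apply_mem _ _) (hb₀c ▸ io_mem_KG (mem_vnSub.2 hb₀))
  have hηx : inner ℂ η ζ = inner ℂ η (io M tr x) := by
    have : inner ℂ η (io M tr x - ζ) = 0 :=
      (Submodule.mem_orthogonal _ _).1 (Submodule.sub_starProjection_mem_orthogonal _) _ hηK
    rw [inner_sub_right, sub_eq_zero] at this
    exact this.symm
  have hvar' : ∀ b ∈ N, ‖b‖ ≤ R → ‖η‖ ^ 2 ≤ (inner ℂ η (io M tr x)).re -
      (inner ℂ η (io M tr b)).re := by
    intro b hb hbR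
    have h1 := hvar (io M tr b) ⟨b, hb, hbR, rfl⟩
    have h2 : (inner ℂ η (io M tr b - c)).re ≤ 0 := h1
    rw [inner_sub_right, Complex.sub_re] at h2
    have h3 : ‖η‖ ^ 2 = (inner ℂ η η).re := by rw [@norm_sq_eq_re_inner ℂ]; rfl
    rw [h3]
    conv_lhs => arg 1; arg 3; rw [hη]
    rw [inner_sub_right, hηx, Complex.sub_re]
    linarith
  have key : ∀ ε : ℝ, 0 < ε → ‖η‖ ^ 2 ≤ 3 * R * ε := by
    intro ε hε
    obtain ⟨y, hy, hyη⟩ := KG_approx hηK hε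
    have hyN : y ∈ N := hy
    have hyM : y ∈ M := hNM hy
    set t := star y * y with ht
    have htM : t ∈ N := mul_mem (star_mem hyN) hyN
    have ht0 : 0 ≤ t := star_mul_self_nonneg y
    have hsa : IsSelfAdjoint t := IsSelfAdjoint.of_nonneg ht0
    have hsp : ∀ s ∈ spectrum ℝ t, 0 ≤ s := fun s hs => spectrum_nonneg_of_nonneg ht0 hs
    have hcp : ∀ s ∈ spectrum ℝ t, 0 < s + ε ^ 2 := fun s hs => by
      have := hsp s hs; positivity
    have hcr : ∀ s ∈ spectrum ℝ t, √(s + ε ^ 2) ≠ 0 := fun s hs => (Real.sqrt_pos.2 (hcp s hs)).ne'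
    have hcon1 : ContinuousOn (fun s : ℝ => √(s + ε ^ 2)) (spectrum ℝ t) := by fun_prop
    have hcon2 : ContinuousOn (fun s : ℝ => (√(s + ε ^ 2))⁻¹) (spectrum ℝ t) := hcon1.inv₀ hcr
    have hcon3 : ContinuousOn (fun s : ℝ => s * (√(s + ε ^ 2))⁻¹) (spectrum ℝ t) :=
      continuousOn_id.mul hcon2
    set h : H →L[ℂ] H := cfc (fun s : ℝ => √(s + ε ^ 2)) t with hh
    set g : H →L[ℂ] H := cfc (fun s : ℝ => (√(s + ε ^ 2))⁻¹) t with hg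
    set m : H →L[ℂ] H := cfc (fun s : ℝ => s * (√(s + ε ^ 2))⁻¹) t with hm
    have hhN : h ∈ N := vn_cfc_mem N htM _
    have hgN : g ∈ N := vn_cfc_mem N htM _
    have hmN : m ∈ N := vn_cfc_mem N htM _
    have hgs : star g = g := (cfc_predicate _ t : IsSelfAdjoint _).star_eq
    have hhs : star h = h := (cfc_predicate _ t : IsSelfAdjoint _).star_eq
    have hgh : g * h = 1 := by
      rw [hg, hh, ← cfc_mul _ _ t hcon2 hcon1, ← cfc_one ℝ t]
      exact cfc_congr fun s hs => inv_mul_cancel₀ (hcr s hs)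
    have htg : t * g = m := by
      have : cfc (fun s : ℝ => s) t * g = m := by
        rw [hg, hm, ← cfc_mul _ _ t (by fun_prop) hcon2]
      rwa [cfc_id' ℝ t] at this
    have hh0 : 0 ≤ h := cfc_nonneg fun s _ => Real.sqrt_nonneg _
    have hhm : h - m ≤ algebraMap ℝ _ ε := by
      rw [hh, hm, ← cfc_sub _ _ t hcon1 hcon3]
      refine cfc_le_algebraMap _ _ _ (fun s hs => ?_) (hcon1.sub hcon3) hsa
      have h1 := Real.sqrt_pos.2 (hcp s hs)
      have h2 : √(s + ε ^ 2) * √(s + ε ^ 2) = s + ε ^ 2 := Real.mul_self_sqrt (hcp s hs).le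
      have h3 : ε ≤ √(s + ε ^ 2) := Real.le_sqrt_of_sq_le (by linarith [hsp s hs])
      rw [← div_eq_mul_inv, sub_le_iff_le_add, ← sub_le_iff_le_add', le_div_iff₀ h1]
      nlinarith
    have hug : ‖y * g‖ ≤ 1 := by
      have h1 : star (y * g) * (y * g) ≤ algebraMap ℝ _ 1 := by
        have h2 : star (y * g) * (y * g) = g * m := by
          rw [star_mul, hgs, ← htg, ht]; simp only [mul_assoc]
        rw [h2, hg, hm, ← cfc_mul _ _ t hcon2 hcon3]
        refine cfc_le_algebraMap _ _ _ (fun s hs => ?_) (hcon2.mul hcon3) hsa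
        have h3 := Real.sqrt_pos.2 (hcp s hs)
        have h4 : √(s + ε ^ 2) * √(s + ε ^ 2) = s + ε ^ 2 := Real.mul_self_sqrt (hcp s hs).le
        rw [mul_comm, mul_assoc, ← mul_inv, h4, ← div_eq_mul_inv, div_le_one (hcp s hs)]
        nlinarith
      have h5 := (CStarAlgebra.norm_le_iff_le_algebraMap _ zero_le_one
        (star_mul_self_nonneg (y * g))).2 h1
      rw [CStarRing.norm_star_mul_self] at h5
      nlinarith [norm_nonneg (y * g)]
    have hugN : y * g ∈ N := mul_mem hyN hgN
    have hyu : y = (y * g) * h := by rw [mul_assoc, hgh, mul_one]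
    have hbR : ‖R • (y * g)‖ ≤ R := by
      rw [norm_smul, Real.norm_of_nonneg (norm_nonneg x)]
      have : 0 ≤ R := norm_nonneg x
      nlinarith
    have h1 := hvar' (R • (y * g)) (vn_rsmul_mem N _ hugN) hbR
    have hbM : R • (y * g) ∈ M := hNM (vn_rsmul_mem N R hugN)
    have h2 : (inner ℂ (io M tr y) (io M tr (R • (y * g)))).re = R * (tr.τ m).re := by
      rw [io_inner tr hyM hbM, mul_smul_comm, ← mul_assoc, ← ht, htg, tau_rsmul_re]
    have h3 : (inner ℂ (io M tr y) (io M tr x)).re ≤ R * (tr.τ h).re := by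
      rw [io_inner tr hyM hx]
      have e1 : star y * x = h * (star (y * g) * x) := by
        conv_lhs => rw [hyu]
        rw [star_mul, hhs, mul_assoc]
      rw [e1]
      refine (Complex.re_le_norm _).trans ((tau_mul_le (hNM hhN) hh0
        (mul_mem (star_mem (hNM hugN)) hx)).trans ?_)
      refine mul_le_mul_of_nonneg_right ?_ (tau_nonneg tr (hNM hhN) hh0).1
      refine (norm_mul_le _ _).trans ?_
      rw [norm_star]
      have : 0 ≤ R := norm_nonneg x
      nlinarith [norm_nonneg (y * g)]
    have h4 : (tr.τ h).re - (tr.τ m).re ≤ ε := by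
      have := tau_mono tr (sub_mem (hNM hhN) (hNM hmN)) (algMap_mem M ε) hhm
      rwa [tau_algebraMap, map_sub, Complex.sub_re] at this
    have h5 : ∀ z ∈ M, ‖z‖ ≤ R → |(inner ℂ (η - io M tr y) (io M tr z)).re| ≤ ε * R := by
      intro z hz hzR
      refine (Complex.abs_re_le_norm _).trans ((norm_inner_le_norm _ _).trans ?_)
      exact mul_le_mul hyη.le ((io_norm_le tr hz).trans hzR) (norm_nonneg _) hε.le
    have h6 := h5 x hx le_rfl
    have h7 := h5 _ hbM hbR
    rw [inner_sub_left, Complex.sub_re, abs_le] at h6 h7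
    have hR0 : 0 ≤ R := norm_nonneg x
    have h8 : R * ((tr.τ h).re - (tr.τ m).re) ≤ R * ε := mul_le_mul_of_nonneg_left h4 hR0
    nlinarith [h6.1, h6.2, h7.1, h7.2]
  have hη0 : ‖η‖ ^ 2 ≤ 0 := by
    have hl : Tendsto (fun n : ℕ => 3 * R * (1 / ((n : ℝ) + 1))) atTop (𝓝 (3 * R * 0)) :=
      tendsto_one_div_add_atTop_nhds_zero_nat.const_mul _
    rw [mul_zero] at hl
    exact ge_of_tendsto' hl fun n => key _ (by positivity)
  have : η = 0 := by
    have h9 : ‖η‖ ^ 2 = 0 := le_antisymm hη0 (sq_nonneg _)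
    exact norm_eq_zero.1 (pow_eq_zero_iff (two_ne_zero) |>.1 h9)
  rw [hb₀c]
  exact (sub_eq_zero.1 this).symm

theorem mem_of_io_mem (nd : NormalData tr k α C) {N : VonNeumannAlgebra H}
    (hNM : (N : Set (H →L[ℂ] H)) ⊆ M) {x : H →L[ℂ] H} (hx : x ∈ M)
    (h : io M tr x ∈ KG tr (vnSub N)) : x ∈ N := by
  obtain ⟨b, hb, hbx⟩ := exists_condExp nd hNM hx
  rw [Submodule.starProjection_eq_self_iff.2 h] at hbx
  rw [← io_inj2 tr (hNM hb) hx hbx]; exact hb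

end L2normal
end CD

namespace CD

section dc
variable {H : Type} [NormedAddCommGroup H] [InnerProductSpace ℂ H] [CompleteSpace H]

/-- coordinate inclusion -/
def inI (k : ℕ) (i : Fin k) : H →L[ℂ] PiLp 2 (fun _ : Fin k => H) :=
  (PiLp.continuousLinearEquiv 2 ℂ (fun _ : Fin k => H)).symm.toContinuousLinearMap ∘L
    ContinuousLinearMap.single ℂ (fun _ : Fin k => H) i

/-- coordinate projection -/
def prI (k : ℕ) (i : Fin k) : PiLp 2 (fun _ : Fin k => H) →L[ℂ] H :=
  PiLp.proj 2 (fun _ : Fin k => H) i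

theorem prI_apply (k : ℕ) (i : Fin k) (ξ : PiLp 2 (fun _ : Fin k => H)) : prI k i ξ = ξ i := rfl

theorem inI_apply (k : ℕ) (i j : Fin k) (v : H) : (inI k i v) j = if j = i then v else 0 := by
  change (Pi.single i v : Fin k → H) j = _
  rw [Pi.single_apply]

theorem sum_inI (k : ℕ) (ξ : PiLp 2 (fun _ : Fin k => H)) : ∑ i, inI k i (ξ i) = ξ := by
  ext j
  rw [← prI_apply, map_sum]
  simp [prI_apply, inI_apply]

/-- amplification -/
def dgI (k : ℕ) (x : H →L[ℂ] H) : PiLp 2 (fun _ : Fin k => H) →L[ℂ] PiLp 2 (fun _ : Fin k => H) :=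
  ∑ i, (inI k i) ∘L x ∘L (prI k i)

theorem dgI_apply (k : ℕ) (x : H →L[ℂ] H) (ξ : PiLp 2 (fun _ : Fin k => H)) (j : Fin k) :
    (dgI k x ξ) j = x (ξ j) := by
  rw [← prI_apply, dgI, ContinuousLinearMap.sum_apply, map_sum]
  simp [prI_apply, inI_apply]

theorem dgI_inner (k : ℕ) (x : H →L[ℂ] H) (ξ η : PiLp 2 (fun _ : Fin k => H)) :
    inner ℂ (dgI k x ξ) η = inner ℂ ξ (dgI k (star x) η) := by
  rw [PiLp.inner_apply, PiLp.inner_apply]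
  refine Finset.sum_congr rfl fun i _ => ?_
  rw [dgI_apply, dgI_apply, inner_star_right]

/-- vector of values -/
def JI {k : ℕ} (α : Fin k → H) : (H →L[ℂ] H) →ₗ[ℂ] PiLp 2 (fun _ : Fin k => H) where
  toFun x := WithLp.toLp 2 (fun i => x (α i))
  map_add' x y := rfl
  map_smul' c x := rfl

theorem JI_apply {k : ℕ} (α : Fin k → H) (x : H →L[ℂ] H) (i : Fin k) : JI α x i = x (α i) := rfl

theorem JI_norm {k : ℕ} (α : Fin k → H) (x : H →L[ℂ] H) : ‖JI α x‖ ^ 2 = ∑ i, ‖x (α i)‖ ^ 2 := by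
  rw [PiLp.norm_sq_eq_of_L2]; rfl

variable {M : VonNeumannAlgebra H} {tr : TraceOn H (M : Set (H →L[ℂ] H))}
variable {k : ℕ} {α : Fin k → H} {C : ℝ}

theorem JI_le (nd : NormalData tr k α C) {x : H →L[ℂ] H} (hx : x ∈ M) :
    ‖JI α x‖ ≤ √C * ‖io M tr x‖ := by
  have hC := nd.1
  apply le_of_sq_le_sq _ (by positivity)
  rw [mul_pow, Real.sq_sqrt hC.le, JI_norm]
  exact (nd.2 x hx).2

theorem le_JI (nd : NormalData tr k α C) {x : H →L[ℂ] H} (hx : x ∈ M) :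
    ‖io M tr x‖ ≤ √C * ‖JI α x‖ := by
  have hC := nd.1
  apply le_of_sq_le_sq _ (by positivity)
  rw [mul_pow, Real.sq_sqrt hC.le, JI_norm]
  exact (nd.2 x hx).1

theorem double_comm (nd : NormalData tr k α C) (S : Set (H →L[ℂ] H))
    (G : Submodule ℂ (H →L[ℂ] H)) (hS : S ⊆ M) (hG : ∀ g ∈ G, g ∈ M) (h1 : 1 ∈ G)
    (hSG : ∀ x ∈ S, ∀ g ∈ G, io M tr (x * g) ∈ KG tr G ∧ io M tr (star x * g) ∈ KG tr G)
    {y : H →L[ℂ] H} (hyM : y ∈ M) (hy : y ∈ vnGen S) : io M tr y ∈ KG tr G := by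
  have hC := nd.1
  have hsC : 0 < √C := Real.sqrt_pos.2 hC
  set V := (G.map (JI α)).topologicalClosure with hV
  have trans : ∀ x ∈ M, io M tr x ∈ KG tr G → JI α x ∈ V := by
    intro x hx hxG
    apply mem_closure_of_approx
    intro ε hε
    obtain ⟨g, hg, h⟩ := KG_approx hxG (show 0 < ε / √C by positivity)
    refine ⟨_, ⟨g, hg, rfl⟩, ?_⟩
    rw [← map_sub] at h ⊢
    have := JI_le nd (sub_mem hx (hG g hg))
    rw [lt_div_iff₀ hsC] at h
    linarith
  have hJ : ∀ x g : H →L[ℂ] H, dgI k x (JI α g) = JI α (x * g) := by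
    intro x g; ext i; rw [dgI_apply]; rfl
  have inv : ∀ x ∈ M, (∀ g ∈ G, io M tr (x * g) ∈ KG tr G) → ∀ v ∈ V, dgI k x v ∈ V := by
    intro x hx h
    apply closure_map_mem
    rintro _ ⟨g, hg, rfl⟩
    rw [hJ]
    exact trans _ (mul_mem hx (hG g hg)) (h g hg)
  have comm : ∀ x ∈ S, ∀ ξ, V.starProjection (dgI k x ξ) = dgI k x (V.starProjection ξ) := by
    intro x hx ξ
    apply proj_commute V (dgI k x) (dgI k (star x)) (dgI_inner k x)
    · exact inv x (hS hx) fun g hg => (hSG x hx g hg).1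
    · exact inv (star x) (star_mem (hS hx)) fun g hg => (hSG x hx g hg).2
  have hdin : ∀ (x : H →L[ℂ] H) (j : Fin k) (v : H), dgI k x (inI k j v) = inI k j (x v) := by
    intro x j v
    ext i
    rw [dgI_apply, inI_apply, inI_apply]
    split_ifs <;> simp
  have ent : ∀ i j, (prI k i ∘L V.starProjection ∘L inI k j : H →L[ℂ] H) ∈ Set.centralizer S := by
    intro i j
    rw [Set.mem_centralizer_iff]
    intro x hx
    ext v
    change x (V.starProjection (inI k j v) i) = V.starProjection (inI k j (x v)) i
    rw [← hdin, comm x hx, dgI_apply]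
  have hcy : dgI k y (V.starProjection (JI α 1)) = V.starProjection (dgI k y (JI α 1)) := by
    ext i
    rw [dgI_apply]
    conv_lhs => rw [← sum_inI k (JI α 1)]
    conv_rhs => rw [← sum_inI k (dgI k y (JI α 1))]
    rw [map_sum, map_sum]
    rw [← prI_apply, ← prI_apply, map_sum, map_sum, map_sum]
    refine Finset.sum_congr rfl fun j _ => ?_
    rw [dgI_apply]
    have := (Set.mem_centralizer_iff.1 hy) _ (ent i j)
    exact (congrArg (fun T : H →L[ℂ] H => T (JI α 1 j)) this).symm
  have h1V : V.starProjection (JI α 1) = JI α 1 := by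
    rw [Submodule.starProjection_eq_self_iff]
    exact Submodule.le_topologicalClosure _ ⟨1, h1, rfl⟩
  rw [h1V, hJ, mul_one] at hcy
  have hyV : JI α y ∈ V := by rw [hcy]; exact Submodule.starProjection_apply_mem _ _
  apply KG_of_approx
  intro ε hε
  obtain ⟨_, ⟨g, hg, rfl⟩, h⟩ := closure_approx hyV (show 0 < ε / √C by positivity)
  refine ⟨g, hg, ?_⟩
  rw [← map_sub] at h ⊢
  have := le_JI nd (sub_mem hyM (hG g hg))
  rw [lt_div_iff₀ hsC] at h
  linarith

end dc
end CD

namespace CD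

section dimF
variable {K : Type*} [NormedAddCommGroup K] [InnerProductSpace ℂ K] [CompleteSpace K]

theorem istarR (T : K →L[ℂ] K) (x y : K) : inner ℂ x (star T y) = inner ℂ (T x) y := by
  rw [ContinuousLinearMap.star_eq_adjoint, ContinuousLinearMap.adjoint_inner_right]

theorem istarL (T : K →L[ℂ] K) (x y : K) : inner ℂ (star T x) y = inner ℂ x (T y) := by
  rw [ContinuousLinearMap.star_eq_adjoint, ContinuousLinearMap.adjoint_inner_left]

theorem resolvent_data {n : ℕ} (T : Fin n → (K →L[ℂ] K)) {ε : ℝ} (hε : 0 < ε) :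
    ∃ D R : K →L[ℂ] K, star D = D ∧ (∀ x : K, x = D (∑ i, T i (star (T i) (D x))) + R x) ∧
      (∀ U : K →L[ℂ] K, (∀ i, Commute (T i * star (T i)) U) → Commute D U) ∧
      (∀ x, ‖R x‖ ≤ ‖x‖) ∧ (∀ i x, ‖R (T i x)‖ ≤ √ε * ‖x‖) ∧ (∀ i x, ‖D (T i x)‖ ≤ ‖x‖) ∧
      (∀ x : K, ∑ i, ‖star (T i) (D x)‖ ^ 2 ≤ ‖x‖ ^ 2) := by
  set S : K →L[ℂ] K := ∑ i, T i * star (T i) with hS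
  have hi0 : ∀ i, 0 ≤ T i * star (T i) := fun i => mul_star_self_nonneg _
  have hS0 : 0 ≤ S := Finset.sum_nonneg fun i _ => hi0 i
  have hiS : ∀ i, T i * star (T i) ≤ S := fun i =>
    Finset.single_le_sum (f := fun i => T i * star (T i)) (fun i _ => hi0 i) (Finset.mem_univ i)
  have hsa : IsSelfAdjoint S := IsSelfAdjoint.of_nonneg hS0
  have hsp : ∀ s ∈ spectrum ℝ S, 0 ≤ s := fun s hs => spectrum_nonneg_of_nonneg hS0 hs
  have hcp : ∀ s ∈ spectrum ℝ S, 0 < s + ε := fun s hs => by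
    have := hsp s hs; positivity
  have hcr : ∀ s ∈ spectrum ℝ S, √(s + ε) ≠ 0 := fun s hs => (Real.sqrt_pos.2 (hcp s hs)).ne'
  have hcD : ContinuousOn (fun s : ℝ => (√(s + ε))⁻¹) (spectrum ℝ S) :=
    ContinuousOn.inv₀ (by fun_prop) hcr
  have hcR : ContinuousOn (fun s : ℝ => ε * (s + ε)⁻¹) (spectrum ℝ S) :=
    continuousOn_const.mul (ContinuousOn.inv₀ (by fun_prop) fun s hs => (hcp s hs).ne')
  set D : K →L[ℂ] K := cfc (fun s : ℝ => (√(s + ε))⁻¹) S with hD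
  set R : K →L[ℂ] K := cfc (fun s : ℝ => ε * (s + ε)⁻¹) S with hR
  have hDs : star D = D := (cfc_predicate _ S : IsSelfAdjoint _).star_eq
  have hRs : star R = R := (cfc_predicate _ S : IsSelfAdjoint _).star_eq
  have hid : cfc (fun s : ℝ => s) S = S := cfc_id' ℝ S
  have hcDs : ContinuousOn (fun s : ℝ => (√(s + ε))⁻¹ * s) (spectrum ℝ S) :=
    hcD.mul continuousOn_id
  have hcDsD : ContinuousOn (fun s : ℝ => (√(s + ε))⁻¹ * s * (√(s + ε))⁻¹) (spectrum ℝ S) :=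
    hcDs.mul hcD
  have hcRs : ContinuousOn (fun s : ℝ => ε * (s + ε)⁻¹ * s) (spectrum ℝ S) :=
    hcR.mul continuousOn_id
  have hDSD : D * S * D + R = 1 := by
    have h1 : D * S = cfc (fun s : ℝ => (√(s + ε))⁻¹ * s) S := by
      rw [cfc_mul _ _ S hcD (by fun_prop), hid]
    have h2 : D * S * D = cfc (fun s : ℝ => (√(s + ε))⁻¹ * s * (√(s + ε))⁻¹) S := by
      rw [h1, cfc_mul _ _ S hcDs hcD]
    rw [h2, hR, ← cfc_add S _ _ hcDsD hcR, ← cfc_one ℝ S]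
    apply cfc_congr
    intro s hs
    have h3 := hcp s hs
    have h4 : √(s + ε) * √(s + ε) = s + ε := Real.mul_self_sqrt h3.le
    have h5 : (√(s + ε))⁻¹ * s * (√(s + ε))⁻¹ = s * (s + ε)⁻¹ := by
      rw [mul_comm _ s, mul_assoc, ← mul_inv, h4]
    simp only [h5, Pi.one_apply]
    field_simp
  have hR0 : 0 ≤ R := cfc_nonneg fun s hs => by have := hcp s hs; positivity
  have hRSR : R * S * R ≤ algebraMap ℝ _ ε := by
    have h1 : R * S = cfc (fun s : ℝ => ε * (s + ε)⁻¹ * s) S := by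
      rw [cfc_mul _ _ S hcR (by fun_prop), hid]
    have h2 : R * S * R = cfc (fun s : ℝ => ε * (s + ε)⁻¹ * s * (ε * (s + ε)⁻¹)) S := by
      rw [h1, cfc_mul _ _ S hcRs hcR]
    rw [h2]
    refine cfc_le_algebraMap _ _ _ (fun s hs => ?_) (hcRs.mul hcR) hsa
    have h3 := hcp s hs
    have h4 := hsp s hs
    have h5 : (s + ε)⁻¹ * s ≤ 1 := by
      rw [inv_mul_le_one₀ h3]; linarith
    have h6 : ε * (s + ε)⁻¹ ≤ 1 := by
      rw [← div_eq_mul_inv, div_le_one h3]; linarith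
    have h7 : 0 ≤ ε * (s + ε)⁻¹ := by positivity
    calc ε * (s + ε)⁻¹ * s * (ε * (s + ε)⁻¹) = ε * ((s + ε)⁻¹ * s) * (ε * (s + ε)⁻¹) := by ring
      _ ≤ ε * 1 * 1 := by gcongr
      _ = ε := by ring
  have hRn : ‖R‖ ≤ 1 := by
    rw [hR]
    refine norm_cfc_le zero_le_one fun s hs => ?_
    have h3 := hcp s hs
    rw [Real.norm_of_nonneg (by positivity), ← div_eq_mul_inv, div_le_one h3]
    linarith [hsp s hs]
  have normle : ∀ (B : K →L[ℂ] K) (c : ℝ), 0 ≤ c → B * star B ≤ algebraMap ℝ _ c → ‖B‖ ≤ √c := by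
    intro B c hc h
    have h5 := (CStarAlgebra.norm_le_iff_le_algebraMap _ hc (mul_star_self_nonneg B)).2 h
    rw [CStarRing.norm_self_mul_star] at h5
    exact Real.le_sqrt_of_sq_le (by nlinarith)
  have hDSD1 : D * S * D ≤ algebraMap ℝ _ 1 := by
    rw [map_one, ← hDSD]; exact le_add_of_nonneg_right hR0
  have conj : ∀ (B : K →L[ℂ] K), star B = B → ∀ i, (B * T i) * star (B * T i) ≤ B * S * B := by
    intro B hB i
    have := star_left_conjugate_le_conjugate (hiS i) B
    rw [hB] at this
    rw [star_mul, hB]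
    calc B * T i * (star (T i) * B) = B * (T i * star (T i)) * B := by noncomm_ring
      _ ≤ _ := this
  refine ⟨D, R, hDs, fun x => ?_, fun U hU => ?_, fun x => ?_, fun i x => ?_, fun i x => ?_,
    fun x => ?_⟩
  · have := congrArg (fun B : K →L[ℂ] K => B x) hDSD
    have h2 : S (D x) = ∑ i, T i (star (T i) (D x)) := by
      rw [hS, ContinuousLinearMap.sum_apply]; rfl
    rw [← h2]
    exact this.symm
  · have : Commute S U := Commute.sum_left _ _ _ fun i _ => hU i
    exact Commute.cfc_real this _
  · exact (R.le_opNorm x).trans (by nlinarith [norm_nonneg x])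
  · have h1 := normle (R * T i) ε hε.le ((conj R hRs i).trans hRSR)
    exact ((R * T i).le_opNorm x).trans (mul_le_mul_of_nonneg_right h1 (norm_nonneg x))
  · have h1 := normle (D * T i) 1 zero_le_one ((conj D hDs i).trans hDSD1)
    rw [Real.sqrt_one] at h1
    exact ((D * T i).le_opNorm x).trans (by nlinarith [norm_nonneg x])
  · have h1 : ((∑ i, ‖star (T i) (D x)‖ ^ 2 : ℝ) : ℂ) = inner ℂ x (D (S (D x))) := by
      have h2 : S (D x) = ∑ i, T i (star (T i) (D x)) := by
        rw [hS, ContinuousLinearMap.sum_apply]; rfl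
      have h3 : inner ℂ x (D (S (D x))) = inner ℂ (D x) (S (D x)) := by
        conv_lhs => rw [← hDs, istarR]
        rw [hDs]
      rw [h3, h2, inner_sum, Complex.ofReal_sum]
      refine Finset.sum_congr rfl fun i _ => ?_
      rw [← istarL, inner_self_eq_norm_sq_to_K]
      push_cast; rfl
    have h4 : D (S (D x)) = x - R x := by
      rw [eq_sub_iff_add_eq]
      exact congrArg (fun B : K →L[ℂ] K => B x) hDSD
    rw [h4, inner_sub_right, inner_self_eq_norm_sq_to_K] at h1
    have h5 := congrArg Complex.re h1
    have h6 : 0 ≤ (inner ℂ x (R x)).re :=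
      ((ContinuousLinearMap.nonneg_iff_isPositive R).1 hR0).re_inner_nonneg_right x
    rw [Complex.ofReal_re, Complex.sub_re] at h5
    have h7 : (((‖x‖ : ℂ)) ^ 2).re = ‖x‖ ^ 2 := by norm_cast
    rw [h5]
    change (((‖x‖ : ℂ)) ^ 2).re - _ ≤ _
    rw [h7]
    linarith

theorem dimF {Γ : Type} [Group Γ] {n m : ℕ} (T : Fin n → (K →L[ℂ] K)) (r : Γ → (K →L[ℂ] K))
    (hr : ∀ g, star (r g) = r g⁻¹) (hr1 : r 1 = 1) (hTr : ∀ i g, Commute (T i) (r g))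
    (W : Submodule ℂ K) [W.HasOrthogonalProjection]
    (hW : ∀ w ∈ W, ∀ δ : ℝ, 0 < δ → ∃ ζ : Fin n → K, ‖w - ∑ i, T i (ζ i)‖ < δ)
    (v : K) (hv : ‖v‖ ≤ 1)
    (hb : ∀ i z, ∀ δ : ℝ, 0 < δ → ∃ F : Finset Γ, ‖star (T i) z‖ ^ 2 ≤
      ∑ g ∈ F, ‖(inner ℂ (r g v) (star (T i) z) : ℂ)‖ ^ 2 + δ)
    (a : Fin m → K) (hon : Orthonormal ℂ (fun p : Γ × Fin m => r p.1 (a p.2))) :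
    ∑ j, ‖W.starProjection (a j)‖ ^ 2 ≤ n := by
  have hTr' : ∀ i g, Commute (star (T i)) (r g) := by
    intro i g
    have := (hTr i g⁻¹).star_star
    rwa [hr, inv_inv] at this
  have key : ∀ δ : ℝ, 0 < δ → ∑ j, ‖W.starProjection (a j)‖ ^ 2 ≤ n + m * (n * δ) + m * (2 * δ) := by
    intro δ hδ
    have hζ : ∀ j, ∃ ζ : Fin n → K, ‖W.starProjection (a j) - ∑ i, T i (ζ i)‖ < δ / 2 :=
      fun j => hW _ (Submodule.starProjection_apply_mem _ _) _ (by positivity)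
    choose ζ hζ using hζ
    set B : ℝ := ∑ j, ∑ i, ‖ζ j i‖ + 1 with hB
    have hB0 : 0 < B := by positivity
    have hBj : ∀ j, ∑ i, ‖ζ j i‖ ≤ B := fun j => by
      have := Finset.single_le_sum (f := fun j => ∑ i, ‖ζ j i‖) (fun j _ => by positivity)
        (Finset.mem_univ j)
      rw [hB]; linarith
    obtain ⟨D, R, hD, hdec, hcom, hR1, hR2, hD1, hD2⟩ := resolvent_data T
      (show 0 < (δ / (2 * B)) ^ 2 by positivity)
    have hRa : ∀ j, ‖R (W.starProjection (a j))‖ ≤ δ := by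
      intro j
      have e : R (W.starProjection (a j)) = R (W.starProjection (a j) - ∑ i, T i (ζ j i)) +
          ∑ i, R (T i (ζ j i)) := by
        rw [map_sub, map_sum]; abel
      rw [e]
      refine (norm_add_le _ _).trans ?_
      have h1 := (hR1 (W.starProjection (a j) - ∑ i, T i (ζ j i))).trans (hζ j).le
      have h2 : ‖∑ i, R (T i (ζ j i))‖ ≤ δ / (2 * B) * B := by
        refine (norm_sum_le _ _).trans ?_
        have : ∀ i ∈ Finset.univ, ‖R (T i (ζ j i))‖ ≤ δ / (2 * B) * ‖ζ j i‖ := fun i _ => by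
          have := hR2 i (ζ j i)
          rwa [Real.sqrt_sq (by positivity)] at this
        refine (Finset.sum_le_sum this).trans ?_
        rw [← Finset.mul_sum]
        exact mul_le_mul_of_nonneg_left (hBj j) (by positivity)
      have h3 : δ / (2 * B) * B = δ / 2 := by field_simp
      linarith
    have hna : ∀ j, ‖a j‖ ≤ 1 := by
      intro j
      have h1 := hon.1 ((1 : Γ), j)
      simp only [hr1] at h1
      exact h1.le
    have hpt : ∀ j, ‖W.starProjection (a j)‖ ^ 2 ≤ ∑ i, ‖star (T i) (D (a j))‖ ^ 2 + 2 * δ := by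
      intro j
      set w := W.starProjection (a j) with hw
      have h1 : (inner ℂ w (a j) : ℂ).re = ‖w‖ ^ 2 := by
        have : inner ℂ w (a j - w) = 0 :=
          (Submodule.mem_orthogonal _ _).1 (Submodule.sub_starProjection_mem_orthogonal _) _
            (Submodule.starProjection_apply_mem _ _)
        rw [inner_sub_right, sub_eq_zero] at this
        rw [this, @norm_sq_eq_re_inner ℂ]; rfl
      have h2 : inner ℂ w (a j) = ∑ i, inner ℂ (star (T i) (D w)) (star (T i) (D (a j))) +
          inner ℂ (R w) (a j) := by
        conv_lhs => rw [hdec w]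
        rw [inner_add_left, ← hD, istarL, sum_inner, hD]
        congr 1
        refine Finset.sum_congr rfl fun i _ => ?_
        rw [istarR]
      rw [h2, Complex.add_re, Complex.re_sum] at h1
      have h3 : (inner ℂ (R w) (a j) : ℂ).re ≤ δ := by
        refine (Complex.re_le_norm _).trans ((norm_inner_le_norm _ _).trans ?_)
        have := hRa j
        have := hna j
        nlinarith [norm_nonneg (R w), norm_nonneg (a j)]
      have h4 : ∀ i ∈ Finset.univ, (inner ℂ (star (T i) (D w)) (star (T i) (D (a j))) : ℂ).re ≤
          (1 / 2) * ‖star (T i) (D w)‖ ^ 2 + (1 / 2) * ‖star (T i) (D (a j))‖ ^ 2 := by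
        intro i _
        refine (Complex.re_le_norm _).trans ((norm_inner_le_norm _ _).trans ?_)
        nlinarith [sq_nonneg (‖star (T i) (D w)‖ - ‖star (T i) (D (a j))‖)]
      have h5 := Finset.sum_le_sum h4
      rw [Finset.sum_add_distrib, ← Finset.mul_sum, ← Finset.mul_sum] at h5
      have h6 := hD2 w
      linarith
    have hcol : ∀ i, ∑ j, ‖star (T i) (D (a j))‖ ^ 2 ≤ 1 + m * δ := by
      intro i
      have hF : ∀ j, ∃ F : Finset Γ, ‖star (T i) (D (a j))‖ ^ 2 ≤
        ∑ g ∈ F, ‖(inner ℂ (r g v) (star (T i) (D (a j))) : ℂ)‖ ^ 2 + δ := fun j => hb i _ δ hδ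
      choose F hF using hF
      set F' : Finset (Γ × Fin m) := (Finset.univ.sigma fun j => F j).map
        ⟨fun p => (p.2⁻¹, p.1), fun p q h => by
          simp only [Prod.mk.injEq, inv_inj] at h
          exact Sigma.ext h.2 (heq_of_eq h.1)⟩ with hF'
      have hbes := hon.sum_inner_products_le (D (T i v)) (s := F')
      rw [hF', Finset.sum_map, Finset.sum_sigma] at hbes
      have hDv : ‖D (T i v)‖ ^ 2 ≤ 1 := by
        have := (hD1 i v).trans hv
        nlinarith [norm_nonneg (D (T i v))]
      have hDr : ∀ g, Commute D (r g) := fun g => hcom _ fun i => (hTr i g).mul_left (hTr' i g)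
      have h1 : ∀ j g, ‖(inner ℂ (r g v) (star (T i) (D (a j))) : ℂ)‖ =
          ‖(inner ℂ (r g⁻¹ (a j)) (D (T i v)) : ℂ)‖ := by
        intro j g
        rw [istarR]
        have e1 : T i (r g v) = r g (T i v) := congrArg (fun B : K →L[ℂ] K => B v) (hTr i g)
        have e2 : D (r g (T i v)) = r g (D (T i v)) :=
          congrArg (fun B : K →L[ℂ] K => B (T i v)) (hDr g)
        rw [e1, ← hD, istarR, hD, e2, ← istarR, hr, ← inner_conj_symm, RCLike.norm_conj]
      calc ∑ j, ‖star (T i) (D (a j))‖ ^ 2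
          ≤ ∑ j, (∑ g ∈ F j, ‖(inner ℂ (r g v) (star (T i) (D (a j))) : ℂ)‖ ^ 2 + δ) :=
            Finset.sum_le_sum fun j _ => hF j
        _ = ∑ j, ∑ g ∈ F j, ‖(inner ℂ (r g⁻¹ (a j)) (D (T i v)) : ℂ)‖ ^ 2 + m * δ := by
            rw [Finset.sum_add_distrib, Finset.sum_const, Finset.card_univ, Fintype.card_fin,
              nsmul_eq_mul]
            simp_rw [h1]
        _ ≤ 1 + m * δ := by
            have : ∑ j, ∑ g ∈ F j, ‖(inner ℂ (r g⁻¹ (a j)) (D (T i v)) : ℂ)‖ ^ 2 ≤ 1 :=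
              hbes.trans hDv
            linarith
    calc ∑ j, ‖W.starProjection (a j)‖ ^ 2
        ≤ ∑ j, (∑ i, ‖star (T i) (D (a j))‖ ^ 2 + 2 * δ) := Finset.sum_le_sum fun j _ => hpt j
      _ = ∑ i, ∑ j, ‖star (T i) (D (a j))‖ ^ 2 + m * (2 * δ) := by
          rw [Finset.sum_add_distrib, Finset.sum_const, Finset.card_univ, Fintype.card_fin,
              nsmul_eq_mul, Finset.sum_comm]
      _ ≤ ∑ i : Fin n, (1 + m * δ) + m * (2 * δ) := by
          gcongr with i _
          exact hcol i
      _ = n + m * (n * δ) + m * (2 * δ) := by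
          rw [Finset.sum_const, Finset.card_univ, Fintype.card_fin, nsmul_eq_mul]; ring
  have hl : Tendsto (fun q : ℕ => (n : ℝ) + m * (n * (1 / ((q : ℝ) + 1))) + m * (2 * (1 / ((q : ℝ) + 1))))
      atTop (𝓝 (n + m * (n * 0) + m * (2 * 0))) := by
    have h := tendsto_one_div_add_atTop_nhds_zero_nat (𝕜 := ℝ)
    exact (tendsto_const_nhds.add ((h.const_mul _).const_mul _)).add ((h.const_mul _).const_mul _)
  have := ge_of_tendsto' hl fun q => key _ (by positivity)
  simpa using this

end dimF
end CD

namespace CD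

section vnof
variable {H : Type} [NormedAddCommGroup H] [InnerProductSpace ℂ H] [CompleteSpace H]

/-- commutant of a star-closed set as a von Neumann algebra -/
def vnOf (S : Set (H →L[ℂ] H)) : VonNeumannAlgebra H :=
  { StarSubalgebra.centralizer ℂ S with
    centralizer_centralizer' := by
      change Set.centralizer (Set.centralizer ((StarSubalgebra.centralizer ℂ S : StarSubalgebra ℂ (H →L[ℂ] H)) : Set (H →L[ℂ] H))) = _
      rw [StarSubalgebra.coe_centralizer]
      exact Set.centralizer_centralizer_centralizer _ }

theorem mem_vnOf {S : Set (H →L[ℂ] H)} (hS : ∀ s ∈ S, star s ∈ S) {x : H →L[ℂ] H} :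
    x ∈ vnOf S ↔ ∀ s ∈ S, s * x = x * s := by
  change x ∈ StarSubalgebra.centralizer ℂ S ↔ _
  rw [StarSubalgebra.mem_centralizer_iff]
  exact ⟨fun h s hs => (h s hs).1, fun h s hs => ⟨h s hs, h _ (hS s hs)⟩⟩

theorem vnOf_gen {S : Set (H →L[ℂ] H)} (hS : ∀ s ∈ S, star s ∈ S) :
    ((vnOf (Set.centralizer S) : VonNeumannAlgebra H) : Set (H →L[ℂ] H)) = vnGen S := by
  ext x
  rw [SetLike.mem_coe, mem_vnOf]
  · rw [vnGen, Set.mem_centralizer_iff]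
  · intro s hs
    rw [Set.mem_centralizer_iff] at hs ⊢
    intro m hm
    have := congrArg star (hs _ (hS m hm))
    rw [star_mul, star_mul, star_star] at this
    exact this.symm

/-- intersection of von Neumann algebras -/
def vnInf (N A : VonNeumannAlgebra H) : VonNeumannAlgebra H :=
  vnOf ((N.commutant : Set (H →L[ℂ] H)) ∪ A.commutant)

theorem mem_vnInf {N A : VonNeumannAlgebra H} {x : H →L[ℂ] H} : x ∈ vnInf N A ↔ x ∈ N ∧ x ∈ A := by
  rw [vnInf, mem_vnOf]
  · constructor
    · intro h
      exact ⟨vn_mem_of N fun y hy => (h y (Or.inl hy)), vn_mem_of A fun y hy => (h y (Or.inr hy))⟩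
    · rintro ⟨h1, h2⟩ s (hs | hs)
      · exact (vn_comm N h1 hs).symm
      · exact (vn_comm A h2 hs).symm
  · rintro s (hs | hs)
    · exact Or.inl (star_mem (S := VonNeumannAlgebra H) hs)
    · exact Or.inr (star_mem (S := VonNeumannAlgebra H) hs)

variable {M : VonNeumannAlgebra H} {tr : TraceOn H (M : Set (H →L[ℂ] H))}

theorem KG_orth {G : Submodule ℂ (H →L[ℂ] H)} {ξ : L2 M tr}
    (h : ∀ g ∈ G, inner ℂ (io M tr g) ξ = 0) : ∀ η ∈ KG tr G, inner ℂ η ξ = 0 := by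
  intro η hη
  have : KG tr G ≤ (ℂ ∙ ξ)ᗮ := by
    apply KG_mono (Submodule.isClosed_orthogonal _)
    intro g hg
    rw [Submodule.mem_orthogonal_singleton_iff_inner_left]
    exact h g hg
  exact (Submodule.mem_orthogonal_singleton_iff_inner_left).1 (this hη)

theorem proj_eq_of_tau {N : VonNeumannAlgebra H} (hNM : (N : Set (H →L[ℂ] H)) ⊆ M)
    {x e : H →L[ℂ] H} (hx : x ∈ M) (he : e ∈ N)
    (h : ∀ a ∈ N, tr.τ (star a * x) = tr.τ (star a * e)) :
    (KG tr (vnSub N)).starProjection (io M tr x) = io M tr e := by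
  apply Submodule.eq_starProjection_of_mem_orthogonal
  · exact io_mem_KG he
  · rw [Submodule.mem_orthogonal]
    apply KG_orth
    intro g hg
    rw [inner_sub_right, io_inner tr (hNM hg) hx, io_inner tr (hNM hg) (hNM he), h g hg, sub_self]

theorem tau_of_proj {N : VonNeumannAlgebra H} (hNM : (N : Set (H →L[ℂ] H)) ⊆ M)
    {x e : H →L[ℂ] H} (hx : x ∈ M) (he : e ∈ N)
    (h : io M tr e = (KG tr (vnSub N)).starProjection (io M tr x)) {a : H →L[ℂ] H} (ha : a ∈ N) :
    tr.τ (star a * x) = tr.τ (star a * e) := by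
  rw [← io_inner tr (hNM ha) hx, ← io_inner tr (hNM ha) (hNM he), h, ← sub_eq_zero, ← inner_sub_right]
  exact (Submodule.mem_orthogonal _ _).1 (Submodule.sub_starProjection_mem_orthogonal _) _
    (io_mem_KG ha)

theorem eq_of_tau {N : VonNeumannAlgebra H} (hNM : (N : Set (H →L[ℂ] H)) ⊆ M)
    {x e : H →L[ℂ] H} (hx : x ∈ N) (he : e ∈ N)
    (h : ∀ a ∈ N, tr.τ (star a * x) = tr.τ (star a * e)) : x = e := by
  rw [← sub_eq_zero]
  apply tr.faithful _ (hNM (sub_mem hx he))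
  rw [mul_sub, map_sub, h _ (sub_mem hx he), sub_self]

end vnof

section cp
variable {H : Type} [NormedAddCommGroup H] [InnerProductSpace ℂ H] [CompleteSpace H]
variable {Γ : Type} [Group Γ] (X : CrossedProduct Γ H)

theorem u_inv_mul (γ : Γ) : X.u γ⁻¹ * X.u γ = 1 := by rw [X.u_mul, inv_mul_cancel, X.u_one]
theorem u_mul_inv (γ : Γ) : X.u γ * X.u γ⁻¹ = 1 := by rw [X.u_mul, mul_inv_cancel, X.u_one]

theorem u_mem_Lg (γ : Γ) : X.u γ ∈ X.Lg := by
  change X.u γ ∈ (X.Lg : Set (H →L[ℂ] H))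
  rw [X.Lg_eq]
  exact Set.subset_centralizer_centralizer ⟨γ, rfl⟩

theorem ea_left {a x : H →L[ℂ] H} (ha : a ∈ X.A) (hx : x ∈ X.M) :
    X.EA.E (a * x) = a * X.EA.E x := by
  have := X.EA.bimod a ha 1 (one_mem X.A) x hx
  simpa using this

theorem ea_right {a x : H →L[ℂ] H} (ha : a ∈ X.A) (hx : x ∈ X.M) :
    X.EA.E (x * a) = X.EA.E x * a := by
  have := X.EA.bimod 1 (one_mem X.A) a ha x hx
  simpa using this

theorem sigma_mem (γ : Γ) {a : H →L[ℂ] H} (ha : a ∈ X.A) : X.u γ * a * X.u γ⁻¹ ∈ X.A := by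
  rw [← X.u_star]; exact X.conj_mem γ a ha

theorem cp_factor (habel : IsAbelianSet (X.A : Set (H →L[ℂ] H)))
    (hfree : IsFree X) (herg : IsErgodic X) : IsFactorSet (X.M : Set (H →L[ℂ] H)) := by
  intro x hx hc
  have h0 : ∀ γ : Γ, γ ≠ 1 → X.EA.E (x * X.u γ⁻¹) = 0 := by
    intro γ hγ
    have hxu : x * X.u γ⁻¹ ∈ X.M := mul_mem (S := VonNeumannAlgebra H) hx (X.u_mem _)
    have hE : X.EA.E (x * X.u γ⁻¹) ∈ X.A := X.EA.mem _ hxu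
    apply hfree γ hγ _ hE
    intro b hb
    have hsb := sigma_mem X γ hb
    rw [CrossedProduct.σ, X.u_star, habel _ hsb _ hE, ← ea_right X hsb hxu, habel _ hE _ hb,
      ← ea_left X hb hxu, ← mul_assoc b x, ← hc b (X.A_sub hb)]
    congr 1
    calc x * X.u γ⁻¹ * (X.u γ * b * X.u γ⁻¹) = x * (X.u γ⁻¹ * X.u γ) * b * X.u γ⁻¹ := by
          simp only [mul_assoc]
      _ = _ := by rw [u_inv_mul, mul_one]
  have hEx : X.EA.E x ∈ X.A := X.EA.mem x hx
  have h1 : x - X.EA.E x = 0 := by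
    apply X.fourier_sep _ (sub_mem (S := VonNeumannAlgebra H) hx (X.A_sub hEx))
    intro γ
    rw [X.u_star, sub_mul, map_sub, ea_left X hEx (X.u_mem _)]
    by_cases hγ : γ = 1
    · subst hγ
      rw [inv_one, X.u_one, mul_one, X.EA.fix 1 (one_mem X.A), mul_one, sub_self]
    · rw [h0 γ hγ, X.EA_u _ (inv_ne_one.2 hγ), mul_zero, sub_zero]
  have hxA : x ∈ X.A := by rw [sub_eq_zero.1 h1]; exact hEx
  apply herg x hxA
  intro γ
  rw [CrossedProduct.σ, ← hc _ (X.u_mem γ), X.u_star, mul_assoc, u_mul_inv, mul_one]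

theorem ea_tau {a x : H →L[ℂ] H} (ha : a ∈ X.A) (hx : x ∈ X.M) :
    X.tr.τ (star a * x) = X.tr.τ (star a * X.EA.E x) := by
  rw [← ea_left X (star_mem ha) hx, X.EA.trace_eq _ (mul_mem (star_mem (X.A_sub ha)) hx)]

/-- the closed subspace of A -/
abbrev KA : Submodule ℂ (L2 X.M X.tr) := KG X.tr (vnSub X.A)
/-- its projection -/
abbrev PA : L2 X.M X.tr →L[ℂ] L2 X.M X.tr := (KA X).starProjection

theorem PA_io {x : H →L[ℂ] H} (hx : x ∈ X.M) :
    PA X (io X.M X.tr x) = io X.M X.tr (X.EA.E x) :=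
  proj_eq_of_tau X.A_sub hx (X.EA.mem x hx) fun a ha => ea_tau X ha hx

/-- span of products a u -/
def AG : Submodule ℂ (H →L[ℂ] H) :=
  Submodule.span ℂ {x | ∃ a ∈ X.A, ∃ γ : Γ, x = a * X.u γ}

theorem AG_sub {x : H →L[ℂ] H} (hx : x ∈ AG X) : x ∈ X.M := by
  have : AG X ≤ vnSub X.M := by
    rw [AG, Submodule.span_le]
    rintro _ ⟨a, ha, γ, rfl⟩
    exact mul_mem (S := VonNeumannAlgebra H) (X.A_sub ha) (X.u_mem γ)
  exact this hx

theorem ea_of_orth {x : H →L[ℂ] H} (hx : x ∈ X.M) (γ : Γ)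
    (h : ∀ a ∈ X.A, inner ℂ (io X.M X.tr (a * X.u γ)) (io X.M X.tr x) = 0) :
    X.EA.E (x * X.u γ⁻¹) = 0 := by
  have hxu : x * X.u γ⁻¹ ∈ X.M := mul_mem (S := VonNeumannAlgebra H) hx (X.u_mem _)
  apply eq_of_tau (tr := X.tr) X.A_sub (X.EA.mem _ hxu) (zero_mem X.A)
  intro a ha
  rw [← ea_tau X ha hxu, mul_zero, map_zero]
  have h1 := h a ha
  rw [io_inner X.tr (mul_mem (X.A_sub ha) (X.u_mem γ)) hx, star_mul, X.u_star, mul_assoc,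
    X.tr.tracial _ (X.u_mem _) _ (mul_mem (star_mem (X.A_sub ha)) hx)] at h1
  rw [← mul_assoc]; exact h1

variable {k : ℕ} {α : Fin k → H} {C : ℝ}

theorem AG_mul_A {a x : H →L[ℂ] H} (ha : a ∈ X.A) (hx : x ∈ AG X) : a * x ∈ AG X := by
  have : AG X ≤ (AG X).comap (LinearMap.mulLeft ℂ a) := by
    conv_lhs => rw [AG]
    rw [Submodule.span_le]
    rintro _ ⟨b, hb, γ, rfl⟩
    exact Submodule.subset_span ⟨a * b, mul_mem ha hb, γ, by simp [mul_assoc]⟩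
  exact this hx

theorem AG_mul_u (g : Γ) {x : H →L[ℂ] H} (hx : x ∈ AG X) : X.u g * x ∈ AG X := by
  have : AG X ≤ (AG X).comap (LinearMap.mulLeft ℂ (X.u g)) := by
    conv_lhs => rw [AG]
    rw [Submodule.span_le]
    rintro _ ⟨b, hb, γ, rfl⟩
    refine Submodule.subset_span ⟨_, sigma_mem X g hb, g * γ, ?_⟩
    simp only [LinearMap.mulLeft_apply]
    calc X.u g * (b * X.u γ) = X.u g * b * (1 * X.u γ) := by rw [one_mul, mul_assoc]
      _ = X.u g * b * (X.u g⁻¹ * X.u g * X.u γ) := by rw [u_inv_mul]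
      _ = X.u g * b * X.u g⁻¹ * (X.u g * X.u γ) := by simp only [mul_assoc]
      _ = _ := by rw [X.u_mul]
  exact this hx

theorem cp_dense (nd : NormalData X.tr k α C) {y : H →L[ℂ] H} (hy : y ∈ X.M) :
    io X.M X.tr y ∈ KG X.tr (AG X) := by
  set S : Set (H →L[ℂ] H) := (X.A : Set (H →L[ℂ] H)) ∪ Set.range X.u with hS
  have hSs : ∀ s ∈ S, star s ∈ S := by
    rintro s (hs | ⟨γ, rfl⟩)
    · exact Or.inl (star_mem (S := VonNeumannAlgebra H) hs)
    · exact Or.inr ⟨γ⁻¹, (X.u_star γ).symm⟩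
  have hSM : S ⊆ X.M := by
    rintro s (hs | ⟨γ, rfl⟩)
    · exact X.A_sub hs
    · exact X.u_mem γ
  set P := vnOf (Set.centralizer S) with hP
  have hPgen : (P : Set (H →L[ℂ] H)) = vnGen S := vnOf_gen hSs
  have hPM : (P : Set (H →L[ℂ] H)) ⊆ X.M := by
    rw [hPgen, ← X.M.centralizer_centralizer]
    exact Set.centralizer_subset (Set.centralizer_subset hSM)
  have hSP : S ⊆ P := by rw [hPgen]; exact Set.subset_centralizer_centralizer
  obtain ⟨b, hb, hbx⟩ := exists_condExp nd hPM hy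
  have hyb : y - b = 0 := by
    apply X.fourier_sep _ (sub_mem hy (hPM hb))
    intro γ
    rw [X.u_star]
    apply ea_of_orth X (sub_mem hy (hPM hb))
    intro a ha
    rw [map_sub, hbx]
    refine (Submodule.mem_orthogonal _ _).1 (Submodule.sub_starProjection_mem_orthogonal _) _
      (io_mem_KG ?_)
    exact mul_mem (S := VonNeumannAlgebra H) (s := P) (hSP (Or.inl ha)) (hSP (Or.inr ⟨γ, rfl⟩))
  have hyP : y ∈ vnGen S := by
    rw [← hPgen, sub_eq_zero.1 hyb]; exact hb
  have main : ∀ x ∈ S, ∀ g ∈ AG X, x * g ∈ AG X := by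
    rintro s (hs | ⟨γ, rfl⟩) g hg
    · exact AG_mul_A X hs hg
    · exact AG_mul_u X γ hg
  refine double_comm nd S (AG X) hSM (fun g hg => AG_sub X hg) ?_ (fun x hx g hg => ?_) hy hyP
  · exact Submodule.subset_span ⟨1, one_mem X.A, 1, by rw [X.u_one, one_mul]⟩
  · exact ⟨io_mem_KG (main x hx g hg), io_mem_KG (main _ (hSs x hx) g hg)⟩

theorem AG_top (nd : NormalData X.tr k α C) (ξ : L2 X.M X.tr) : ξ ∈ KG X.tr (AG X) :=
  io_induction X.tr (fun ξ => ξ ∈ KG X.tr (AG X)) (KG_closed _) (fun y hy => cp_dense X nd hy) ξ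

end cp
end CD

namespace CD

section hilb2
variable {K : Type*} [NormedAddCommGroup K] [InnerProductSpace ℂ K]

theorem bessel_rev {Γ : Type} {e : Γ → K} (he : Orthonormal ℂ e) {z : K}
    (hz : z ∈ (Submodule.span ℂ (Set.range e)).topologicalClosure) {δ : ℝ} (hδ : 0 < δ) :
    ∃ F : Finset Γ, ‖z‖ ^ 2 ≤ ∑ g ∈ F, ‖(inner ℂ (e g) z : ℂ)‖ ^ 2 + δ := by
  obtain ⟨v, hv, hzv⟩ := closure_approx hz (Real.sqrt_pos.2 hδ)
  obtain ⟨c, rfl⟩ := (Finsupp.mem_span_range_iff_exists_finsupp).1 hv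
  refine ⟨c.support, ?_⟩
  rw [Finsupp.sum] at hzv
  set v := ∑ i ∈ c.support, c i • e i with hvd
  have h1 : ‖z - v‖ ^ 2 ≤ δ := by
    rw [← Real.sq_sqrt hδ.le]
    exact pow_le_pow_left₀ (norm_nonneg _) hzv.le 2
  have h2 : ‖z - v‖ ^ 2 = ‖z‖ ^ 2 - 2 * (inner ℂ z v : ℂ).re + ‖v‖ ^ 2 := by
    rw [@norm_sub_sq ℂ]; rfl
  have h3 : ‖v‖ ^ 2 = ∑ i ∈ c.support, ‖c i‖ ^ 2 := by
    rw [@norm_sq_eq_re_inner ℂ, hvd, he.inner_sum]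
    rw [map_sum]
    refine Finset.sum_congr rfl fun i _ => ?_
    rw [← Complex.normSq_eq_norm_sq, mul_comm, Complex.mul_conj]
    simp
  have h4 : (inner ℂ z v : ℂ).re = ∑ i ∈ c.support, (c i * inner ℂ z (e i)).re := by
    rw [hvd, inner_sum, Complex.re_sum]
    simp_rw [inner_smul_right]
  have h5 : ∀ i ∈ c.support, 2 * (c i * inner ℂ z (e i)).re ≤ ‖c i‖ ^ 2 +
      ‖(inner ℂ (e i) z : ℂ)‖ ^ 2 := by
    intro i _
    have h6 := Complex.re_le_norm (c i * inner ℂ z (e i))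
    rw [norm_mul, norm_inner_symm] at h6
    nlinarith [sq_nonneg (‖c i‖ - ‖(inner ℂ (e i) z : ℂ)‖)]
  have h7 := Finset.sum_le_sum h5
  rw [← Finset.mul_sum, Finset.sum_add_distrib, ← h4, ← h3] at h7
  linarith

theorem finDim_of_orthonormal {U : Submodule ℂ K} {n : ℕ}
    (h : ∀ (m : ℕ) (a : Fin m → K), Orthonormal ℂ a → (∀ j, a j ∈ U) → m ≤ n) :
    FiniteDimensional ℂ U := by
  by_contra hcon
  have h1 : Cardinal.aleph0 ≤ Module.rank ℂ U := by
    by_contra h2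
    exact hcon (Module.rank_lt_aleph0_iff.1 (not_le.1 h2))
  have h2 : ((n + 1 : ℕ) : Cardinal) ≤ Module.rank ℂ U := (Cardinal.natCast_le_aleph0).trans h1
  obtain ⟨s, hs, hli⟩ := le_rank_iff_exists_linearIndependent_finset.1 h2
  have h3 : Module.finrank ℂ (Submodule.span ℂ (s : Set U)) = n + 1 := by
    have := finrank_span_finset_eq_card hli
    rw [this, hs]
  let b := stdOrthonormalBasis ℂ (Submodule.span ℂ (s : Set U))
  have h4 := h _ (fun j => ((b j : U) : K)) ?_ (fun j => (b j : U).2)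
  · omega
  · have := b.orthonormal
    rw [orthonormal_iff_ite] at this ⊢
    exact this

theorem totallyBounded_finDim {U : Submodule ℂ K} [FiniteDimensional ℂ U] {S : Set K}
    (hS : S ⊆ U) {B : ℝ} (hB : ∀ s ∈ S, ‖s‖ ≤ B) : TotallyBounded S := by
  have h1 : TotallyBounded (Metric.closedBall (0 : U) B) := by
    haveI : ProperSpace U := FiniteDimensional.proper ℂ U
    exact (isCompact_closedBall _ _).totallyBounded
  refine (h1.image (f := (Subtype.val : U → K)) uniformContinuous_subtype_val).subset ?_
  intro s hs
  refine ⟨⟨s, hS hs⟩, ?_, rfl⟩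
  rw [mem_closedBall_zero_iff]
  exact hB s hs

end hilb2

section l2x
variable {H : Type} [NormedAddCommGroup H] [InnerProductSpace ℂ H] [CompleteSpace H]
variable {M : VonNeumannAlgebra H} (tr : TraceOn H (M : Set (H →L[ℂ] H)))

theorem rho_adj {y : H →L[ℂ] H} (hy : y ∈ M) : star (rho tr y) = rho tr (star y) := by
  rw [ContinuousLinearMap.star_eq_adjoint]
  symm
  rw [ContinuousLinearMap.eq_adjoint_iff]
  intro k l
  rw [rho_inner tr (star_mem hy), star_star]

theorem rho_proj {N : VonNeumannAlgebra H} (hNM : (N : Set (H →L[ℂ] H)) ⊆ M) {y : H →L[ℂ] H}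
    (hy : y ∈ N) (ξ : L2 M tr) : (KG tr (vnSub N)).starProjection (rho tr y ξ) =
      rho tr y ((KG tr (vnSub N)).starProjection ξ) := by
  have h : ∀ y ∈ N, ∀ v ∈ KG tr (vnSub N), rho tr y v ∈ KG tr (vnSub N) := by
    intro y hy
    apply KG_map
    intro g hg
    rw [rho_io tr (hNM hy) (hNM hg)]
    exact io_mem_KG (mul_mem (S := VonNeumannAlgebra H) hg hy)
  exact proj_commute _ (rho tr y) (rho tr (star y)) (rho_inner tr (hNM hy)) (h y hy)
    (h _ (star_mem hy)) ξ

theorem lam_proj {N : VonNeumannAlgebra H} (hNM : (N : Set (H →L[ℂ] H)) ⊆ M) {y : H →L[ℂ] H}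
    (hy : y ∈ N) (ξ : L2 M tr) : (KG tr (vnSub N)).starProjection (lam tr y ξ) =
      lam tr y ((KG tr (vnSub N)).starProjection ξ) := by
  have h : ∀ y ∈ N, ∀ v ∈ KG tr (vnSub N), lam tr y v ∈ KG tr (vnSub N) := by
    intro y hy
    apply KG_map
    intro g hg
    rw [lam_io tr (hNM hy) (hNM hg)]
    exact io_mem_KG (mul_mem (S := VonNeumannAlgebra H) hy hg)
  exact proj_commute _ (lam tr y) (lam tr (star y)) (lam_inner tr (hNM hy)) (h y hy)
    (h _ (star_mem hy)) ξ

end l2x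

section cp
variable {H : Type} [NormedAddCommGroup H] [InnerProductSpace ℂ H] [CompleteSpace H]
variable {Γ : Type} [Group Γ] (X : CrossedProduct Γ H)

/-- right translation -/
def rU (g : Γ) : L2 X.M X.tr →L[ℂ] L2 X.M X.tr := rho X.tr (X.u g)
/-- left translation -/
def lU (g : Γ) : L2 X.M X.tr →L[ℂ] L2 X.M X.tr := lam X.tr (X.u g)
/-- conjugation -/
def cj (g : Γ) : L2 X.M X.tr →L[ℂ] L2 X.M X.tr := lU X g ∘L rU X g⁻¹

theorem cj_apply (g : Γ) (ξ : L2 X.M X.tr) : cj X g ξ = lU X g (rU X g⁻¹ ξ) := rfl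

theorem rU_io (g : Γ) {x : H →L[ℂ] H} (hx : x ∈ X.M) :
    rU X g (io X.M X.tr x) = io X.M X.tr (x * X.u g) := rho_io X.tr (X.u_mem g) hx
theorem lU_io (g : Γ) {x : H →L[ℂ] H} (hx : x ∈ X.M) :
    lU X g (io X.M X.tr x) = io X.M X.tr (X.u g * x) := lam_io X.tr (X.u_mem g) hx
theorem cj_io (g : Γ) {x : H →L[ℂ] H} (hx : x ∈ X.M) :
    cj X g (io X.M X.tr x) = io X.M X.tr (X.u g * x * X.u g⁻¹) := by
  rw [cj_apply, rU_io X _ hx, lU_io X _ (mul_mem hx (X.u_mem _)), mul_assoc]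

theorem rU_mul (g h : Γ) (ξ : L2 X.M X.tr) : rU X g (rU X h ξ) = rU X (h * g) ξ := by
  rw [rU, rU, rU, rho_mul X.tr (X.u_mem g) (X.u_mem h), X.u_mul]
theorem lU_mul (g h : Γ) (ξ : L2 X.M X.tr) : lU X g (lU X h ξ) = lU X (g * h) ξ := by
  rw [lU, lU, lU, lam_mul X.tr (X.u_mem g) (X.u_mem h), X.u_mul]
theorem rU_one : rU X 1 = 1 := by
  ext ξ; rw [rU, X.u_one, rho_one]
theorem lU_one : lU X 1 = 1 := by
  ext ξ; rw [lU, X.u_one, lam_one]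
theorem lU_rU (g h : Γ) (ξ : L2 X.M X.tr) : lU X g (rU X h ξ) = rU X h (lU X g ξ) :=
  lam_rho X.tr (X.u_mem g) (X.u_mem h) ξ
theorem rU_inner (g : Γ) (ξ η : L2 X.M X.tr) : inner ℂ (rU X g ξ) η = inner ℂ ξ (rU X g⁻¹ η) := by
  rw [rU, rho_inner X.tr (X.u_mem g), X.u_star]; rfl
theorem lU_inner (g : Γ) (ξ η : L2 X.M X.tr) : inner ℂ (lU X g ξ) η = inner ℂ ξ (lU X g⁻¹ η) := by
  rw [lU, lam_inner X.tr (X.u_mem g), X.u_star]; rfl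
theorem rU_star (g : Γ) : star (rU X g) = rU X g⁻¹ := by
  rw [rU, rho_adj X.tr (X.u_mem g), X.u_star]; rfl
theorem cj_inner (g : Γ) (ξ η : L2 X.M X.tr) : inner ℂ (cj X g ξ) η = inner ℂ ξ (cj X g⁻¹ η) := by
  rw [cj_apply, lU_inner, rU_inner, cj_apply, lU_rU]
theorem cj_inv (g : Γ) (ξ : L2 X.M X.tr) : cj X g⁻¹ (cj X g ξ) = ξ := by
  rw [cj_apply, cj_apply, ← lU_rU, rU_mul, lU_mul, inv_mul_cancel, mul_inv_cancel, lU_one,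
    rU_one]; rfl
theorem cj_norm (g : Γ) (ξ : L2 X.M X.tr) : ‖cj X g ξ‖ = ‖ξ‖ := by
  have : ‖cj X g ξ‖ ^ 2 = ‖ξ‖ ^ 2 := by
    rw [@norm_sq_eq_re_inner ℂ, cj_inner, cj_inv, ← @norm_sq_eq_re_inner ℂ]
  exact (sq_eq_sq₀ (norm_nonneg _) (norm_nonneg _)).1 this
theorem rU_norm (g : Γ) (ξ : L2 X.M X.tr) : ‖rU X g ξ‖ = ‖ξ‖ := by
  have : ‖rU X g ξ‖ ^ 2 = ‖ξ‖ ^ 2 := by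
    rw [@norm_sq_eq_re_inner ℂ, rU_inner, rU_mul, mul_inv_cancel, rU_one, ContinuousLinearMap.one_apply,
      ← @norm_sq_eq_re_inner ℂ]
  exact (sq_eq_sq₀ (norm_nonneg _) (norm_nonneg _)).1 this
theorem cj_rU (γ g : Γ) (ξ : L2 X.M X.tr) :
    cj X γ (rU X g ξ) = rU X (γ * g * γ⁻¹) (cj X γ ξ) := by
  rw [cj_apply, cj_apply, ← lU_rU, rU_mul, rU_mul]
  congr 2
  group

theorem cj_KA (γ : Γ) : ∀ ξ ∈ KA X, cj X γ ξ ∈ KA X := by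
  apply KG_map
  intro a ha
  rw [cj_io X γ (X.A_sub ha)]
  exact io_mem_KG (sigma_mem X γ ha)

theorem PA_cj (γ : Γ) (ξ : L2 X.M X.tr) : PA X (cj X γ ξ) = cj X γ (PA X ξ) :=
  proj_commute _ (cj X γ) (cj X γ⁻¹) (cj_inner X γ) (cj_KA X γ) (cj_KA X γ⁻¹) ξ

theorem PA_mem (ξ : L2 X.M X.tr) : PA X ξ ∈ KA X := Submodule.starProjection_apply_mem _ _
theorem PA_eq {ξ : L2 X.M X.tr} (h : ξ ∈ KA X) : PA X ξ = ξ :=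
  Submodule.starProjection_eq_self_iff.2 h
theorem PA_inner (ξ η : L2 X.M X.tr) : inner ℂ (PA X ξ) η = inner ℂ ξ (PA X η) :=
  Submodule.inner_starProjection_left_eq_right _ _ _
theorem PA_zero {ξ : L2 X.M X.tr} (h : ∀ η ∈ KA X, inner ℂ η ξ = 0) : PA X ξ = 0 := by
  rw [← inner_self_eq_zero (𝕜 := ℂ), PA_inner, PA_eq X (PA_mem X ξ), ← inner_conj_symm, h _ (PA_mem X ξ), map_zero]

theorem tau_A_u {a : H →L[ℂ] H} (ha : a ∈ X.A) {g : Γ} (hg : g ≠ 1) : X.tr.τ (a * X.u g) = 0 := by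
  rw [← X.EA.trace_eq _ (mul_mem (X.A_sub ha) (X.u_mem g)), ea_left X ha (X.u_mem g), X.EA_u g hg,
    mul_zero, map_zero]

theorem KA_orth {g : Γ} (hg : g ≠ 1) : ∀ ξ ∈ KA X, ∀ η ∈ KA X, inner ℂ ξ (rU X g η) = 0 := by
  intro ξ hξ η hη
  refine KG_orth (ξ := rU X g η) (fun a ha => ?_) ξ hξ
  have h2 : ∀ η ∈ KA X, inner ℂ η (rU X g⁻¹ (io X.M X.tr a)) = 0 := by
    apply KG_orth
    intro b hb
    have ha' : a ∈ X.M := X.A_sub ha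
    rw [rU_io X _ ha', io_inner X.tr (X.A_sub hb) (mul_mem ha' (X.u_mem _)), ← mul_assoc]
    exact tau_A_u X (mul_mem (S := VonNeumannAlgebra H) (star_mem (S := VonNeumannAlgebra H) hb) ha)
      (inv_ne_one.2 hg)
  have h3 := h2 η hη
  rw [← inner_conj_symm, rU_inner, h3, map_zero]

theorem PA_rU_KA {g : Γ} (hg : g ≠ 1) {η : L2 X.M X.tr} (hη : η ∈ KA X) : PA X (rU X g η) = 0 :=
  PA_zero X fun ξ hξ => KA_orth X hg ξ hξ η hη

variable {k : ℕ} {α : Fin k → H} {C : ℝ}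

theorem sep (nd : NormalData X.tr k α C) {ξ : L2 X.M X.tr} (h : ∀ g : Γ, PA X (rU X g⁻¹ ξ) = 0) :
    ξ = 0 := by
  rw [← inner_self_eq_zero (𝕜 := ℂ)]
  refine KG_orth (fun x hx => ?_) ξ (AG_top X nd ξ)
  have : AG X ≤ (LinearMap.ker ((innerSL ℂ ξ).toLinearMap ∘ₗ io X.M X.tr)) := by
    rw [AG, Submodule.span_le]
    rintro _ ⟨a, ha, γ, rfl⟩
    change inner ℂ ξ (io X.M X.tr (a * X.u γ)) = 0
    rw [← rU_io X γ (X.A_sub ha), ← inner_conj_symm, rU_inner, ← PA_eq X (io_mem_KG ha), PA_inner,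
      h γ, inner_zero_right, map_zero]
  have h2 : inner ℂ ξ (io X.M X.tr x) = 0 := this hx
  rw [← inner_conj_symm, h2, map_zero]

/-- L2 of the group algebra -/
abbrev KL : Submodule ℂ (L2 X.M X.tr) := KG X.tr (vnSub X.Lg)

theorem u_orthonormal : Orthonormal ℂ (fun g : Γ => io X.M X.tr (X.u g)) := by
  rw [orthonormal_iff_ite]
  intro g h
  rw [io_inner X.tr (X.u_mem g) (X.u_mem h), X.u_star, X.u_mul]
  split_ifs with e
  · subst e; rw [inv_mul_cancel, X.u_one, X.tr.unital]
  · have := tau_A_u X (one_mem X.A) (g := g⁻¹ * h) (fun h' => e (inv_mul_eq_one.1 h'))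
    rwa [one_mul] at this

/-- span of the group -/
def UG : Submodule ℂ (H →L[ℂ] H) := Submodule.span ℂ (Set.range X.u)

theorem UG_mul (g : Γ) {x : H →L[ℂ] H} (hx : x ∈ UG X) : X.u g * x ∈ UG X := by
  have : UG X ≤ (UG X).comap (LinearMap.mulLeft ℂ (X.u g)) := by
    conv_lhs => rw [UG]
    rw [Submodule.span_le]
    rintro _ ⟨γ, rfl⟩
    exact Submodule.subset_span ⟨g * γ, by simp [X.u_mul]⟩
  exact this hx

theorem UG_sub {x : H →L[ℂ] H} (hx : x ∈ UG X) : x ∈ X.Lg := by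
  have : UG X ≤ vnSub X.Lg := by
    rw [UG, Submodule.span_le]
    rintro _ ⟨γ, rfl⟩
    exact u_mem_Lg X γ
  exact this hx

theorem Lg_dense (nd : NormalData X.tr k α C) {y : H →L[ℂ] H} (hy : y ∈ X.Lg) :
    io X.M X.tr y ∈ KG X.tr (UG X) := by
  refine double_comm nd (Set.range X.u) (UG X) ?_ (fun g hg => X.Lg_sub (UG_sub X hg)) ?_ ?_
    (X.Lg_sub hy) ?_
  · rintro _ ⟨g, rfl⟩; exact X.u_mem g
  · exact Submodule.subset_span ⟨1, X.u_one⟩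
  · rintro _ ⟨γ, rfl⟩ g hg
    rw [X.u_star]
    exact ⟨io_mem_KG (UG_mul X γ hg), io_mem_KG (UG_mul X _ hg)⟩
  · rw [← X.Lg_eq]; exact hy

theorem KL_le (nd : NormalData X.tr k α C) :
    KL X ≤ (Submodule.span ℂ (Set.range fun g : Γ => io X.M X.tr (X.u g))).topologicalClosure := by
  have h1 : KL X ≤ KG X.tr (UG X) := KG_mono (KG_closed _) fun g hg => Lg_dense X nd hg
  refine h1.trans (le_of_eq ?_)
  rw [KG, UG, Submodule.map_span, ← Set.range_comp]
  rfl

end cp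
end CD

namespace CD

section lemF
variable {H : Type} [NormedAddCommGroup H] [InnerProductSpace ℂ H] [CompleteSpace H]
variable {Γ : Type} [Group Γ] (X : CrossedProduct Γ H)
variable {k : ℕ} {α : Fin k → H} {C : ℝ}

theorem rU_inner2 {g h : Γ} (ξ η : L2 X.M X.tr) :
    inner ℂ (rU X g ξ) (rU X h η) = inner ℂ ξ (rU X (h * g⁻¹) η) := by
  rw [rU_inner, rU_mul]

theorem F1 (nd : NormalData X.tr k α C) {n m : ℕ} {y : Fin n → (H →L[ℂ] H)} (hy : ∀ i, y i ∈ X.M)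
    (W : Submodule ℂ (L2 X.M X.tr)) [W.HasOrthogonalProjection]
    (hW : ∀ w ∈ W, ∀ δ : ℝ, 0 < δ → ∃ ζ : Fin n → L2 X.M X.tr,
      ‖w - ∑ i, lam X.tr (y i) ((KL X).starProjection (ζ i))‖ < δ)
    (a : Fin m → L2 X.M X.tr) (ha : Orthonormal ℂ a) (haA : ∀ j, a j ∈ KA X) :
    ∑ j, ‖W.starProjection (a j)‖ ^ 2 ≤ n := by
  have hst : ∀ i, star (lam X.tr (y i) ∘L (KL X).starProjection) =
      (KL X).starProjection ∘L lam X.tr (star (y i)) := by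
    intro i
    change star (lam X.tr (y i) * (KL X).starProjection) = _
    rw [star_mul, show star (lam X.tr (y i)) = lam X.tr (star (y i)) from lam_adj X.tr (hy i)]
    have : star (KL X).starProjection = (KL X).starProjection := by
      have := (isSelfAdjoint_starProjection (KL X))
      exact this
    rw [this]; rfl
  refine dimF (fun i => lam X.tr (y i) ∘L (KL X).starProjection) (rU X) (rU_star X) (rU_one X)
    ?_ W hW (io X.M X.tr 1) (io_one_norm X.tr).le ?_ a ?_
  · intro i g
    ext ξ
    change lam X.tr (y i) ((KL X).starProjection (rU X g ξ)) =
      rU X g (lam X.tr (y i) ((KL X).starProjection ξ))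
    rw [rU, rho_proj X.tr X.Lg_sub (u_mem_Lg X g), lam_rho X.tr (hy i) (X.u_mem g)]
  · intro i z δ hδ
    have hz : star (lam X.tr (y i) ∘L (KL X).starProjection) z ∈ KL X := by
      rw [hst]
      exact Submodule.starProjection_apply_mem _ _
    obtain ⟨F, hF⟩ := bessel_rev (u_orthonormal X) (KL_le X nd hz) hδ
    refine ⟨F, ?_⟩
    simp_rw [rU_io X _ (one_mem X.M), one_mul]
    exact hF
  · rw [orthonormal_iff_ite] at ha ⊢
    rintro ⟨g, i⟩ ⟨h, j⟩
    simp only [rU_inner2]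
    by_cases e : g = h
    · subst e
      rw [mul_inv_cancel, rU_one]
      simp only [ContinuousLinearMap.one_apply, ha, Prod.mk.injEq, true_and]
    · rw [KA_orth X (fun e2 => e (mul_inv_eq_one.1 e2).symm) _ (haA i) _ (haA j), if_neg]
      intro e2
      exact e (congrArg Prod.fst e2)

theorem F2a (hicc : IsICC Γ) {n : ℕ} (f : L2 X.M X.tr →L[ℂ] L2 X.M X.tr)
    (hf : ∀ ξ η, inner ℂ (f ξ) η = inner ℂ ξ (f η))
    (hfc : ∀ γ ξ, f (cj X γ ξ) = cj X γ (f ξ))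
    (hb : ∀ (m : ℕ) (a : Fin m → L2 X.M X.tr), Orthonormal ℂ a → (∀ j, a j ∈ KA X) →
      ∑ j, ‖f (a j)‖ ^ 2 ≤ n) {g : Γ} (hg : g ≠ 1) {η : L2 X.M X.tr} (hη : η ∈ KA X)
    (h1 : ‖η‖ = 1) : PA X (f (rU X g η)) = 0 := by
  have hinf := hicc g hg
  set emb := hinf.natEmbedding with hemb
  have h2 : ∀ i : ℕ, ∃ γ : Γ, (emb i : Γ) = γ * g * γ⁻¹ := fun i => (emb i).2
  choose γ hγ using h2
  have hinj : ∀ i j, i ≠ j → γ i * g * (γ i)⁻¹ ≠ γ j * g * (γ j)⁻¹ := by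
    intro i j hij e
    rw [← hγ, ← hγ] at e
    exact hij (emb.injective (Subtype.ext e))
  set w := PA X (f (rU X g η)) with hw
  have key : ∀ m : ℕ, (m : ℝ) * ‖w‖ ^ 2 ≤ n := by
    intro m
    set v : Fin m → L2 X.M X.tr := fun j => cj X (γ j) (rU X g η) with hv
    have hvo : Orthonormal ℂ v := by
      refine ⟨fun j => ?_, ?_⟩
      · rw [hv]; simp only [cj_norm, rU_norm, h1]
      · intro i j hij
        simp only [hv, cj_rU, rU_inner2]
        apply KA_orth X _ _ (cj_KA X _ _ hη) _ (cj_KA X _ _ hη)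
        intro e
        exact hinj i j (fun e2 => hij (Fin.ext e2)) (mul_inv_eq_one.1 e).symm
    set wj : Fin m → L2 X.M X.tr := fun j => PA X (f (v j)) with hwj
    have hwn : ∀ j, ‖wj j‖ = ‖w‖ := by
      intro j
      simp only [hwj, hv, hfc, PA_cj, cj_norm, hw]
    let U : Submodule ℂ (L2 X.M X.tr) := Submodule.span ℂ (Set.range wj)
    haveI : FiniteDimensional ℂ U := FiniteDimensional.span_of_finite ℂ (Set.finite_range wj)
    have hUA : U ≤ KA X := by
      rw [Submodule.span_le]
      rintro _ ⟨j, rfl⟩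
      exact PA_mem X _
    let b := stdOrthonormalBasis ℂ U
    have hbo : Orthonormal ℂ (fun i => (b i : L2 X.M X.tr)) := by
      have := b.orthonormal
      rw [orthonormal_iff_ite] at this ⊢
      exact this
    have e1 : ∀ j, ‖w‖ ^ 2 = ∑ i, ‖(inner ℂ (f (b i : L2 X.M X.tr)) (v j) : ℂ)‖ ^ 2 := by
      intro j
      have hwU : wj j ∈ U := Submodule.subset_span ⟨j, rfl⟩
      have := b.sum_sq_norm_inner_right ⟨wj j, hwU⟩
      rw [← hwn j]
      rw [show ‖wj j‖ = ‖(⟨wj j, hwU⟩ : U)‖ from rfl, ← this]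
      refine Finset.sum_congr rfl fun i _ => ?_
      congr 2
      change inner ℂ (b i : L2 X.M X.tr) (PA X (f (v j))) = _
      rw [← PA_inner, PA_eq X (hUA (b i).2), hf]
    calc (m : ℝ) * ‖w‖ ^ 2 = ∑ j : Fin m, ‖w‖ ^ 2 := by simp
      _ = ∑ j : Fin m, ∑ i, ‖(inner ℂ (f (b i : L2 X.M X.tr)) (v j) : ℂ)‖ ^ 2 :=
        Finset.sum_congr rfl fun j _ => e1 j
      _ = ∑ i, ∑ j : Fin m, ‖(inner ℂ (f (b i : L2 X.M X.tr)) (v j) : ℂ)‖ ^ 2 := Finset.sum_comm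
      _ ≤ ∑ i, ‖f (b i : L2 X.M X.tr)‖ ^ 2 := by
        refine Finset.sum_le_sum fun i _ => ?_
        have := hvo.sum_inner_products_le (f (b i : L2 X.M X.tr)) (s := Finset.univ)
        refine le_trans (le_of_eq ?_) this
        refine Finset.sum_congr rfl fun j _ => ?_
        rw [norm_inner_symm]
      _ ≤ n := hb _ _ hbo fun i => hUA (b i).2
  by_contra hne
  have hpos : 0 < ‖w‖ ^ 2 := by positivity
  obtain ⟨m, hm⟩ := exists_nat_gt ((n : ℝ) / ‖w‖ ^ 2)
  rw [div_lt_iff₀ hpos] at hm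
  linarith [key m]

theorem F2 (hicc : IsICC Γ) {n : ℕ} (f : L2 X.M X.tr →L[ℂ] L2 X.M X.tr)
    (hf : ∀ ξ η, inner ℂ (f ξ) η = inner ℂ ξ (f η))
    (hfc : ∀ γ ξ, f (cj X γ ξ) = cj X γ (f ξ))
    (hb : ∀ (m : ℕ) (a : Fin m → L2 X.M X.tr), Orthonormal ℂ a → (∀ j, a j ∈ KA X) →
      ∑ j, ‖f (a j)‖ ^ 2 ≤ n) {g : Γ} (hg : g ≠ 1) {η : L2 X.M X.tr} (hη : η ∈ KA X) :
    PA X (f (rU X g η)) = 0 := by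
  by_cases h0 : η = 0
  · subst h0; simp
  have h1 : ‖((‖η‖ : ℂ)⁻¹ • η)‖ = 1 := by
    rw [norm_smul, norm_inv, Complex.norm_real, norm_norm, inv_mul_cancel₀ (norm_ne_zero_iff.2 h0)]
  have := F2a X hicc f hf hfc hb hg (Submodule.smul_mem _ ((‖η‖ : ℂ)⁻¹) hη) h1
  rw [map_smul, map_smul, map_smul, smul_eq_zero] at this
  rcases this with h | h
  · exfalso
    rw [inv_eq_zero] at h
    exact h0 (norm_eq_zero.1 (by exact_mod_cast h))
  · exact h

theorem F3 (hicc : IsICC Γ) (nd : NormalData X.tr k α C) {n : ℕ} (f : L2 X.M X.tr →L[ℂ] L2 X.M X.tr)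
    (hf : ∀ ξ η, inner ℂ (f ξ) η = inner ℂ ξ (f η))
    (hfc : ∀ γ ξ, f (cj X γ ξ) = cj X γ (f ξ)) (hfr : ∀ γ ξ, f (rU X γ ξ) = rU X γ (f ξ))
    (hb : ∀ (m : ℕ) (a : Fin m → L2 X.M X.tr), Orthonormal ℂ a → (∀ j, a j ∈ KA X) →
      ∑ j, ‖f (a j)‖ ^ 2 ≤ n) (ξ : L2 X.M X.tr) : PA X (f ξ) = f (PA X ξ) := by
  have h1 : ∀ ξ ∈ KA X, f ξ ∈ KA X := by
    intro ξ hξ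
    have : f ξ - PA X (f ξ) = 0 := by
      apply sep X nd
      intro g
      rw [map_sub, map_sub]
      by_cases hg : g = 1
      · subst hg
        rw [inv_one, rU_one]
        change PA X (f ξ) - PA X (PA X (f ξ)) = 0
        rw [PA_eq X (PA_mem X _), sub_self]
      · rw [PA_rU_KA X (by simpa using hg) (PA_mem X _), sub_zero, ← hfr]
        exact F2 X hicc f hf hfc hb (by simpa using hg) hξ
    rw [sub_eq_zero.1 this]
    exact PA_mem X _
  exact proj_commute _ f f hf h1 h1 ξ

/-- almost periodic vectors -/
def AP (ξ : L2 X.M X.tr) : Prop := TotallyBounded (Set.range fun γ : Γ => cj X γ ξ)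

theorem F4 (hicc : IsICC Γ) (nd : NormalData X.tr k α C) {x : H →L[ℂ] H}
    (hx : x ∈ QNset (X.M : Set (H →L[ℂ] H)) (X.Lg : Set (H →L[ℂ] H))) (g : Γ) :
    AP X (io X.M X.tr (X.EA.E (x * X.u g⁻¹))) := by
  obtain ⟨hxM, n, y, hy, hl, -⟩ := hx
  set G : Submodule ℂ (H →L[ℂ] H) := Submodule.span ℂ {z | ∃ g h : Γ, z = X.u g * x * X.u h} with hG
  have hGM : ∀ z ∈ G, z ∈ X.M := by
    intro z hz
    have : G ≤ vnSub X.M := by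
      rw [hG, Submodule.span_le]
      rintro _ ⟨g, h, rfl⟩
      exact mul_mem (S := VonNeumannAlgebra H) (mul_mem (S := VonNeumannAlgebra H) (X.u_mem _) hxM) (X.u_mem _)
    exact this hz
  set W := KG X.tr G with hWd
  have hWl : ∀ γ, ∀ w ∈ W, lU X γ w ∈ W := by
    intro γ
    apply KG_map
    intro z hz
    rw [lU_io X γ (hGM z hz)]
    apply io_mem_KG
    have : G ≤ G.comap (LinearMap.mulLeft ℂ (X.u γ)) := by
      conv_lhs => rw [hG]
      rw [Submodule.span_le]
      rintro _ ⟨g, h, rfl⟩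
      refine Submodule.subset_span ⟨γ * g, h, ?_⟩
      simp only [LinearMap.mulLeft_apply, ← X.u_mul, mul_assoc]
    exact this hz
  have hWr : ∀ γ, ∀ w ∈ W, rU X γ w ∈ W := by
    intro γ
    apply KG_map
    intro z hz
    rw [rU_io X γ (hGM z hz)]
    apply io_mem_KG
    have : G ≤ G.comap (LinearMap.mulRight ℂ (X.u γ)) := by
      conv_lhs => rw [hG]
      rw [Submodule.span_le]
      rintro _ ⟨g, h, rfl⟩
      refine Submodule.subset_span ⟨g, h * γ, ?_⟩
      simp only [LinearMap.mulRight_apply, ← X.u_mul, mul_assoc]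
    exact this hz
  have hWcj : ∀ γ, ∀ w ∈ W, cj X γ w ∈ W := fun γ w hw => hWl _ _ (hWr _ _ hw)
  have hfr : ∀ γ ξ, W.starProjection (rU X γ ξ) = rU X γ (W.starProjection ξ) := fun γ ξ =>
    proj_commute W (rU X γ) (rU X γ⁻¹) (rU_inner X γ) (hWr γ) (hWr γ⁻¹) ξ
  have hfc : ∀ γ ξ, W.starProjection (cj X γ ξ) = cj X γ (W.starProjection ξ) := fun γ ξ =>
    proj_commute W (cj X γ) (cj X γ⁻¹) (cj_inner X γ) (hWcj γ) (hWcj γ⁻¹) ξ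
  have hW : ∀ w ∈ W, ∀ δ : ℝ, 0 < δ → ∃ ζ : Fin n → L2 X.M X.tr,
      ‖w - ∑ i, lam X.tr (y i) ((KL X).starProjection (ζ i))‖ < δ := by
    intro w hw δ hδ
    obtain ⟨z, hz, hzw⟩ := KG_approx hw hδ
    suffices h : ∃ ζ : Fin n → L2 X.M X.tr,
        io X.M X.tr z = ∑ i, lam X.tr (y i) ((KL X).starProjection (ζ i)) by
      obtain ⟨ζ, h⟩ := h
      exact ⟨ζ, by rw [← h]; exact hzw⟩
    clear hzw hw
    induction hz using Submodule.span_induction with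
    | mem z hz =>
      obtain ⟨g, h, rfl⟩ := hz
      obtain ⟨q, hq, e⟩ := hl _ (u_mem_Lg X g)
      refine ⟨fun i => io X.M X.tr (q i * X.u h), ?_⟩
      rw [e, Finset.sum_mul, map_sum]
      refine Finset.sum_congr rfl fun i _ => ?_
      have hqL : q i * X.u h ∈ X.Lg := mul_mem (hq i) (u_mem_Lg X h)
      rw [Submodule.starProjection_eq_self_iff.2 (io_mem_KG (G := vnSub X.Lg) hqL),
        lam_io X.tr (hy i) (X.Lg_sub hqL), mul_assoc]
    | zero => exact ⟨0, by simp⟩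
    | add a b _ _ ha hb =>
      obtain ⟨ζ, ha⟩ := ha
      obtain ⟨ζ', hb⟩ := hb
      refine ⟨ζ + ζ', ?_⟩
      rw [map_add, ha, hb, ← Finset.sum_add_distrib]
      simp
    | smul c a _ ha =>
      obtain ⟨ζ, ha⟩ := ha
      refine ⟨c • ζ, ?_⟩
      rw [map_smul, ha, Finset.smul_sum]
      simp
  have hb : ∀ (m : ℕ) (a : Fin m → L2 X.M X.tr), Orthonormal ℂ a → (∀ j, a j ∈ KA X) →
      ∑ j, ‖W.starProjection (a j)‖ ^ 2 ≤ n := fun m a ha haA => F1 X nd hy W hW a ha haA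
  have hPA := F3 X hicc nd W.starProjection
    (fun ξ η => Submodule.inner_starProjection_left_eq_right _ _ _) hfc hfr hb
  haveI : FiniteDimensional ℂ (W ⊓ KA X : Submodule ℂ (L2 X.M X.tr)) := by
    apply finDim_of_orthonormal (n := n)
    intro m a ha hm
    have h1 := hb m a ha fun j => (hm j).2
    have h2 : ∀ j, ‖W.starProjection (a j)‖ ^ 2 = 1 := by
      intro j
      rw [Submodule.starProjection_eq_self_iff.2 (hm j).1, ha.1 j, one_pow]
    simp only [h2] at h1
    simpa using h1
  have hxW : io X.M X.tr x ∈ W :=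
    io_mem_KG (Submodule.subset_span ⟨1, 1, by rw [X.u_one, one_mul, mul_one]⟩)
  have hEm : io X.M X.tr (X.EA.E (x * X.u g⁻¹)) ∈ W ⊓ KA X := by
    rw [← PA_io X (mul_mem (S := VonNeumannAlgebra H) hxM (X.u_mem _)), ← rU_io X _ hxM]
    refine ⟨?_, PA_mem X _⟩
    have := hWr g⁻¹ _ hxW
    rw [← Submodule.starProjection_eq_self_iff.2 this, hPA]
    exact Submodule.starProjection_apply_mem _ _
  apply totallyBounded_finDim (U := W ⊓ KA X) (B := ‖io X.M X.tr (X.EA.E (x * X.u g⁻¹))‖)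
  · rintro _ ⟨γ, rfl⟩
    exact ⟨hWcj γ _ hEm.1, cj_KA X γ _ hEm.2⟩
  · rintro _ ⟨γ, rfl⟩
    exact (cj_norm X γ _).le

end lemF
end CD

namespace CD

section four
variable {H : Type} [NormedAddCommGroup H] [InnerProductSpace ℂ H] [CompleteSpace H]
variable {Γ : Type} [Group Γ] (X : CrossedProduct Γ H)
variable {k : ℕ} {α : Fin k → H} {C : ℝ}

/-- Fourier component -/
def eP (g : Γ) : L2 X.M X.tr →L[ℂ] L2 X.M X.tr := rU X g ∘L PA X ∘L rU X g⁻¹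

theorem eP_apply (g : Γ) (ξ : L2 X.M X.tr) : eP X g ξ = rU X g (PA X (rU X g⁻¹ ξ)) := rfl

theorem rU_inv (g : Γ) (ξ : L2 X.M X.tr) : rU X g⁻¹ (rU X g ξ) = ξ := by
  rw [rU_mul, mul_inv_cancel, rU_one]; rfl

theorem eP_rU (g : Γ) {ξ : L2 X.M X.tr} (h : ξ ∈ KA X) : eP X g (rU X g ξ) = rU X g ξ := by
  rw [eP_apply, rU_inv, PA_eq X h]

theorem eP_rU_ne {g h : Γ} (e : h ≠ g) {ξ : L2 X.M X.tr} (hξ : ξ ∈ KA X) :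
    eP X g (rU X h ξ) = 0 := by
  rw [eP_apply, rU_mul, PA_rU_KA X _ hξ, map_zero]
  intro e2
  exact e (mul_inv_eq_one.1 e2)

theorem eP_inner (g : Γ) (ξ η : L2 X.M X.tr) : inner ℂ (eP X g ξ) η = inner ℂ ξ (eP X g η) := by
  rw [eP_apply, rU_inner, PA_inner, rU_inner, inv_inv, eP_apply]

theorem PA_norm_le (ξ : L2 X.M X.tr) : ‖PA X ξ‖ ≤ ‖ξ‖ := Submodule.norm_starProjection_apply_le _ _

theorem eP_norm (g : Γ) (ξ : L2 X.M X.tr) : ‖eP X g ξ‖ ≤ ‖ξ‖ := by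
  rw [eP_apply, rU_norm]
  exact (PA_norm_le X _).trans (rU_norm X _ _).le

theorem eP_norm' (g : Γ) (ξ : L2 X.M X.tr) : ‖eP X g ξ‖ = ‖PA X (rU X g⁻¹ ξ)‖ := by
  rw [eP_apply, rU_norm]

/-- partial Fourier sum -/
def PF (F : Finset Γ) : L2 X.M X.tr →L[ℂ] L2 X.M X.tr := ∑ g ∈ F, eP X g

theorem PF_apply (F : Finset Γ) (ξ : L2 X.M X.tr) : PF X F ξ = ∑ g ∈ F, eP X g ξ := by
  rw [PF, ContinuousLinearMap.sum_apply]

theorem PF_rU (F : Finset Γ) (g : Γ) {ξ : L2 X.M X.tr} (h : ξ ∈ KA X) :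
    PF X F (rU X g ξ) = if g ∈ F then rU X g ξ else 0 := by
  rw [PF_apply]
  have : ∀ h ∈ F, eP X h (rU X g ξ) = if g = h then rU X g ξ else 0 := by
    intro h' _
    split_ifs with e
    · subst e; exact eP_rU X g h
    · exact eP_rU_ne X e h
  rw [Finset.sum_congr rfl this, Finset.sum_ite_eq]

theorem PF_idem (F : Finset Γ) (ξ : L2 X.M X.tr) : PF X F (PF X F ξ) = PF X F ξ := by
  conv_lhs => rw [PF_apply X F ξ]
  rw [map_sum, PF_apply]
  refine Finset.sum_congr rfl fun g hg => ?_
  rw [eP_apply, PF_rU X F g (PA_mem X _), if_pos hg]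

theorem PF_inner (F : Finset Γ) (ξ η : L2 X.M X.tr) :
    inner ℂ (PF X F ξ) η = inner ℂ ξ (PF X F η) := by
  rw [PF_apply, PF_apply, sum_inner, inner_sum]
  exact Finset.sum_congr rfl fun g _ => eP_inner X g ξ η

theorem PF_norm (F : Finset Γ) (ξ : L2 X.M X.tr) : ‖PF X F ξ‖ ≤ ‖ξ‖ := by
  have h1 : ‖PF X F ξ‖ ^ 2 ≤ ‖ξ‖ * ‖PF X F ξ‖ := by
    rw [@norm_sq_eq_re_inner ℂ, PF_inner, PF_idem]
    exact (RCLike.re_le_norm _).trans (norm_inner_le_norm _ _)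
  by_contra h
  push Not at h
  have : 0 < ‖PF X F ξ‖ := (norm_nonneg _).trans_lt h
  nlinarith

theorem fourier_approx (nd : NormalData X.tr k α C) (ξ : L2 X.M X.tr) {ε : ℝ} (hε : 0 < ε) :
    ∃ F : Finset Γ, ‖ξ - PF X F ξ‖ < ε := by
  obtain ⟨y, hy, hyξ⟩ := KG_approx (AG_top X nd ξ) (show 0 < ε / 2 by positivity)
  have h : ∃ F : Finset Γ, ∀ F', F ⊆ F' → PF X F' (io X.M X.tr y) = io X.M X.tr y := by
    clear hyξ
    induction hy using Submodule.span_induction with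
    | mem z hz =>
      obtain ⟨a, ha, g, rfl⟩ := hz
      refine ⟨{g}, fun F' hF' => ?_⟩
      rw [← rU_io X g (X.A_sub ha), PF_rU X F' g (io_mem_KG ha), if_pos (hF' (by simp))]
    | zero => exact ⟨∅, fun F' _ => by simp⟩
    | add a b _ _ ha hb =>
      obtain ⟨F, ha⟩ := ha
      obtain ⟨F', hb⟩ := hb
      refine ⟨F ∪ F', fun F'' h => ?_⟩
      rw [map_add, map_add, ha _ (Finset.union_subset_left h), hb _ (Finset.union_subset_right h)]
    | smul c a _ ha =>
      obtain ⟨F, ha⟩ := ha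
      exact ⟨F, fun F' h => by rw [map_smul, map_smul, ha F' h]⟩
  obtain ⟨F, hF⟩ := h
  refine ⟨F, ?_⟩
  have e : ξ - PF X F ξ = (ξ - io X.M X.tr y) - PF X F (ξ - io X.M X.tr y) := by
    rw [map_sub, hF F subset_rfl]; abel
  rw [e]
  calc _ ≤ ‖ξ - io X.M X.tr y‖ + ‖PF X F (ξ - io X.M X.tr y)‖ := norm_sub_le _ _
    _ ≤ ‖ξ - io X.M X.tr y‖ + ‖ξ - io X.M X.tr y‖ := by gcongr; exact PF_norm X _ _
    _ < ε := by linarith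

theorem eP_small (nd : NormalData X.tr k α C) (ξ : L2 X.M X.tr) {ε : ℝ} (hε : 0 < ε) :
    ∃ F : Finset Γ, ∀ g, g ∉ F → ‖eP X g ξ‖ < ε := by
  obtain ⟨F, hF⟩ := fourier_approx X nd ξ hε
  refine ⟨F, fun g hg => ?_⟩
  have : eP X g (PF X F ξ) = 0 := by
    rw [PF_apply, map_sum]
    refine Finset.sum_eq_zero fun h hh => ?_
    rw [eP_apply X h, eP_rU_ne X (fun (e : h = g) => hg (e ▸ hh)) (PA_mem X _)]
  have e : eP X g ξ = eP X g (ξ - PF X F ξ) := by rw [map_sub, this, sub_zero]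
  rw [e]
  exact (eP_norm X g _).trans_lt hF

theorem mem_of_coef (nd : NormalData X.tr k α C) {w : H →L[ℂ] H} (hw : w ∈ X.M)
    {G : Submodule ℂ (H →L[ℂ] H)} (h : ∀ g : Γ, X.EA.E (w * X.u g⁻¹) * X.u g ∈ G) :
    io X.M X.tr w ∈ KG X.tr G := by
  apply KG_of_approx
  intro ε hε
  obtain ⟨F, hF⟩ := fourier_approx X nd (io X.M X.tr w) hε
  refine ⟨∑ g ∈ F, X.EA.E (w * X.u g⁻¹) * X.u g, sum_mem fun g _ => h g, ?_⟩
  convert hF using 3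
  rw [PF_apply, map_sum]
  refine Finset.sum_congr rfl fun g _ => ?_
  have hm : w * X.u g⁻¹ ∈ X.M := mul_mem hw (X.u_mem _)
  rw [eP_apply, rU_io X _ hw, PA_io X hm, rU_io X _ (X.A_sub (X.EA.mem _ hm))]

theorem cj_mul (g h : Γ) (ξ : L2 X.M X.tr) : cj X g (cj X h ξ) = cj X (g * h) ξ := by
  rw [cj_apply, cj_apply, cj_apply, ← lU_rU, rU_mul, lU_mul, mul_inv_rev]

theorem AP_net {ξ : L2 X.M X.tr} (h : AP X ξ) {ε : ℝ} (hε : 0 < ε) :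
    ∃ F : Finset Γ, ∀ γ, ∃ δ ∈ F, ‖cj X γ ξ - cj X δ ξ‖ < ε := by
  obtain ⟨t, ht, htf, hc⟩ := Metric.finite_approx_of_totallyBounded h ε hε
  have : ∀ y : t, ∃ γ, cj X γ ξ = y := fun y => ht y.2
  choose f hf using this
  haveI : Fintype t := htf.fintype
  refine ⟨Finset.univ.image f, fun γ => ?_⟩
  obtain ⟨y, hy, hb⟩ := Set.mem_iUnion₂.1 (hc ⟨γ, rfl⟩)
  refine ⟨f ⟨y, hy⟩, Finset.mem_image_of_mem _ (Finset.mem_univ _), ?_⟩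
  rw [hf]
  rwa [Metric.mem_ball, dist_eq_norm] at hb

theorem AP_of {ξ : L2 X.M X.tr}
    (h : ∀ ε : ℝ, 0 < ε → ∃ T : Set (L2 X.M X.tr), TotallyBounded T ∧
      ∀ γ, ∃ t ∈ T, ‖cj X γ ξ - t‖ ≤ ε) : AP X ξ := by
  apply Metric.totallyBounded_iff.2
  intro ε hε
  obtain ⟨T, hT, h⟩ := h (ε / 3) (by positivity)
  obtain ⟨t, ht, hc⟩ := Metric.totallyBounded_iff.1 hT (ε / 3) (by positivity)
  refine ⟨t, ht, ?_⟩
  rintro _ ⟨γ, rfl⟩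
  obtain ⟨z, hz, hzγ⟩ := h γ
  obtain ⟨y, hy, hb⟩ := Set.mem_iUnion₂.1 (hc hz)
  refine Set.mem_iUnion₂.2 ⟨y, hy, ?_⟩
  rw [Metric.mem_ball] at hb ⊢
  have := dist_triangle (cj X γ ξ) z y
  rw [← dist_eq_norm] at hzγ
  simp only
  linarith

theorem AP_map {ξ : L2 X.M X.tr} (h : AP X ξ) (T : L2 X.M X.tr →L[ℂ] L2 X.M X.tr)
    (hT : ∀ γ ξ, T (cj X γ ξ) = cj X γ (T ξ)) : AP X (T ξ) := by
  have := TotallyBounded.image h T.uniformContinuous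
  rw [← Set.range_comp] at this
  unfold AP
  convert this using 2
  ext γ
  simp [hT]

theorem AP_add {ξ η : L2 X.M X.tr} (h : AP X ξ) (h' : AP X η) : AP X (ξ + η) := by
  apply AP_of
  intro ε hε
  obtain ⟨F, hF⟩ := AP_net X h (show 0 < ε / 2 by positivity)
  obtain ⟨F', hF'⟩ := AP_net X h' (show 0 < ε / 2 by positivity)
  refine ⟨(fun p : Γ × Γ => cj X p.1 ξ + cj X p.2 η) '' (F ×ˢ F' : Finset (Γ × Γ)),
    ((Finset.finite_toSet _).image _).totallyBounded, fun γ => ?_⟩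
  obtain ⟨δ, hδ, h1⟩ := hF γ
  obtain ⟨δ', hδ', h2⟩ := hF' γ
  refine ⟨_, ⟨(δ, δ'), by simp [hδ, hδ'], rfl⟩, ?_⟩
  rw [map_add]
  calc _ = ‖(cj X γ ξ - cj X δ ξ) + (cj X γ η - cj X δ' η)‖ := by congr 1; simp only; abel
    _ ≤ _ := (norm_add_le _ _).trans (by linarith)

theorem AP_smul {ξ : L2 X.M X.tr} (h : AP X ξ) (c : ℂ) : AP X (c • ξ) :=
  AP_map X h (c • 1) (fun γ ξ => by simp)

theorem u_norm (g : Γ) : ‖X.u g‖ ≤ 1 := by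
  have h1 : star (X.u g) * X.u g = 1 := by rw [X.u_star, u_inv_mul]
  have h2 := CStarRing.norm_star_mul_self (x := X.u g)
  rw [h1] at h2
  have h3 : ‖(1 : H →L[ℂ] H)‖ ≤ 1 := ContinuousLinearMap.norm_id_le
  nlinarith [norm_nonneg (X.u g)]

theorem sigma_norm (g : Γ) (a : H →L[ℂ] H) : ‖X.u g * a * X.u g⁻¹‖ ≤ ‖a‖ := by
  calc _ ≤ ‖X.u g‖ * ‖a‖ * ‖X.u g⁻¹‖ := (norm_mul_le _ _).trans (by gcongr; exact norm_mul_le _ _)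
    _ ≤ 1 * ‖a‖ * 1 := by gcongr <;> exact u_norm X _
    _ = ‖a‖ := by ring

theorem sigma_mul (g : Γ) (a b : H →L[ℂ] H) :
    X.u g * (a * b) * X.u g⁻¹ = (X.u g * a * X.u g⁻¹) * (X.u g * b * X.u g⁻¹) := by
  have := u_inv_mul X g
  calc _ = X.u g * a * 1 * b * X.u g⁻¹ := by simp only [mul_one, mul_assoc]
    _ = _ := by rw [← this]; simp only [mul_assoc]

theorem AP_mul {a b : H →L[ℂ] H} (ha : a ∈ X.M) (hb : b ∈ X.M) (h : AP X (io X.M X.tr a))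
    (h' : AP X (io X.M X.tr b)) : AP X (io X.M X.tr (a * b)) := by
  apply AP_of
  intro ε hε
  set R := ‖a‖ + ‖b‖ + 1 with hR
  have hRp : 0 < R := by positivity
  obtain ⟨F, hF⟩ := AP_net X h (show 0 < ε / (2 * R) by positivity)
  obtain ⟨F', hF'⟩ := AP_net X h' (show 0 < ε / (2 * R) by positivity)
  let s : Γ → (H →L[ℂ] H) → (H →L[ℂ] H) := fun g x => X.u g * x * X.u g⁻¹
  have hs : ∀ g, ∀ x ∈ X.M, s g x ∈ X.M := fun g x hx => mul_mem (mul_mem (X.u_mem _) hx) (X.u_mem _)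
  refine ⟨(fun p : Γ × Γ => io X.M X.tr (s p.1 a * s p.2 b)) '' (F ×ˢ F' : Finset (Γ × Γ)),
    ((Finset.finite_toSet _).image _).totallyBounded, fun γ => ?_⟩
  obtain ⟨δ, hδ, h1⟩ := hF γ
  obtain ⟨δ', hδ', h2⟩ := hF' γ
  refine ⟨_, ⟨(δ, δ'), by simp [hδ, hδ'], rfl⟩, ?_⟩
  rw [cj_io X _ ha, cj_io X _ ha, ← map_sub] at h1
  rw [cj_io X _ hb, cj_io X _ hb, ← map_sub] at h2
  rw [cj_io X _ (mul_mem ha hb), ← map_sub, sigma_mul]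
  have e : (X.u γ * a * X.u γ⁻¹) * (X.u γ * b * X.u γ⁻¹) - s δ a * s δ' b =
      s γ a * (s γ b - s δ' b) + (s γ a - s δ a) * s δ' b := by
    simp only [s]; noncomm_ring
  simp only
  rw [e, map_add]
  have i1 : ‖io X.M X.tr (s γ a * (s γ b - s δ' b))‖ ≤ R * (ε / (2 * R)) := by
    refine (io_norm_mul_left X.tr (sub_mem (hs _ _ hb) (hs _ _ hb)) (hs _ _ ha)).trans ?_
    gcongr
    refine (sigma_norm X γ a).trans ?_
    rw [hR]; linarith [norm_nonneg b]
  have i2 : ‖io X.M X.tr ((s γ a - s δ a) * s δ' b)‖ ≤ R * (ε / (2 * R)) := by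
    refine (io_norm_mul_right X.tr (sub_mem (hs _ _ ha) (hs _ _ ha)) (hs _ _ hb)).trans ?_
    gcongr
    refine (sigma_norm X δ' b).trans ?_
    rw [hR]; linarith [norm_nonneg a]
  have e3 : R * (ε / (2 * R)) = ε / 2 := by field_simp
  calc _ ≤ _ := norm_add_le _ _
    _ ≤ ε := by linarith

theorem AP_sigma {a : H →L[ℂ] H} (ha : a ∈ X.M) (h : AP X (io X.M X.tr a)) (g : Γ) :
    AP X (io X.M X.tr (X.u g * a * X.u g⁻¹)) := by
  refine TotallyBounded.subset ?_ h
  rintro _ ⟨γ, rfl⟩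
  refine ⟨γ * g, ?_⟩
  simp only
  rw [← cj_io X g ha, cj_mul]

theorem AP_mem (hicc : IsICC Γ) (nd : NormalData X.tr k α C) {ξ : L2 X.M X.tr} (h : AP X ξ) :
    ξ ∈ KA X := by
  have key : ∀ g : Γ, g ≠ 1 → eP X g ξ = 0 := by
    intro g hg
    by_contra hne
    set ε := ‖eP X g ξ‖ / 2 with hε
    have hεp : 0 < ε := by positivity
    obtain ⟨F, hF⟩ := AP_net X h hεp
    have : ∀ δ : Γ, ∃ T : Finset Γ, ∀ g, g ∉ T → ‖eP X g (cj X δ ξ)‖ < ε :=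
      fun δ => eP_small X nd _ hεp
    choose T hT using this
    apply hicc g hg
    refine Set.Finite.subset (F.biUnion T).finite_toSet ?_
    rintro _ ⟨γ, rfl⟩
    obtain ⟨δ, hδ, h1⟩ := hF γ
    by_contra hc
    have h2 : ‖eP X (γ * g * γ⁻¹) (cj X δ ξ)‖ < ε := by
      apply hT
      intro hm
      exact hc (Finset.mem_coe.2 (Finset.mem_biUnion.2 ⟨δ, hδ, hm⟩))
    have h3 : ‖eP X (γ * g * γ⁻¹) (cj X γ ξ)‖ = ‖eP X g ξ‖ := by
      rw [eP_norm', eP_norm', show (γ * g * γ⁻¹)⁻¹ = γ * g⁻¹ * γ⁻¹ by group, ← cj_rU, PA_cj, cj_norm]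
    have h4 : ‖eP X (γ * g * γ⁻¹) (cj X γ ξ)‖ ≤ ‖eP X (γ * g * γ⁻¹) (cj X γ ξ - cj X δ ξ)‖ +
        ‖eP X (γ * g * γ⁻¹) (cj X δ ξ)‖ := by
      refine le_trans (le_of_eq ?_) (norm_add_le _ _)
      rw [← map_add, sub_add_cancel]
    have h5 := eP_norm X (γ * g * γ⁻¹) (cj X γ ξ - cj X δ ξ)
    linarith
  have : ξ - PA X ξ = 0 := by
    apply sep X nd
    intro g
    rw [map_sub, map_sub]
    by_cases hg : g = 1
    · subst hg
      rw [inv_one, rU_one]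
      change PA X ξ - PA X (PA X ξ) = 0
      rw [PA_eq X (PA_mem X _), sub_self]
    · rw [PA_rU_KA X (by simpa using hg) (PA_mem X _), sub_zero, ← norm_eq_zero, ← eP_norm',
        key g hg, norm_zero]
  rw [sub_eq_zero.1 this]
  exact PA_mem X _

end four
end CD

namespace CD

section part1
variable {H : Type} [NormedAddCommGroup H] [InnerProductSpace ℂ H] [CompleteSpace H]
variable {Γ : Type} [Group Γ] (X : CrossedProduct Γ H)
variable {k : ℕ} {α : Fin k → H} {C : ℝ}

/-- span of q u -/
def QG (Q : Set (H →L[ℂ] H)) : Submodule ℂ (H →L[ℂ] H) :=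
  Submodule.span ℂ {x | ∃ a ∈ Q, ∃ γ : Γ, x = a * X.u γ}

/-- almost periodic elements -/
def Ac : Set (H →L[ℂ] H) := {a | a ∈ X.A ∧ AP X (io X.M X.tr a)}

theorem QG_mem {Q : Set (H →L[ℂ] H)} {a : H →L[ℂ] H} (ha : a ∈ Q) (γ : Γ) :
    a * X.u γ ∈ QG X Q := Submodule.subset_span ⟨a, ha, γ, rfl⟩

theorem QG_sub {Q : Set (H →L[ℂ] H)} {N : VonNeumannAlgebra H} (hQ : Q ⊆ N)
    (hL : (X.Lg : Set (H →L[ℂ] H)) ⊆ N) {x : H →L[ℂ] H} (hx : x ∈ QG X Q) : x ∈ N := by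
  have : QG X Q ≤ vnSub N := by
    rw [QG, Submodule.span_le]
    rintro _ ⟨a, ha, γ, rfl⟩
    exact mul_mem (S := VonNeumannAlgebra H) (hQ ha) (hL (u_mem_Lg X γ))
  exact this hx

theorem QG_ind {Q : Set (H →L[ℂ] H)} {p : (H →L[ℂ] H) → Prop} {V : Submodule ℂ (L2 X.M X.tr)}
    (T : (H →L[ℂ] H) →ₗ[ℂ] L2 X.M X.tr) (h : ∀ a ∈ Q, ∀ γ : Γ, T (a * X.u γ) ∈ V) :
    ∀ x ∈ QG X Q, T x ∈ V := by
  intro x hx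
  have : QG X Q ≤ V.comap T := by
    rw [QG, Submodule.span_le]
    rintro _ ⟨a, ha, γ, rfl⟩
    exact h a ha γ
  exact this hx

theorem QN_star {x : H →L[ℂ] H}
    (hx : x ∈ QNset (X.M : Set (H →L[ℂ] H)) (X.Lg : Set (H →L[ℂ] H))) :
    star x ∈ QNset (X.M : Set (H →L[ℂ] H)) (X.Lg : Set (H →L[ℂ] H)) := by
  obtain ⟨hxM, n, y, hy, h1, h2⟩ := hx
  refine ⟨star_mem (S := VonNeumannAlgebra H) hxM, n, fun i => star (y i),
    fun i => star_mem (S := VonNeumannAlgebra H) (hy i), fun p hp => ?_, fun p hp => ?_⟩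
  · obtain ⟨q, hq, e⟩ := h2 (star p) (star_mem (S := VonNeumannAlgebra H) hp)
    refine ⟨fun i => star (q i), fun i => star_mem (S := VonNeumannAlgebra H) (hq i), ?_⟩
    have := congrArg star e
    simpa using this
  · obtain ⟨q, hq, e⟩ := h1 (star p) (star_mem (S := VonNeumannAlgebra H) hp)
    refine ⟨fun i => star (q i), fun i => star_mem (S := VonNeumannAlgebra H) (hq i), ?_⟩
    have := congrArg star e
    simpa using this

theorem Ac_one : (1 : H →L[ℂ] H) ∈ Ac X := by
  refine ⟨one_mem X.A, ?_⟩
  have : (Set.range fun γ : Γ => cj X γ (io X.M X.tr 1)) ⊆ {io X.M X.tr 1} := by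
    rintro _ ⟨γ, rfl⟩
    simp only
    rw [cj_io X γ (one_mem X.M), mul_one, u_mul_inv]; rfl
  exact TotallyBounded.subset this (Set.finite_singleton _).totallyBounded

theorem QN_dense (hicc : IsICC Γ) (nd : NormalData X.tr k α C) {y : H →L[ℂ] H} (hy : y ∈ X.M)
    (h : y ∈ vnGen (QNset (X.M : Set (H →L[ℂ] H)) (X.Lg : Set (H →L[ℂ] H)))) :
    io X.M X.tr y ∈ KG X.tr (QG X (Ac X)) := by
  have hAcM : Ac X ⊆ (X.M : Set (H →L[ℂ] H)) := fun a ha => X.A_sub ha.1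
  have key : ∀ x ∈ QNset (X.M : Set (H →L[ℂ] H)) (X.Lg : Set (H →L[ℂ] H)), ∀ g ∈ QG X (Ac X),
      io X.M X.tr (x * g) ∈ KG X.tr (QG X (Ac X)) := by
    intro x hx
    refine QG_ind X (p := fun _ => True) (io X.M X.tr ∘ₗ LinearMap.mulLeft ℂ x) ?_
    intro a ha h
    simp only [LinearMap.comp_apply, LinearMap.mulLeft_apply]
    have hxM : x ∈ X.M := hx.1
    have haM : a ∈ X.M := X.A_sub ha.1
    apply mem_of_coef X nd (mul_mem hxM (mul_mem haM (X.u_mem _)))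
    intro g
    apply QG_mem
    set s := g * h⁻¹ with hs
    have e : x * (a * X.u h) * X.u g⁻¹ = (x * X.u s⁻¹) * (X.u s * a * X.u s⁻¹) := by
      have e1 : X.u h * X.u g⁻¹ = X.u s⁻¹ := by rw [X.u_mul, hs]; congr 1; group
      calc _ = x * a * (X.u h * X.u g⁻¹) := by simp only [mul_assoc]
        _ = x * 1 * a * X.u s⁻¹ := by rw [e1, mul_one]
        _ = _ := by rw [← u_inv_mul X s]; simp only [mul_assoc]
    have hxs : x * X.u s⁻¹ ∈ X.M := mul_mem hxM (X.u_mem _)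
    have hE := X.EA.mem _ hxs
    rw [e, ea_right X (sigma_mem X s ha.1) hxs]
    exact ⟨mul_mem hE (sigma_mem X s ha.1),
      AP_mul X (X.A_sub hE) (X.A_sub (sigma_mem X s ha.1)) (F4 X hicc nd hx s) (AP_sigma X haM ha.2 s)⟩
  refine double_comm nd _ _ (fun x hx => hx.1) (fun g hg => QG_sub X hAcM X.Lg_sub hg) ?_ ?_ hy h
  · have := QG_mem X (Ac_one X) 1
    rwa [X.u_one, mul_one] at this
  · intro x hx g hg
    exact ⟨key x hx g hg, key _ (QN_star X hx) g hg⟩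

theorem PN_cj {N : VonNeumannAlgebra H} (hNM : (N : Set (H →L[ℂ] H)) ⊆ X.M)
    (hL : (X.Lg : Set (H →L[ℂ] H)) ⊆ N) (γ : Γ) (ξ : L2 X.M X.tr) :
    (KG X.tr (vnSub N)).starProjection (cj X γ ξ) =
      cj X γ ((KG X.tr (vnSub N)).starProjection ξ) := by
  rw [cj_apply, cj_apply, lU, rU, lam_proj X.tr hNM (hL (u_mem_Lg X _)),
    rho_proj X.tr hNM (hL (u_mem_Lg X _))]

theorem exp_Ac (hicc : IsICC Γ) (nd : NormalData X.tr k α C) {N : VonNeumannAlgebra H}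
    (hNM : (N : Set (H →L[ℂ] H)) ⊆ X.M)
    (hL : (X.Lg : Set (H →L[ℂ] H)) ⊆ N) {a b : H →L[ℂ] H} (ha : a ∈ Ac X) (hb : b ∈ N)
    (h : io X.M X.tr b = (KG X.tr (vnSub N)).starProjection (io X.M X.tr a)) : b ∈ X.A := by
  apply mem_of_io_mem nd X.A_sub (hNM hb)
  rw [h]
  exact AP_mem X hicc nd (AP_map X ha.2 _ (PN_cj X hNM hL))

theorem Q_dense (hicc : IsICC Γ) (nd : NormalData X.tr k α C) {N : VonNeumannAlgebra H}
    (hNM : (N : Set (H →L[ℂ] H)) ⊆ X.M)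
    (hL : (X.Lg : Set (H →L[ℂ] H)) ⊆ N)
    (hd : ∀ z ∈ N, io X.M X.tr z ∈ KG X.tr (QG X (Ac X))) {z : H →L[ℂ] H} (hz : z ∈ N) :
    io X.M X.tr z ∈ KG X.tr (QG X (vnInf N X.A : VonNeumannAlgebra H)) := by
  have h1 : (KG X.tr (vnSub N)).starProjection (io X.M X.tr z) = io X.M X.tr z :=
    Submodule.starProjection_eq_self_iff.2 (io_mem_KG hz)
  rw [← h1]
  refine KG_map (KG X.tr (vnSub N)).starProjection ?_ _ (hd z hz)
  refine QG_ind X (p := fun _ => True) ((KG X.tr (vnSub N)).starProjection.toLinearMap ∘ₗ io X.M X.tr) ?_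
  intro a ha γ
  simp only [LinearMap.comp_apply, ContinuousLinearMap.coe_coe]
  obtain ⟨b, hb, hba⟩ := exists_condExp nd hNM (X.A_sub ha.1)
  have hbA := exp_Ac X hicc nd hNM hL ha hb hba
  rw [← rU_io X γ (X.A_sub ha.1), rU, rho_proj X.tr hNM (hL (u_mem_Lg X _)), ← hba,
    rho_io X.tr (X.u_mem γ) (hNM hb)]
  exact io_mem_KG (QG_mem X (mem_vnInf.2 ⟨hb, hbA⟩) γ)

theorem inf_sub {N : VonNeumannAlgebra H} :
    ((vnInf N X.A : VonNeumannAlgebra H) : Set (H →L[ℂ] H)) ⊆ X.A := fun x hx => (mem_vnInf.1 hx).2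

theorem inf_sub' {N : VonNeumannAlgebra H} :
    ((vnInf N X.A : VonNeumannAlgebra H) : Set (H →L[ℂ] H)) ⊆ N := fun x hx => (mem_vnInf.1 hx).1

theorem inf_inv {N : VonNeumannAlgebra H} (hL : (X.Lg : Set (H →L[ℂ] H)) ⊆ N) :
    InvariantUnder X (vnInf N X.A : VonNeumannAlgebra H) := by
  intro γ q hq
  have h := mem_vnInf.1 hq
  refine mem_vnInf.2 ⟨?_, X.conj_mem γ q h.2⟩
  have hu := hL (u_mem_Lg X γ)
  exact mul_mem (S := VonNeumannAlgebra H) (mul_mem (S := VonNeumannAlgebra H) hu h.1) (star_mem (S := VonNeumannAlgebra H) hu)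

theorem N_eq (hicc : IsICC Γ) (nd : NormalData X.tr k α C) {N : VonNeumannAlgebra H}
    (hNM : (N : Set (H →L[ℂ] H)) ⊆ X.M)
    (hL : (X.Lg : Set (H →L[ℂ] H)) ⊆ N)
    (hd : ∀ z ∈ N, io X.M X.tr z ∈ KG X.tr (QG X (Ac X))) :
    (N : Set (H →L[ℂ] H)) = midCP X (vnInf N X.A : VonNeumannAlgebra H) := by
  apply Set.Subset.antisymm
  · intro x hx
    refine ⟨hNM hx, fun γ => ?_⟩
    rw [X.u_star]
    have hz : x * X.u γ⁻¹ ∈ N := mul_mem (S := VonNeumannAlgebra H) hx (hL (u_mem_Lg X _))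
    have hE := X.EA.mem _ (hNM hz)
    apply mem_of_io_mem nd ((inf_sub X).trans X.A_sub) (X.A_sub hE)
    rw [← PA_io X (hNM hz)]
    refine KG_map (PA X) ?_ _ (Q_dense X hicc nd hNM hL hd hz)
    refine QG_ind X (p := fun _ => True) ((PA X).toLinearMap ∘ₗ io X.M X.tr) ?_
    intro a ha g
    simp only [LinearMap.comp_apply, ContinuousLinearMap.coe_coe]
    have haA := inf_sub X ha
    rw [← rU_io X g (X.A_sub haA)]
    by_cases hg : g = 1
    · subst hg
      rw [rU_one]
      change PA X (io X.M X.tr a) ∈ _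
      rw [PA_eq X (io_mem_KG haA)]
      exact io_mem_KG ha
    · rw [PA_rU_KA X hg (io_mem_KG haA)]
      exact zero_mem _
  · rintro x ⟨hx, h⟩
    refine mem_of_io_mem nd hNM hx ?_
    apply mem_of_coef X nd hx
    intro g
    have := h g
    rw [X.u_star] at this
    exact mul_mem (S := VonNeumannAlgebra H) (inf_sub' X this) (hL (u_mem_Lg X g))

/-- compact actions -/
theorem compact_Ac (hc : IsCompactAction X) {a : H →L[ℂ] H} (ha : a ∈ X.A) : a ∈ Ac X := by
  refine ⟨ha, ?_⟩
  obtain ⟨F, hFA, hF1, hF2⟩ := hc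
  have h1n : ‖(1 : H →L[ℂ] H)‖ = 1 := by
    have : (1 : H →L[ℂ] H) ≠ 0 := by
      intro e
      have := X.tr.unital
      rw [e, map_zero] at this
      exact zero_ne_one this
    haveI : Nontrivial (H →L[ℂ] H) := ⟨1, 0, this⟩
    exact CStarRing.norm_one
  have hf : ∀ f ∈ F, AP X (io X.M X.tr f) := by
    intro f hf
    apply AP_of
    intro ε hε
    obtain ⟨n, ξ, R, hξ, h⟩ := hF2 f hf ε hε
    let U : Submodule ℂ (L2 X.M X.tr) := Submodule.span ℂ (Set.range fun i => io X.M X.tr (ξ i))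
    haveI : FiniteDimensional ℂ U := FiniteDimensional.span_of_finite ℂ (Set.finite_range _)
    refine ⟨{v | v ∈ U ∧ ‖v‖ ≤ ∑ i, |R| * ‖io X.M X.tr (ξ i)‖}, ?_, ?_⟩
    · exact totallyBounded_finDim (U := U) (fun v hv => hv.1) (fun v hv => hv.2)
    · intro γ
      obtain ⟨κ, hκ, hκR, hn⟩ := h γ
      choose c hc using hκ
      have hcR : ∀ i, ‖c i‖ ≤ |R| := by
        intro i
        have := hκR i
        rw [← hc i] at this
        simp only [norm_smul, h1n, mul_one] at this
        exact this.trans (le_abs_self R)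
      have e : ∑ i, κ i * ξ i = ∑ i, c i • ξ i := by
        refine Finset.sum_congr rfl fun i _ => ?_
        rw [← hc i]; simp
      have hfM : f ∈ X.M := X.A_sub (hFA hf)
      refine ⟨io X.M X.tr (∑ i, c i • ξ i), ⟨?_, ?_⟩, ?_⟩
      · rw [map_sum]
        refine sum_mem fun i _ => ?_
        rw [map_smul]
        exact U.smul_mem _ (Submodule.subset_span ⟨i, rfl⟩)
      · rw [map_sum]
        refine (norm_sum_le _ _).trans (Finset.sum_le_sum fun i _ => ?_)
        rw [map_smul, norm_smul]
        gcongr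
        exact hcR i
      · rw [cj_io X γ hfM, ← map_sub, io_norm X.tr, ← X.u_star, ← e]
        · exact hn
        · refine sub_mem (mul_mem (mul_mem (X.u_mem _) hfM) (X.u_mem _)) (sum_mem fun i _ => ?_)
          exact vn_smul_mem X.M _ (X.A_sub (hξ i))
  apply AP_of
  intro ε hε
  obtain ⟨n, c, f, hfF, hn⟩ := hF1 a ha ε hε
  have hsum : AP X (io X.M X.tr (∑ i, c i • f i)) := by
    rw [map_sum]
    have : ∀ s : Finset (Fin n), AP X (∑ i ∈ s, io X.M X.tr (c i • f i)) := by
      intro s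
      induction s using Finset.induction_on with
      | empty =>
        rw [Finset.sum_empty]
        have := AP_smul X (Ac_one X).2 0
        rwa [zero_smul] at this
      | insert i s hi ih =>
        rw [Finset.sum_insert hi]
        refine AP_add X ?_ ih
        rw [map_smul]
        exact AP_smul X (hf _ (hfF i)) _
    exact this _
  refine ⟨_, hsum, fun γ => ⟨_, ⟨γ, rfl⟩, ?_⟩⟩
  simp only
  rw [← map_sub, cj_norm, ← map_sub, io_norm X.tr]
  · exact hn
  · exact sub_mem (X.A_sub ha) (sum_mem fun i _ => vn_smul_mem X.M _ (X.A_sub (hFA (hfF i))))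

end part1
end CD

namespace CD

section part1
variable {H : Type} [NormedAddCommGroup H] [InnerProductSpace ℂ H] [CompleteSpace H]
variable {Γ : Type} [Group Γ] {X : CrossedProduct Γ H}

/-- A trace preserving expectation of `N₂` onto `N₁` inside `M`. -/
structure ExpD (X : CrossedProduct Γ H) (N₁ N₂ : VonNeumannAlgebra H)
    (E : (H →L[ℂ] H) →ₗ[ℂ] (H →L[ℂ] H)) : Prop where
  h12 : (N₁ : Set (H →L[ℂ] H)) ⊆ N₂
  h2 : (N₂ : Set (H →L[ℂ] H)) ⊆ X.M
  mem : ∀ x ∈ N₂, E x ∈ N₁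
  fix : ∀ x ∈ N₁, E x = x
  bim : ∀ a ∈ N₁, ∀ b ∈ N₁, ∀ x ∈ N₂, E (a * x * b) = a * E x * b
  tre : ∀ x ∈ N₂, X.tr.τ (E x) = X.tr.τ x

variable {N₁ N₂ : VonNeumannAlgebra H} {E : (H →L[ℂ] H) →ₗ[ℂ] (H →L[ℂ] H)}

namespace ExpD

theorem up (D : ExpD X N₁ N₂ E) {x : H →L[ℂ] H} (hx : x ∈ N₁) : x ∈ N₂ := D.h12 hx
theorem upM (D : ExpD X N₁ N₂ E) {x : H →L[ℂ] H} (hx : x ∈ N₂) : x ∈ X.M := D.h2 hx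
theorem h1 (D : ExpD X N₁ N₂ E) : (N₁ : Set (H →L[ℂ] H)) ⊆ X.M := fun x hx => D.h2 (D.h12 hx)

theorem left (D : ExpD X N₁ N₂ E) {a x : H →L[ℂ] H} (ha : a ∈ N₁) (hx : x ∈ N₂) : E (a * x) = a * E x := by
  have := D.bim a ha 1 (one_mem N₁) x hx
  simpa using this

theorem right (D : ExpD X N₁ N₂ E) {a x : H →L[ℂ] H} (ha : a ∈ N₁) (hx : x ∈ N₂) : E (x * a) = E x * a := by
  have := D.bim 1 (one_mem N₁) a ha x hx
  simpa using this

theorem tau (D : ExpD X N₁ N₂ E) {a x : H →L[ℂ] H} (ha : a ∈ N₁) (hx : x ∈ N₂) :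
    X.tr.τ (star a * x) = X.tr.τ (star a * E x) := by
  have hs : star a ∈ N₁ := star_mem ha
  rw [← D.left hs hx, D.tre _ (mul_mem (D.up hs) hx)]

theorem proj (D : ExpD X N₁ N₂ E) {x : H →L[ℂ] H} (hx : x ∈ N₂) :
    (KG X.tr (vnSub N₁)).starProjection (io X.M X.tr x) = io X.M X.tr (E x) :=
  proj_eq_of_tau D.h1 (D.upM hx) (D.mem x hx) fun a ha => D.tau ha hx

theorem star_map (D : ExpD X N₁ N₂ E) {x : H →L[ℂ] H} (hx : x ∈ N₂) : E (star x) = star (E x) := by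
  have hs : star x ∈ N₂ := star_mem hx
  have he := D.mem x hx
  apply eq_of_tau D.h1 (D.mem _ hs) (star_mem he)
  intro a ha
  have haM := D.upM (D.up ha)
  rw [← D.tau ha hs, ← star_mul, ← star_mul, X.tr.star_eq _ (mul_mem (D.upM hx) haM),
    X.tr.star_eq _ (mul_mem (D.h1 he) haM), ← D.right ha hx, D.tre _ (mul_mem hx (D.up ha))]

theorem pos (D : ExpD X N₁ N₂ E) {x : H →L[ℂ] H} (hx : x ∈ N₂) (h : 0 ≤ x) : 0 ≤ E x := by
  have he := D.mem x hx
  have hsx : star x = x := (IsSelfAdjoint.of_nonneg h).star_eq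
  have hsa : IsSelfAdjoint (E x) := by
    change star (E x) = E x
    rw [← D.star_map hx, hsx]
  set y := cfc (fun t : ℝ => max (-t) 0) (E x) with hy
  have hyN : y ∈ N₁ := vn_cfc_mem N₁ he _
  have hys : star y = y := (cfc_predicate _ (E x) : IsSelfAdjoint y).star_eq
  have hc1 : Continuous fun t : ℝ => max (-t) 0 := by fun_prop
  have hy3 : y * E x * y = - (y * y * y) := by
    conv_lhs => rw [← cfc_id' ℝ (E x) hsa]
    rw [hy, ← cfc_mul _ _ (E x) hc1.continuousOn (by fun_prop),
      ← cfc_mul _ _ (E x) (by fun_prop) hc1.continuousOn, 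
      ← cfc_mul _ _ (E x) hc1.continuousOn hc1.continuousOn,
      ← cfc_mul _ _ (E x) (by fun_prop) hc1.continuousOn, ← cfc_neg]
    apply cfc_congr
    intro t _
    rcases le_total t 0 with ht | ht
    · simp only [max_eq_left (neg_nonneg.2 ht)]; ring
    · simp only [max_eq_right (neg_nonpos.2 ht)]; ring
  have hy0 : 0 ≤ y := cfc_nonneg fun t _ => le_max_right _ _
  have hyM := D.h1 hyN
  have hN2 : y * x * y ∈ N₂ := mul_mem (mul_mem (D.up hyN) hx) (D.up hyN)
  have e1 : 0 ≤ (X.tr.τ (y * E x * y)).re := by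
    rw [← D.bim y hyN y hyN x hx, D.tre _ hN2]
    exact (tau_nonneg X.tr (D.upM hN2) (conj_nonneg hys h)).1
  have h3M : y * y * y ∈ X.M := mul_mem (mul_mem hyM hyM) hyM
  have h30 : 0 ≤ y * y * y := conj_nonneg hys hy0
  have e2 : y * y * y = 0 := by
    apply tau_eq_zero X.tr h3M h30
    have := (tau_nonneg X.tr h3M h30).1
    rw [hy3, map_neg, Complex.neg_re] at e1
    linarith
  have e3 : y = 0 := by
    have : star (y * y) * (y * y) = 0 := by
      rw [star_mul, hys, ← mul_assoc, e2, zero_mul]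
    have := eq_zero_of_star_mul this
    apply eq_zero_of_star_mul
    rw [hys, this]
  have e4 : E x = cfc (fun t : ℝ => max t 0) (E x) := by
    have : cfc (fun t : ℝ => max t 0) (E x) = E x + y := by
      conv_rhs => rw [← cfc_id' ℝ (E x) hsa]
      rw [hy]
      conv_rhs => rw [cfc_id' ℝ (E x) hsa]
      conv_rhs => enter [1]; rw [← cfc_id' ℝ (E x) hsa]
      rw [← cfc_add (E x) _ _ (by fun_prop) hc1.continuousOn]
      apply cfc_congr
      intro t _
      rcases le_total t 0 with ht | ht
      · simp [max_eq_left (neg_nonneg.2 ht), ht]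
      · simp [max_eq_right (neg_nonpos.2 ht), ht]
    rw [this, e3, add_zero]
  rw [e4]
  exact cfc_nonneg fun t _ => le_max_right _ _

theorem mono (D : ExpD X N₁ N₂ E) {x y : H →L[ℂ] H} (hx : x ∈ N₂) (hy : y ∈ N₂) (h : x ≤ y) : E x ≤ E y := by
  have := D.pos (sub_mem hy hx) (sub_nonneg.2 h)
  rw [map_sub] at this
  exact sub_nonneg.1 this

theorem sq_le (D : ExpD X N₁ N₂ E) {x : H →L[ℂ] H} (hx : x ∈ N₂) : star (E x) * E x ≤ E (star x * x) := by
  have he := D.mem x hx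
  have hes : star (E x) ∈ N₁ := star_mem he
  have hxs : star x ∈ N₂ := star_mem hx
  have h1 : x - E x ∈ N₂ := sub_mem hx (D.up he)
  have h2 : star (x - E x) * (x - E x) ∈ N₂ := mul_mem (star_mem h1) h1
  have := D.pos h2 (star_mul_self_nonneg _)
  have e : star (x - E x) * (x - E x) = star x * x - star x * E x - star (E x) * x + star (E x) * E x := by
    rw [star_sub]; noncomm_ring
  rw [e, map_add, map_sub, map_sub, D.right he hxs, D.left hes hx,
    D.fix _ (mul_mem hes he), D.star_map hx] at this
  rw [← sub_nonneg]
  convert this using 1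
  noncomm_ring

theorem faithful (D : ExpD X N₁ N₂ E) {x : H →L[ℂ] H} (hx : x ∈ N₂) (h : 0 ≤ x) (h0 : E x = 0) : x = 0 := by
  apply tau_eq_zero X.tr (D.upM hx) h
  rw [← D.tre x hx, h0]; simp

theorem one (D : ExpD X N₁ N₂ E) : E 1 = 1 := D.fix 1 (one_mem N₁)

end ExpD

theorem norm_le_of_le {y : H →L[ℂ] H} {c : ℝ} (h0 : 0 ≤ y) (hc : 0 ≤ c)
    (h : y ≤ algebraMap ℝ _ c) : ‖y‖ ≤ c := (CStarAlgebra.norm_le_iff_le_algebraMap y hc h0).2 h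

theorem le_of_norm_le {y : H →L[ℂ] H} {c : ℝ} (h0 : 0 ≤ y) (hc : 0 ≤ c)
    (h : ‖y‖ ≤ c) : y ≤ algebraMap ℝ _ c := (CStarAlgebra.norm_le_iff_le_algebraMap y hc h0).1 h

theorem proj_le_one {f : H →L[ℂ] H} (h1 : star f = f) (h2 : f * f = f) : f ≤ 1 := by
  have : 0 ≤ 1 - f := proj_nonneg (by rw [star_sub, star_one, h1]) (by
    rw [mul_sub, sub_mul, sub_mul, h2]; simp)
  exact sub_nonneg.1 this

/-- Full data for the index computation. -/
structure IdxD (X : CrossedProduct Γ H) (N₁ N₂ : VonNeumannAlgebra H)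
    (E : (H →L[ℂ] H) →ₗ[ℂ] (H →L[ℂ] H)) (k : ℕ) (m : Fin k → (H →L[ℂ] H)) (r : ℝ) : Prop
    extends ExpD X N₁ N₂ E where
  hL : (X.Lg : Set (H →L[ℂ] H)) ⊆ N₁
  mN : ∀ i, m i ∈ N₂
  exp : ∀ x ∈ N₂, x = ∑ i, E (x * star (m i)) * m i
  hQ : ∀ q ∈ N₂, q ∈ X.A → E q ∈ X.A
  dens : ∀ z ∈ N₂, io X.M X.tr z ∈ KG X.tr (QG X (vnInf N₂ X.A : VonNeumannAlgebra H))
  msum : ∑ i, star (m i) * m i = r • (1 : H →L[ℂ] H)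
  rpos : 0 < r

namespace IdxD
variable {k : ℕ} {m : Fin k → (H →L[ℂ] H)} {r : ℝ}

/-- the abelian algebra `N ∩ A` -/
abbrev Q (X : CrossedProduct Γ H) (N : VonNeumannAlgebra H) : VonNeumannAlgebra H := vnInf N X.A

theorem EQ (D : IdxD X N₁ N₂ E k m r) {q : H →L[ℂ] H} (hq : q ∈ Q X N₂) : E q ∈ Q X N₁ :=
  mem_vnInf.2 ⟨D.mem q (mem_vnInf.1 hq).1, D.hQ q (mem_vnInf.1 hq).1 (mem_vnInf.1 hq).2⟩

theorem Qup (D : IdxD X N₁ N₂ E k m r) {q : H →L[ℂ] H} (hq : q ∈ Q X N₁) : q ∈ Q X N₂ :=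
  mem_vnInf.2 ⟨D.up (mem_vnInf.1 hq).1, (mem_vnInf.1 hq).2⟩

theorem q1 {N : VonNeumannAlgebra H} {q : H →L[ℂ] H} (hq : q ∈ Q X N) : q ∈ N := (mem_vnInf.1 hq).1

theorem qc (habel : IsAbelianSet (X.A : Set (H →L[ℂ] H))) {N N' : VonNeumannAlgebra H}
    {a b : H →L[ℂ] H} (ha : a ∈ Q X N) (hb : b ∈ Q X N') : a * b = b * a :=
  habel a (mem_vnInf.1 ha).2 b (mem_vnInf.1 hb).2

theorem exp2 (D : IdxD X N₁ N₂ E k m r) {x : H →L[ℂ] H} (hx : x ∈ N₂) : x = ∑ i, star (m i) * E (m i * x) := by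
  have h := D.exp (star x) (star_mem hx)
  have h2 := congrArg star h
  rw [star_star] at h2
  refine h2.trans ?_
  rw [star_sum]
  apply Finset.sum_congr rfl
  intro i _
  have : star x * star (m i) ∈ N₂ := mul_mem (star_mem hx) (star_mem (D.mN i))
  rw [star_mul, ← D.star_map this, star_mul, star_star, star_star]

/-- lower bound -/
theorem lower (D : IdxD X N₁ N₂ E k m r) : ∃ c : ℝ, 0 < c ∧ ∀ f, IsProjIn (N₂ : Set (H →L[ℂ] H)) f → f ≠ 0 → c ≤ ‖E f‖ := by
  set S := ∑ i, ‖m i‖ * ‖m i‖ with hS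
  have hS0 : 0 ≤ S := Finset.sum_nonneg fun i _ => by positivity
  refine ⟨(1 / (S + 1)) ^ 2, by positivity, ?_⟩
  intro f hf hf0
  have hfN : f ∈ N₂ := hf.1
  have hf1 : 1 ≤ ‖f‖ := by
    have h := norm_mul_le f f
    rw [hf.2.2] at h
    have : 0 < ‖f‖ := norm_pos_iff.2 hf0
    nlinarith
  have hEf0 : 0 ≤ E f := D.pos hfN (proj_nonneg hf.2.1 hf.2.2)
  have key : ∀ i, ‖E (m i * f)‖ ≤ ‖m i‖ * Real.sqrt ‖E f‖ := by
    intro i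
    have hmf : m i * f ∈ N₂ := mul_mem (D.mN i) hfN
    apply le_of_sq_le_sq _ (by positivity)
    rw [mul_pow, Real.sq_sqrt (norm_nonneg _), sq, ← CStarRing.norm_star_mul_self]
    have h1 : star (m i * f) * (m i * f) ≤ (‖m i‖ ^ 2) • f := by
      have a := star_mul_le (m i)
      have b := conj_nonneg (e := f) hf.2.1 (sub_nonneg.2 a)
      rw [← sub_nonneg]
      convert b using 1
      rw [Algebra.algebraMap_eq_smul_one, mul_sub, sub_mul, star_mul, hf.2.1, mul_smul_comm,
        smul_mul_assoc, mul_one, hf.2.2]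
      simp only [mul_assoc]
    have h2 := D.mono (mul_mem (star_mem hmf) hmf) (vn_rsmul_mem N₂ _ hfN) h1
    have h3 : E ((‖m i‖ ^ 2) • f) = (‖m i‖ ^ 2) • E f := by
      have := E.map_smul ((‖m i‖ ^ 2 : ℝ) : ℂ) f
      rwa [Complex.coe_smul, Complex.coe_smul] at this
    have h4 := CStarAlgebra.norm_le_norm_of_nonneg_of_le (star_mul_self_nonneg _)
      ((D.sq_le hmf).trans h2)
    rw [h3, norm_smul, Real.norm_of_nonneg (by positivity)] at h4
    exact h4
  have h5 : ‖f‖ ≤ S * Real.sqrt ‖E f‖ := by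
    conv_lhs => rw [D.exp2 hfN]
    refine (norm_sum_le _ _).trans ?_
    rw [hS, Finset.sum_mul]
    apply Finset.sum_le_sum
    intro i _
    refine (norm_mul_le _ _).trans ?_
    rw [norm_star, mul_assoc]
    exact mul_le_mul_of_nonneg_left (key i) (norm_nonneg _)
  have hs := Real.sqrt_nonneg ‖E f‖
  have h6 : 1 / (S + 1) ≤ Real.sqrt ‖E f‖ := by
    rw [div_le_iff₀ (by positivity)]
    nlinarith
  calc (1 / (S + 1)) ^ 2 ≤ Real.sqrt ‖E f‖ ^ 2 := by gcongr
    _ = ‖E f‖ := Real.sq_sqrt (norm_nonneg _)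

end IdxD
end part1
end CD

namespace CD

section part1
variable {H : Type} [NormedAddCommGroup H] [InnerProductSpace ℂ H] [CompleteSpace H]
variable {Γ : Type} [Group Γ] {X : CrossedProduct Γ H}
variable {N₁ N₂ : VonNeumannAlgebra H} {E : (H →L[ℂ] H) →ₗ[ℂ] (H →L[ℂ] H)}

namespace IdxD
variable {k : ℕ} {m : Fin k → (H →L[ℂ] H)} {r : ℝ}

theorem projQ (D : IdxD X N₁ N₂ E k m r) {f : H →L[ℂ] H} (hf : IsProjIn (Q X N₂ : Set (H →L[ℂ] H)) f) :
    IsProjIn (N₂ : Set (H →L[ℂ] H)) f := ⟨q1 hf.1, hf.2⟩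

/-- If all nonzero projections below `p` have large expectation, then `E h ^ 2 ≥ t E h`. -/
theorem claimA (D : IdxD X N₁ N₂ E k m r) (habel : IsAbelianSet (X.A : Set (H →L[ℂ] H)))
    {p h : H →L[ℂ] H} {t : ℝ} (ht0 : 0 ≤ t)
    (ht : ∀ g, IsProjIn (Q X N₂ : Set (H →L[ℂ] H)) g → p * g = g → g ≠ 0 → t < ‖E g‖)
    (hh : IsProjIn (Q X N₂ : Set (H →L[ℂ] H)) h) (hp : p * h = h) :
    0 ≤ E h * E h - t • E h := by
  have hhQ : h ∈ Q X N₂ := hh.1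
  have hh0 := proj_nonneg hh.2.1 hh.2.2
  have ha := D.EQ hhQ
  have ha0 : 0 ≤ E h := D.pos (q1 hhQ) hh0
  have hsa : IsSelfAdjoint (E h) := IsSelfAdjoint.of_nonneg ha0
  set a := E h with had
  have hc1 : Continuous fun s : ℝ => max (t - s) 0 := by fun_prop
  have hc2 : Continuous fun s : ℝ => max (s - t) 0 := by fun_prop
  set y := cfc (fun s : ℝ => max (t - s) 0) a with hy
  set w := cfc (fun s : ℝ => max (s - t) 0) a with hw
  have hyQ : y ∈ Q X N₁ := vn_cfc_mem _ ha _
  have hy0 : 0 ≤ y := cfc_nonneg fun s _ => le_max_right _ _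
  have hw0 : 0 ≤ w := cfc_nonneg fun s _ => le_max_right _ _
  have hwy : w * y = 0 := by
    rw [hw, hy, ← cfc_mul _ _ a hc2.continuousOn hc1.continuousOn]
    rw [← cfc_zero ℝ a]
    apply cfc_congr
    intro s _
    rcases le_total s t with hs | hs
    · simp [hs]
    · simp [hs]
  have hta : algebraMap ℝ (H →L[ℂ] H) t - a = y - w := by
    conv_lhs => rw [← cfc_id' ℝ a hsa, ← cfc_const t a hsa]
    rw [← cfc_sub _ _ a (by fun_prop) (by fun_prop), hy, hw,
      ← cfc_sub _ _ a hc1.continuousOn hc2.continuousOn]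
    apply cfc_congr
    intro s _
    rcases le_total s t with hs | hs
    · simp [hs]
    · simp [hs]
  set z := rp y with hz
  have hzQ : z ∈ Q X N₁ := rp_mem _ hyQ
  have hzs : star z = z := rp_star y
  have hzz : z * z = z := rp_idem y
  have hwz : w * z = 0 := mul_rp_of_mul_eq_zero hwy
  have hyh : y * h = 0 := by
    by_contra hne
    have hyhQ : y * h ∈ Q X N₂ := mul_mem (D.Qup hyQ) hhQ
    have hcom : y * h = h * y := qc habel hyQ hhQ
    set g := rp (y * h) with hg
    have hgP : IsProjIn (Q X N₂ : Set (H →L[ℂ] H)) g := rp_isProj _ hyhQ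
    have hgQ : g ∈ Q X N₂ := hgP.1
    have hhg : h * g = g := mul_rp_of_mul_eq_self (by rw [hcom, ← mul_assoc, hh.2.2])
    have hzg : z * g = g := mul_rp_of_mul_eq_self (by rw [← mul_assoc, rp_mul_self])
    have hpg : p * g = g := by rw [← hhg, ← mul_assoc, hp]
    have hg0 : g ≠ 0 := fun e => hne (rp_eq_zero e)
    have h1 := ht g hgP hpg hg0
    have hgh : g ≤ h := by
      rw [← sub_nonneg]
      exact proj_nonneg (compl_proj hh hgP hhg).2.1 (compl_proj hh hgP hhg).2.2
    have h2 : E g ≤ a := D.mono (q1 hgQ) (q1 hhQ) hgh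
    have h3 : E g = z * E g * z := by
      rw [← D.bim z (q1 hzQ) z (q1 hzQ) g (q1 hgQ), hzg, qc habel hgQ hzQ, hzg]
    have h4 : z * E g * z ≤ z * a * z := by
      rw [← sub_nonneg, ← sub_mul, ← mul_sub]
      exact conj_nonneg hzs (sub_nonneg.2 h2)
    have h5 : z * a * z ≤ t • z := by
      rw [← sub_nonneg]
      have : t • z - z * a * z = z * y * z := by
        have e : z * (algebraMap ℝ (H →L[ℂ] H) t - a) * z = z * (y - w) * z := by rw [hta]
        rw [mul_sub, sub_mul, mul_sub, sub_mul, mul_assoc z w z, hwz, mul_zero, sub_zero,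
          Algebra.algebraMap_eq_smul_one, mul_smul_comm, smul_mul_assoc, mul_one, hzz] at e
        exact e
      rw [this]
      exact conj_nonneg hzs hy0
    have h6 : t • z ≤ algebraMap ℝ _ t := by
      rw [Algebra.algebraMap_eq_smul_one]
      exact smul_le_smul_of_nonneg_left (proj_le_one hzs hzz) ht0
    have h7 := norm_le_of_le (D.pos (q1 hgQ) (proj_nonneg hgP.2.1 hgP.2.2)) ht0
      ((h3.le.trans h4).trans (h5.trans h6))
    linarith
  have hya : y * a = 0 := by
    rw [had, ← D.left (q1 hyQ) (q1 hhQ), hyh, map_zero]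
  have e1 : a * a - t • a = w * a := by
    have e : (algebraMap ℝ (H →L[ℂ] H) t - a) * a = (y - w) * a := by rw [hta]
    rw [sub_mul, sub_mul, hya, zero_sub, Algebra.algebraMap_eq_smul_one, smul_mul_assoc, one_mul] at e
    rw [← neg_inj, ← e]; abel
  rw [e1]
  have hwQ : w ∈ Q X N₁ := vn_cfc_mem _ ha _
  exact Commute.mul_nonneg hw0 ha0 (qc habel hwQ ha)

theorem claimB (D : IdxD X N₁ N₂ E k m r) (habel : IsAbelianSet (X.A : Set (H →L[ℂ] H)))
    {p f : H →L[ℂ] H} {t t' : ℝ} (ht0 : 0 ≤ t) (htt : t' < 2 * t) (ht' : 0 ≤ t')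
    (ht : ∀ g, IsProjIn (Q X N₂ : Set (H →L[ℂ] H)) g → p * g = g → g ≠ 0 → t < ‖E g‖)
    (hf : IsProjIn (Q X N₂ : Set (H →L[ℂ] H)) f) (hp : p * f = f) (hft : ‖E f‖ ≤ t')
    {g : H →L[ℂ] H} (hg : IsProjIn (Q X N₂ : Set (H →L[ℂ] H)) g) (hfg : f * g = g) :
    E g * f = g * E f := by
  have hk := compl_proj hf hg hfg
  have hkf : f * (f - g) = f - g := by rw [mul_sub, hf.2.2, hfg]
  have hpg : p * g = g := by rw [← hfg, ← mul_assoc, hp]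
  have hpk : p * (f - g) = f - g := by rw [mul_sub, hp, hpg]
  have hfQ : f ∈ Q X N₂ := hf.1
  have hgQ : g ∈ Q X N₂ := hg.1
  have hkQ : f - g ∈ Q X N₂ := hk.1
  have A1 := D.claimA habel ht0 ht hg hpg
  have A2 := D.claimA habel ht0 ht hk hpk
  have ha := D.EQ hgQ
  have hb := D.EQ hkQ
  have ha0 : 0 ≤ E g := D.pos (q1 hgQ) (proj_nonneg hg.2.1 hg.2.2)
  have hb0 : 0 ≤ E (f - g) := D.pos (q1 hkQ) (proj_nonneg hk.2.1 hk.2.2)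
  have hsum : E f = E g + E (f - g) := by rw [← map_add]; congr 1; abel
  have hf0 : 0 ≤ E f := D.pos (q1 hfQ) (proj_nonneg hf.2.1 hf.2.2)
  have hle := le_of_norm_le hf0 ht' hft
  set a := E g with had
  set b := E (f - g) with hbd
  have hab : a * b = b * a := qc habel ha hb
  have hab0 : 0 ≤ a * b := Commute.mul_nonneg ha0 hb0 hab
  have s1 : 0 ≤ (a * a - t • a) * b := Commute.mul_nonneg A1 hb0
    (qc habel (sub_mem (mul_mem ha ha) (vn_rsmul_mem _ t ha) : _ ∈ Q X N₁) hb)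
  have s2 : 0 ≤ (b * b - t • b) * a := Commute.mul_nonneg A2 ha0
    (qc habel (sub_mem (mul_mem hb hb) (vn_rsmul_mem _ t hb) : _ ∈ Q X N₁) ha)
  have s3 : 0 ≤ (algebraMap ℝ _ t' - E f) * (a * b) := Commute.mul_nonneg (sub_nonneg.2 hle) hab0
    (qc habel (sub_mem (algMap_mem _ t') (D.EQ hfQ) : _ ∈ Q X N₁) (mul_mem ha hb : _ ∈ Q X N₁))
  have s4 : 0 ≤ (-(2 * t - t')) • (a * b) := by
    have := add_nonneg (add_nonneg s1 s2) s3
    convert this using 1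
    rw [hsum, Algebra.algebraMap_eq_smul_one]
    simp only [sub_mul, add_mul, smul_mul_assoc, one_mul, neg_smul, sub_smul, mul_smul, two_smul]
    have e1 : b * b * a = b * (a * b) := by rw [hab, mul_assoc]
    have e2 : b * a = a * b := hab.symm
    rw [e1, e2, mul_assoc a a b]
    abel
  have s5 : a * b = 0 := by
    apply le_antisymm _ hab0
    have h1 : 0 < 2 * t - t' := by linarith
    have := smul_nonneg (inv_nonneg.2 h1.le) s4
    rw [smul_smul, mul_neg, inv_mul_cancel₀ h1.ne', neg_smul, one_smul] at this
    exact neg_nonneg.1 this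
  have hN : ∀ {x}, x ∈ Q X N₂ → x ∈ N₂ := fun h => q1 h
  have v1 : (f - g) * a = 0 := by
    have e : (f - g) * a = (f - g) * a * (f - g) := by
      rw [mul_assoc, qc habel ha hkQ, ← mul_assoc, hk.2.2]
    apply D.faithful (mul_mem (q1 hkQ) (D.up (q1 ha)))
    · rw [e]; exact conj_nonneg hk.2.1 ha0
    · rw [D.right (q1 ha) (q1 hkQ), ← hab, s5]
  have v2 : g * b = 0 := by
    have e : g * b = g * b * g := by
      rw [mul_assoc, qc habel hb hgQ, ← mul_assoc, hg.2.2]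
    apply D.faithful (mul_mem (q1 hgQ) (D.up (q1 hb)))
    · rw [e]; exact conj_nonneg hg.2.1 hb0
    · rw [D.right (q1 hb) (q1 hgQ), s5]
  rw [hsum, mul_add, v2, add_zero, qc habel ha hfQ]
  rw [sub_mul] at v1
  exact sub_eq_zero.1 v1

end IdxD
end part1
end CD

namespace CD

section part1
variable {H : Type} [NormedAddCommGroup H] [InnerProductSpace ℂ H] [CompleteSpace H]
variable {Γ : Type} [Group Γ] {X : CrossedProduct Γ H}
variable {N₁ N₂ : VonNeumannAlgebra H} {E : (H →L[ℂ] H) →ₗ[ℂ] (H →L[ℂ] H)}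

theorem rsmulE (E : (H →L[ℂ] H) →ₗ[ℂ] (H →L[ℂ] H)) (c : ℝ) (f : H →L[ℂ] H) :
    E (c • f) = c • E f := by
  have := E.map_smul (c : ℂ) f
  rwa [Complex.coe_smul, Complex.coe_smul] at this

namespace IdxD
variable {k : ℕ} {m : Fin k → (H →L[ℂ] H)} {r : ℝ}

theorem claimC0 (D : IdxD X N₁ N₂ E k m r) {f : H →L[ℂ] H}
    (hB : ∀ g, IsProjIn (Q X N₂ : Set (H →L[ℂ] H)) g → f * g = g → E g * f = g * E f)
    {x : H →L[ℂ] H} (hx : x ∈ Q X N₂) (hx0 : 0 ≤ x) (hfx : f * x = x) :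
    E x * f = x * E f := by
  set c : ℝ := ‖x‖ + 1 with hc
  have hc0 : 0 < c := by positivity
  have hxc : x ≤ algebraMap ℝ _ c := le_of_norm_le hx0 hc0.le (by linarith)
  have key : ∀ n : ℕ, ‖E x * f - x * E f‖ ≤ (c * (‖f‖ + ‖E f‖)) * (1 / 2) ^ n := by
    intro n
    obtain ⟨e, w, hw, he, h0, h1⟩ := spectral_approx (Q X N₂) n hx c hc0 hx0 hxc f hfx
    set s := ∑ i, w i • e i with hs
    have hsQ : s ∈ Q X N₂ := sum_mem fun i _ => vn_rsmul_mem _ _ (he i).1.1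
    have hyQ : x - s ∈ Q X N₂ := sub_mem hx hsQ
    have hss : E s * f = s * E f := by
      rw [hs, map_sum, Finset.sum_mul, Finset.sum_mul]
      apply Finset.sum_congr rfl
      intro i _
      rw [rsmulE, smul_mul_assoc, smul_mul_assoc, hB _ (he i).1 (he i).2]
    have hd : E x * f - x * E f = E (x - s) * f - (x - s) * E f := by
      rw [map_sub, sub_mul, sub_mul, hss]; abel
    have hcn : 0 ≤ c / 2 ^ n := by positivity
    have n1 : ‖x - s‖ ≤ c / 2 ^ n := norm_le_of_le h0 hcn h1
    have n2 : ‖E (x - s)‖ ≤ c / 2 ^ n := by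
      apply norm_le_of_le (D.pos (q1 hyQ) h0) hcn
      have := D.mono (q1 hyQ) (algMap_mem N₂ _) h1
      rwa [D.fix _ (algMap_mem N₁ _)] at this
    rw [hd]
    refine (norm_sub_le _ _).trans ?_
    have n3 := (norm_mul_le (E (x - s)) f).trans (mul_le_mul_of_nonneg_right n2 (norm_nonneg f))
    have n4 := (norm_mul_le (x - s) (E f)).trans (mul_le_mul_of_nonneg_right n1 (norm_nonneg (E f)))
    refine (add_le_add n3 n4).trans (le_of_eq ?_)
    rw [one_div, inv_pow]; ring
  have hl : Tendsto (fun n : ℕ => (c * (‖f‖ + ‖E f‖)) * (1 / 2 : ℝ) ^ n) atTop (𝓝 0) := by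
    have := (tendsto_pow_atTop_nhds_zero_of_lt_one (r := (1 / 2 : ℝ)) (by norm_num) (by norm_num)).const_mul
      (c * (‖f‖ + ‖E f‖))
    simpa using this
  have := ge_of_tendsto' hl key
  exact sub_eq_zero.1 (norm_le_zero_iff.1 this)

theorem claimC (D : IdxD X N₁ N₂ E k m r) (habel : IsAbelianSet (X.A : Set (H →L[ℂ] H)))
    {f : H →L[ℂ] H} (hf : IsProjIn (Q X N₂ : Set (H →L[ℂ] H)) f)
    (hB : ∀ g, IsProjIn (Q X N₂ : Set (H →L[ℂ] H)) g → f * g = g → E g * f = g * E f)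
    {x : H →L[ℂ] H} (hx : x ∈ Q X N₂) :
    E (x * f) * f = x * f * E f := by
  have hfQ : f ∈ Q X N₂ := hf.1
  let S : Submodule ℂ (H →L[ℂ] H) := LinearMap.ker
    ((LinearMap.mulRight ℂ f) ∘ₗ E ∘ₗ (LinearMap.mulRight ℂ f) - LinearMap.mulRight ℂ (f * E f))
  have hS : ∀ y, y ∈ S ↔ E (y * f) * f = y * f * E f := by
    intro y
    simp only [S, LinearMap.mem_ker, LinearMap.sub_apply, LinearMap.comp_apply,
      LinearMap.mulRight_apply, sub_eq_zero, mul_assoc]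
  have hpos : ∀ y ∈ Q X N₂, 0 ≤ y → y ∈ S := by
    intro y hy h0
    rw [hS]
    have e : y * f = f * y * f := by rw [qc habel hfQ hy, mul_assoc, hf.2.2]
    apply D.claimC0 hB (mul_mem hy hfQ)
    · rw [e]; exact conj_nonneg hf.2.1 h0
    · rw [e, ← mul_assoc, ← mul_assoc, hf.2.2]
  have h1S : (1 : H →L[ℂ] H) ∈ S := hpos 1 (one_mem _) zero_le_one
  have hsa : ∀ y ∈ Q X N₂, star y = y → y ∈ S := by
    intro y hy h
    have hs : IsSelfAdjoint y := h
    have h2 : 0 ≤ y + algebraMap ℝ _ ‖y‖ := by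
      have := hs.neg_algebraMap_norm_le_self
      rw [← sub_nonneg] at this
      simpa using this
    have h3 : y + algebraMap ℝ _ ‖y‖ ∈ S := hpos _ (add_mem hy (algMap_mem _ _)) h2
    have h4 : algebraMap ℝ (H →L[ℂ] H) ‖y‖ ∈ S := by
      rw [Algebra.algebraMap_eq_smul_one, ← Complex.coe_smul]
      exact S.smul_mem _ h1S
    have := S.sub_mem h3 h4
    rwa [add_sub_cancel_right] at this
  rw [← hS]
  have hxs : star x ∈ Q X N₂ := star_mem hx
  have a1 : x + star x ∈ S := hsa _ (add_mem hx hxs) (by rw [star_add, star_star, add_comm])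
  have a2 : Complex.I • (x - star x) ∈ S := hsa _ (vn_smul_mem _ _ (sub_mem hx hxs)) (by
    rw [star_smul, star_sub, star_star]
    simp only [RCLike.star_def, Complex.conj_I, neg_smul, smul_sub]
    abel)
  have e : x = (1 / 2 : ℂ) • (x + star x) + (-Complex.I / 2) • (Complex.I • (x - star x)) := by
    rw [smul_smul]
    have : -Complex.I / 2 * Complex.I = 1 / 2 := by
      rw [div_mul_eq_mul_div, neg_mul, Complex.I_mul_I, neg_neg]
    rw [this, ← smul_add]
    have : x + star x + (x - star x) = (2 : ℂ) • x := by rw [two_smul]; abel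
    rw [this, smul_smul]; norm_num
  rw [e]
  exact S.add_mem (S.smul_mem _ a1) (S.smul_mem _ a2)

theorem claimD (D : IdxD X N₁ N₂ E k m r) (habel : IsAbelianSet (X.A : Set (H →L[ℂ] H)))
    {f : H →L[ℂ] H} (hf : IsProjIn (Q X N₂ : Set (H →L[ℂ] H)) f)
    (hB : ∀ g, IsProjIn (Q X N₂ : Set (H →L[ℂ] H)) g → f * g = g → E g * f = g * E f)
    {x : H →L[ℂ] H} (hx : x ∈ N₂) :
    E (x * f) * f = x * f * E f := by
  have hfQ : f ∈ Q X N₂ := hf.1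
  have hfN := q1 hfQ
  have hfM := D.upM hfN
  have hEf : E f ∈ N₂ := D.up (D.mem f hfN)
  let P := (KG X.tr (vnSub N₁)).starProjection
  let T : L2 X.M X.tr →L[ℂ] L2 X.M X.tr :=
    (rho X.tr f) ∘L P ∘L (rho X.tr f) - rho X.tr (f * E f)
  have hT : ∀ y ∈ N₂, T (io X.M X.tr y) = io X.M X.tr (E (y * f) * f - y * f * E f) := by
    intro y hy
    have hyf : y * f ∈ N₂ := mul_mem hy hfN
    have hffM : f * E f ∈ X.M := D.upM (mul_mem hfN hEf)
    simp only [T, P, ContinuousLinearMap.sub_apply, ContinuousLinearMap.comp_apply]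
    rw [rho_io X.tr hfM (D.upM hy), D.proj hyf, rho_io X.tr hfM (D.h1 (D.mem _ hyf)),
      rho_io X.tr hffM (D.upM hy), map_sub, mul_assoc]
  have hker : KG X.tr (QG X (Q X N₂ : Set (H →L[ℂ] H))) ≤ LinearMap.ker (T : L2 X.M X.tr →ₗ[ℂ] L2 X.M X.tr) := by
    apply KG_mono (ContinuousLinearMap.isClosed_ker T)
    have h0 : ∀ x ∈ QG X (Q X N₂ : Set (H →L[ℂ] H)), ((T : L2 X.M X.tr →ₗ[ℂ] L2 X.M X.tr) ∘ₗ io X.M X.tr) x ∈ (⊥ : Submodule ℂ (L2 X.M X.tr)) := by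
      refine QG_ind X (p := fun _ => True) _ ?_
      intro a ha γ
      have hu := D.hL (u_mem_Lg X γ)
      have hui := D.hL (u_mem_Lg X γ⁻¹)
      have haN : a ∈ N₂ := q1 ha
      rw [Submodule.mem_bot]
      change T (io X.M X.tr (a * X.u γ)) = 0
      rw [hT _ (mul_mem haN (D.up hu))]
      set b := X.u γ⁻¹ * a * X.u γ with hb
      have hbQ : b ∈ Q X N₂ := by
        have := inf_inv X (N := N₂) (fun z hz => D.up (D.hL hz)) γ⁻¹ a ha
        rw [CrossedProduct.σ, X.u_star, inv_inv] at this
        exact this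
      have e : a * X.u γ = X.u γ * b := by
        rw [hb, ← mul_assoc, ← mul_assoc, u_mul_inv, one_mul]
      rw [e, mul_assoc, D.left hu (mul_mem (q1 hbQ) hfN), mul_assoc, D.claimC habel hf hB hbQ,
        mul_assoc (X.u γ), sub_self, map_zero]
    intro g hg
    have := h0 g hg
    rw [Submodule.mem_bot] at this
    exact this
  have h := hker (D.dens x hx)
  have h2 : T (io X.M X.tr x) = 0 := h
  rw [hT x hx] at h2
  have hxf : x * f ∈ N₂ := mul_mem hx hfN
  exact sub_eq_zero.1 (io_inj X.tr (D.upM (sub_mem (mul_mem (D.up (D.mem _ hxf)) hfN) (mul_mem hxf hEf))) h2)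

theorem good_of (D : IdxD X N₁ N₂ E k m r) (habel : IsAbelianSet (X.A : Set (H →L[ℂ] H)))
    {f : H →L[ℂ] H} (hf : IsProjIn (Q X N₂ : Set (H →L[ℂ] H)) f)
    (hB : ∀ g, IsProjIn (Q X N₂ : Set (H →L[ℂ] H)) g → f * g = g → E g * f = g * E f) :
    r • (f * E f) = f := by
  have hfN := q1 (N := N₂) (X := X) hf.1
  have h := D.exp2 hfN
  have h2 : f * f = (∑ i, star (m i) * E (m i * f)) * f := by rw [← h]
  rw [hf.2.2, Finset.sum_mul] at h2
  have h3 : ∀ i ∈ Finset.univ, star (m i) * E (m i * f) * f = star (m i) * m i * (f * E f) := by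
    intro i _
    rw [mul_assoc, D.claimD habel hf hB (D.mN i)]
    simp only [mul_assoc]
  rw [Finset.sum_congr rfl h3, ← Finset.sum_mul, D.msum, smul_mul_assoc, one_mul] at h2
  exact h2.symm

theorem exists_good (D : IdxD X N₁ N₂ E k m r) (habel : IsAbelianSet (X.A : Set (H →L[ℂ] H)))
    {p : H →L[ℂ] H} (hp : IsProjIn (Q X N₂ : Set (H →L[ℂ] H)) p) (hp0 : p ≠ 0) :
    ∃ f, IsProjIn (Q X N₂ : Set (H →L[ℂ] H)) f ∧ f ≠ 0 ∧ p * f = f ∧ r • (f * E f) = f := by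
  obtain ⟨c₀, hc₀, hlow⟩ := D.lower
  let S : Set ℝ := {x | ∃ f, IsProjIn (Q X N₂ : Set (H →L[ℂ] H)) f ∧ f ≠ 0 ∧ p * f = f ∧ x = ‖E f‖}
  have hne : S.Nonempty := ⟨_, p, hp, hp0, hp.2.2, rfl⟩
  have hbd : ∀ x ∈ S, c₀ ≤ x := by
    rintro x ⟨f, hf, hf0, -, rfl⟩
    exact hlow f (D.projQ hf) hf0
  have hbb : BddBelow S := ⟨c₀, hbd⟩
  set c := sInf S with hc
  have hcc : c₀ ≤ c := le_csInf hne hbd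
  obtain ⟨_, ⟨f, hf, hf0, hpf, rfl⟩, hlt⟩ := exists_lt_of_csInf_lt hne (show sInf S < 5 / 4 * c by rw [← hc]; linarith)
  refine ⟨f, hf, hf0, hpf, D.good_of habel hf ?_⟩
  intro g hg hfg
  refine D.claimB habel (p := p) (t := 3 / 4 * c) (t' := 5 / 4 * c) (by linarith) (by linarith) (by linarith)
    ?_ hf hpf hlt.le hg hfg
  intro g hg hpg hg0
  have : c ≤ ‖E g‖ := csInf_le hbb ⟨g, hg, hg0, hpg, rfl⟩
  linarith

end IdxD
end part1
end CD

namespace CD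

section part1
variable {H : Type} [NormedAddCommGroup H] [InnerProductSpace ℂ H] [CompleteSpace H]
variable {Γ : Type} [Group Γ] {X : CrossedProduct Γ H}
variable {N₁ N₂ : VonNeumannAlgebra H} {E : (H →L[ℂ] H) →ₗ[ℂ] (H →L[ℂ] H)}

namespace IdxD
variable {k : ℕ} {m : Fin k → (H →L[ℂ] H)} {r : ℝ}
variable {k' : ℕ} {α : Fin k' → H} {C : ℝ}

theorem E_le_one (D : IdxD X N₁ N₂ E k m r) {f : H →L[ℂ] H}
    (hf : IsProjIn (Q X N₂ : Set (H →L[ℂ] H)) f) : ‖E f‖ ≤ 1 := by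
  have hfN := q1 (N := N₂) (X := X) hf.1
  apply norm_le_of_le (D.pos hfN (proj_nonneg hf.2.1 hf.2.2)) zero_le_one
  rw [map_one, ← D.one]
  exact D.mono hfN (one_mem _) (proj_le_one hf.2.1 hf.2.2)

theorem good_sup (D : IdxD X N₁ N₂ E k m r) (nd : NormalData X.tr k' α C)
    {s : ℕ → (H →L[ℂ] H)} {e : H →L[ℂ] H}
    (hs : ∀ n, IsProjIn (Q X N₂ : Set (H →L[ℂ] H)) (s n)) (hg : ∀ n, r • (s n * E (s n)) = s n)
    (he : IsProjIn (Q X N₂ : Set (H →L[ℂ] H)) e)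
    (hl : ∀ x, Tendsto (fun n => s n x) atTop (𝓝 (e x))) : r • (e * E e) = e := by
  have hsN : ∀ n, s n ∈ N₂ := fun n => q1 (N := N₂) (X := X) (hs n).1
  have heN : e ∈ N₂ := q1 (N := N₂) (X := X) he.1
  have hEs : ∀ n, E (s n) ∈ X.M := fun n => D.h1 (D.mem _ (hsN n))
  have hEe : E e ∈ X.M := D.h1 (D.mem _ heN)
  have l1 := nd_tendsto nd (fun n => D.upM (hsN n)) (D.upM heN) hl
  have l2 : Tendsto (fun n => io X.M X.tr (E (s n))) atTop (𝓝 (io X.M X.tr (E e))) := by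
    have := ((KG X.tr (vnSub N₁)).starProjection.continuous.tendsto _).comp l1
    rw [D.proj heN] at this
    refine this.congr fun n => ?_
    rw [Function.comp_apply, D.proj (hsN n)]
  have l3 : Tendsto (fun n => io X.M X.tr (s n * E (s n))) atTop (𝓝 (io X.M X.tr (e * E e))) := by
    rw [tendsto_iff_norm_sub_tendsto_zero] at l1 l2 ⊢
    have l4 := (l2.const_mul ‖e‖).add l1
    rw [mul_zero, add_zero] at l4
    refine squeeze_zero (fun n => norm_nonneg _) (fun n => ?_) l4
    rw [← map_sub (io X.M X.tr) (s n * E (s n)), ← map_sub (io X.M X.tr) (E (s n)),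
      ← map_sub (io X.M X.tr) (s n)]
    have e1 : s n * E (s n) - e * E e = e * (E (s n) - E e) + (s n - e) * E (s n) := by noncomm_ring
    rw [e1, map_add]
    refine (norm_add_le _ _).trans (add_le_add ?_ ?_)
    · exact io_norm_mul_left X.tr (sub_mem (hEs n) hEe) (D.upM heN)
    · refine (io_norm_mul_right X.tr (sub_mem (D.upM (hsN n)) (D.upM heN)) (hEs n)).trans ?_
      have := D.E_le_one (hs n)
      have h0 := norm_nonneg (io X.M X.tr (s n - e))
      nlinarith
  have l5 := l3.const_smul (r : ℂ)
  have h6 := tendsto_nhds_unique (l5.congr fun n => by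
    change (r : ℂ) • io X.M X.tr (s n * E (s n)) = io X.M X.tr (s n)
    rw [← map_smul, Complex.coe_smul, hg]) l1
  rw [← map_smul, Complex.coe_smul] at h6
  exact io_inj2 X.tr (vn_rsmul_mem _ _ (mul_mem (D.upM heN) hEe)) (D.upM heN) h6

theorem step (D : IdxD X N₁ N₂ E k m r) (habel : IsAbelianSet (X.A : Set (H →L[ℂ] H)))
    (nd : NormalData X.tr k' α C) {n : ℕ} (hn : (n : ℝ) < r) {q : H →L[ℂ] H}
    (hq : IsProjIn (Q X N₂ : Set (H →L[ℂ] H)) q) (hqE : r • E q = (n : ℝ) • (1 : H →L[ℂ] H)) :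
    ∃ q', IsProjIn (Q X N₂ : Set (H →L[ℂ] H)) q' ∧ r • E q' = ((n + 1 : ℕ) : ℝ) • (1 : H →L[ℂ] H) := by
  have h1P : IsProjIn (Q X N₂ : Set (H →L[ℂ] H)) 1 := ⟨one_mem (Q X N₂), star_one _, mul_one _⟩
  have hp := compl_proj h1P hq (one_mul q)
  set p := 1 - q with hpd
  have hQ2 : ((Q X N₂ : VonNeumannAlgebra H) : Set (H →L[ℂ] H)) ⊆ X.M := fun x hx => D.h2 (q1 hx)
  obtain ⟨f, hf, ⟨hpf, hfg⟩, hmax⟩ := proj_exhaust X.tr (Q X N₂) hQ2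
    (fun f => p * f = f ∧ r • (f * E f) = f) (by simp) (by
      intro s e hs he hle hl
      refine ⟨?_, D.good_sup nd (fun n => (hs n).1) (fun n => (hs n).2.2) he hl⟩
      ext v
      have l1 : Tendsto (fun n => p (s n v)) atTop (𝓝 (p (e v))) := (p.continuous.tendsto _).comp (hl v)
      have l2 : Tendsto (fun n => p (s n v)) atTop (𝓝 (e v)) := (hl v).congr fun n => by
        rw [← mulA, (hs n).2.1]
      rw [mulA]
      exact tendsto_nhds_unique l1 l2)
  have hfQ : f ∈ Q X N₂ := hf.1
  have hfN := q1 hfQ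
  have hEf := D.EQ hfQ
  have hEfN := q1 hEf
  set s := r • E f with hs
  have hsQ : s ∈ Q X N₁ := vn_rsmul_mem _ _ hEf
  have hfs : f * s = f := by rw [hs, mul_smul_comm, hfg]
  have hss : s * s = s := by
    have := congrArg E hfs
    rw [D.right (q1 hsQ) hfN] at this
    calc s * s = r • (E f * s) := by rw [hs, smul_mul_assoc]
      _ = s := by rw [this]
  have hsst : star s = s := by
    have : star (E f) = E f := (IsSelfAdjoint.of_nonneg (D.pos hfN (proj_nonneg hf.2.1 hf.2.2))).star_eq
    rw [hs, star_smul, this]; simp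
  have hsP : IsProjIn (Q X N₁ : Set (H →L[ℂ] H)) s := ⟨hsQ, hsst, hss⟩
  have h1s : IsProjIn (Q X N₂ : Set (H →L[ℂ] H)) (1 - s) :=
    compl_proj h1P ⟨D.Qup hsQ, hsst, hss⟩ (one_mul s)
  have h1sQ : 1 - s ∈ Q X N₁ := sub_mem (one_mem _) hsQ
  have hpQ : p ∈ Q X N₂ := hp.1
  have hcom : (1 - s) * p = p * (1 - s) := qc habel h1sQ hpQ
  have hzero : (1 - s) * p = 0 := by
    by_contra hne
    have hP : IsProjIn (Q X N₂ : Set (H →L[ℂ] H)) ((1 - s) * p) := by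
      refine ⟨mul_mem (D.Qup h1sQ) hpQ, ?_, ?_⟩
      · rw [star_mul, hp.2.1, h1s.2.1, hcom]
      · have : (1 - s) * p * ((1 - s) * p) = (1 - s) * (p * (1 - s)) * p := by simp only [mul_assoc]
        rw [this, ← hcom, ← mul_assoc, h1s.2.2, mul_assoc, hp.2.2]
    obtain ⟨g, hg, hg0, hgp, hgg⟩ := D.exists_good habel hP hne
    have hgQ : g ∈ Q X N₂ := hg.1
    have hgN := q1 hgQ
    have hsg : (1 - s) * g = g := by
      rw [← hgp, ← mul_assoc, ← mul_assoc, h1s.2.2]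
    have hpg : p * g = g := by
      rw [← hgp, hcom, ← mul_assoc, ← mul_assoc, hp.2.2]
    have hsg0 : s * g = 0 := by
      rw [sub_mul, one_mul, sub_eq_self] at hsg
      exact hsg
    have hsf : s * f = f := by rw [qc habel hsQ hfQ, hfs]
    have hfg0 : f * g = 0 := by rw [← hfs, mul_assoc, hsg0, mul_zero]
    have hgf0 : g * f = 0 := by rw [qc habel hgQ hfQ, hfg0]
    have hsEg : s * E g = 0 := by rw [← D.left (q1 hsQ) hgN, hsg0, map_zero]
    have hEg := D.EQ hgQ
    have hfEg : f * E g = 0 := by rw [← hfs, mul_assoc, hsEg, mul_zero]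
    have hgEf : g * (r • E f) = 0 := by
      rw [← hs, qc habel hgQ hsQ, hsg0]
    have hadd := proj_add hf hg hfg0
    have hgood : r • ((f + g) * E (f + g)) = f + g := by
      rw [map_add, add_mul, mul_add, mul_add, hfEg, add_zero, smul_add, smul_add, hfg, hgg,
        ← mul_smul_comm, hgEf, zero_add]
    have := hmax (f + g) hadd.1 ⟨by rw [mul_add, hpf, hpg], hgood⟩ hadd.2.1
    exact hg0 (by simpa using this)
  have hs1 : s = 1 := by
    have e1 : (1 - s) * (r • E p) = 0 := by
      rw [mul_smul_comm, ← D.left (q1 h1sQ) (q1 hpQ), hzero, map_zero, smul_zero]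
    rw [hpd, map_sub, D.one, smul_sub, hqE, ← sub_smul, mul_smul_comm, mul_one] at e1
    rcases smul_eq_zero.1 e1 with h | h
    · exact absurd h (by linarith)
    · exact (sub_eq_zero.1 h).symm
  have hqf : q * f = 0 := by
    rw [hpd, sub_mul, one_mul, sub_eq_self] at hpf
    exact hpf
  refine ⟨q + f, (proj_add hq hf hqf).1, ?_⟩
  rw [map_add, smul_add, hqE, ← hs, hs1]
  push_cast
  rw [add_smul, one_smul]

theorem nat_index (D : IdxD X N₁ N₂ E k m r) (habel : IsAbelianSet (X.A : Set (H →L[ℂ] H)))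
    (nd : NormalData X.tr k' α C) : ∃ n : ℕ, r = n := by
  have hle : ∀ (n : ℕ) (q : H →L[ℂ] H), IsProjIn (Q X N₂ : Set (H →L[ℂ] H)) q →
      r • E q = (n : ℝ) • (1 : H →L[ℂ] H) → (n : ℝ) ≤ r := by
    intro n q hq h
    have h1 := congrArg (fun x => (X.tr.τ x).re) h
    simp only [tau_rsmul_re, X.tr.unital, Complex.one_re, mul_one] at h1
    have hqN : q ∈ N₂ := q1 (X := X) hq.1
    rw [D.tre q hqN] at h1
    have := proj_le_one_tau X.tr (p := q) ⟨D.upM hqN, hq.2⟩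
    have := D.rpos
    nlinarith
  by_contra hno
  push Not at hno
  have all : ∀ n : ℕ, ∃ q, IsProjIn (Q X N₂ : Set (H →L[ℂ] H)) q ∧ r • E q = (n : ℝ) • (1 : H →L[ℂ] H) := by
    intro n
    induction n with
    | zero => exact ⟨0, ⟨zero_mem (Q X N₂), star_zero _, mul_zero _⟩, by simp⟩
    | succ n ih =>
      obtain ⟨q, hq, h⟩ := ih
      exact D.step habel nd (lt_of_le_of_ne (hle n q hq h) (hno n).symm) hq h
  obtain ⟨n, hn⟩ := exists_nat_gt r
  obtain ⟨q, hq, h⟩ := all n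
  linarith [hle n q hq h]

end IdxD
end part1
end CD

namespace CD

section assembly
variable {H : Type} [NormedAddCommGroup H] [InnerProductSpace ℂ H] [CompleteSpace H]
variable {Γ : Type} [Group Γ] (X : CrossedProduct Γ H)
variable {k : ℕ} {α : Fin k → H} {C : ℝ}
variable {N₁ N₂ : VonNeumannAlgebra H} {E : (H →L[ℂ] H) →ₗ[ℂ] (H →L[ℂ] H)}

theorem exp_keeps_A (hicc : IsICC Γ) (nd : NormalData X.tr k α C) (D : ExpD X N₁ N₂ E)
    (hL : (X.Lg : Set (H →L[ℂ] H)) ⊆ N₁)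
    (hd : ∀ z ∈ N₂, io X.M X.tr z ∈ KG X.tr (QG X (Ac X))) :
    ∀ q ∈ N₂, q ∈ X.A → E q ∈ X.A := by
  intro q hq hqA
  have hqM := D.upM hq
  apply mem_of_io_mem nd X.A_sub (D.h1 (D.mem q hq))
  rw [← D.proj hq]
  have h1 : PA X (io X.M X.tr q) = io X.M X.tr q := by
    rw [PA_io X hqM, X.EA.fix q hqA]
  rw [← h1]
  refine KG_map ((KG X.tr (vnSub N₁)).starProjection ∘L PA X) ?_ _ (hd q hq)
  refine QG_ind X (p := fun _ => True)
    (((KG X.tr (vnSub N₁)).starProjection ∘L PA X).toLinearMap ∘ₗ io X.M X.tr) ?_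
  intro a ha γ
  simp only [LinearMap.comp_apply, ContinuousLinearMap.coe_coe, ContinuousLinearMap.comp_apply]
  rw [PA_io X (mul_mem (X.A_sub ha.1) (X.u_mem γ)), ea_left X ha.1 (X.u_mem γ)]
  by_cases hγ : γ = 1
  · subst hγ
    rw [X.u_one, X.EA.fix 1 (one_mem X.A), mul_one]
    exact AP_mem X hicc nd (AP_map X ha.2 _ (PN_cj X D.h1 hL))
  · rw [X.EA_u γ hγ, mul_zero, map_zero, map_zero]
    exact Submodule.zero_mem _

variable {n : ℕ} {m p : Fin n → (H →L[ℂ] H)}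

theorem ExpD.exp_flip {X : CrossedProduct Γ H} (D : ExpD X N₁ N₂ E) (mN : ∀ i, m i ∈ N₂)
    (hexp : ∀ x ∈ N₂, x = ∑ i, E (x * star (m i)) * m i) {x : H →L[ℂ] H} (hx : x ∈ N₂) :
    x = ∑ i, star (m i) * E (m i * x) := by
  have h := hexp (star x) (star_mem hx)
  have h2 := congrArg star h
  rw [star_star] at h2
  refine h2.trans ?_
  rw [star_sum]
  apply Finset.sum_congr rfl
  intro i _
  have : star x * star (m i) ∈ N₂ := mul_mem (star_mem hx) (star_mem (mN i))
  rw [star_mul, ← D.star_map this, star_mul, star_star, star_star]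

theorem mkIdx (hicc : IsICC Γ) (nd : NormalData X.tr k α C) (D : ExpD X N₁ N₂ E)
    (hL : (X.Lg : Set (H →L[ℂ] H)) ⊆ N₁)
    (hd : ∀ z ∈ N₂, io X.M X.tr z ∈ KG X.tr (QG X (Ac X)))
    (hfac : IsFactorSet (N₂ : Set (H →L[ℂ] H)))
    (mN : ∀ i, m i ∈ N₂)
    (hmp : ∀ i j, E (m i * star (m j)) = if i = j then p i else 0)
    (hexp : ∀ x ∈ N₂, x = ∑ i, E (x * star (m i)) * m i)
    {r : ℝ} (hr : r = (∑ i, X.tr.τ (p i)).re) : IdxD X N₁ N₂ E n m r := by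
  set S := ∑ i, star (m i) * m i with hS
  have hSN : S ∈ N₂ := sum_mem fun i _ => mul_mem (star_mem (mN i)) (mN i)
  have hcomm : ∀ y ∈ (N₂ : Set (H →L[ℂ] H)), S * y = y * S := by
    intro y hy
    have hy : y ∈ N₂ := hy
    have e1 : S * y = ∑ i, ∑ j, star (m i) * (E (m i * y * star (m j)) * m j) := by
      rw [hS, Finset.sum_mul]
      apply Finset.sum_congr rfl
      intro i _
      rw [mul_assoc, ← Finset.mul_sum, ← hexp _ (mul_mem (mN i) hy)]
    have e2 : y * S = ∑ j, ∑ i, star (m i) * (E (m i * y * star (m j)) * m j) := by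
      rw [hS, Finset.mul_sum]
      apply Finset.sum_congr rfl
      intro j _
      have h := D.exp_flip mN hexp (mul_mem hy (star_mem (mN j)) : y * star (m j) ∈ N₂)
      rw [← mul_assoc]
      conv_lhs => rw [h]
      rw [Finset.sum_mul]
      apply Finset.sum_congr rfl
      intro i _
      simp only [mul_assoc]
    rw [e1, e2, Finset.sum_comm]
  obtain ⟨c, hc⟩ := hfac S hSN hcomm
  have htau : ∀ i, X.tr.τ (star (m i) * m i) = X.tr.τ (p i) := by
    intro i
    have hi := mN i
    rw [X.tr.tracial _ (D.upM (star_mem hi)) _ (D.upM hi), ← D.tre _ (mul_mem hi (star_mem hi)), hmp, if_pos rfl]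
  have hc1 : c = ∑ i, X.tr.τ (p i) := by
    have := congrArg X.tr.τ hc
    rw [hS, map_sum, map_smul, X.tr.unital, smul_eq_mul, mul_one] at this
    rw [← this]
    exact Finset.sum_congr rfl fun i _ => htau i
  have hr' : r = ∑ i, (X.tr.τ (star (m i) * m i)).re := by
    rw [hr, Complex.re_sum]
    exact Finset.sum_congr rfl fun i _ => by rw [htau]
  have him : c.im = 0 := by
    rw [hc1, Complex.im_sum]
    exact Finset.sum_eq_zero fun i _ => by rw [← htau]; exact (X.tr.nonneg _ (D.upM (mN i))).2
  have hcr : c = (r : ℂ) := by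
    apply Complex.ext
    · rw [hc1, hr]; simp
    · rw [him]; simp
  refine ⟨D, hL, mN, hexp, exp_keeps_A X hicc nd D hL hd,
    fun z hz => Q_dense X hicc nd D.h2 (fun x hx => D.h12 (hL hx)) hd hz, ?_, ?_⟩
  · rw [← hS, hc, hcr, Complex.coe_smul]
  · by_contra hneg
    push Not at hneg
    have hnn : ∀ i ∈ Finset.univ, 0 ≤ (X.tr.τ (star (m i) * m i)).re :=
      fun i _ => (X.tr.nonneg _ (D.upM (mN i))).1
    have h0 : ∑ i, (X.tr.τ (star (m i) * m i)).re = 0 :=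
      le_antisymm (hr' ▸ hneg) (Finset.sum_nonneg hnn)
    rw [Finset.sum_eq_zero_iff_of_nonneg hnn] at h0
    have hm0 : ∀ i, m i = 0 := by
      intro i
      apply X.tr.faithful _ (D.upM (mN i))
      apply Complex.ext
      · rw [h0 i (Finset.mem_univ i)]; rfl
      · rw [(X.tr.nonneg _ (D.upM (mN i))).2]; rfl
    have h1 := hexp 1 (one_mem N₂)
    have : (1 : H →L[ℂ] H) = 0 := by
      rw [h1]
      exact Finset.sum_eq_zero fun i _ => by rw [hm0 i, mul_zero]
    have h2 := X.tr.unital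
    rw [this, map_zero] at h2
    exact zero_ne_one h2

/-- finitely generated as a left module over `L(Γ)` -/
def FG (N : VonNeumannAlgebra H) : Prop :=
  ∃ (n : ℕ) (m : Fin n → (H →L[ℂ] H)), (∀ i, m i ∈ N) ∧
    ∀ x ∈ N, ∃ q : Fin n → (H →L[ℂ] H), (∀ i, q i ∈ X.Lg) ∧ x = ∑ i, q i * m i

theorem FG_of {ι : Type} [Fintype ι] {N : VonNeumannAlgebra H} (m : ι → (H →L[ℂ] H)) (hm : ∀ i, m i ∈ N)
    (h : ∀ x ∈ N, ∃ q : ι → (H →L[ℂ] H), (∀ i, q i ∈ X.Lg) ∧ x = ∑ i, q i * m i) : FG X N := by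
  let e := Fintype.equivFin ι
  refine ⟨Fintype.card ι, m ∘ e.symm, fun i => hm _, fun x hx => ?_⟩
  obtain ⟨q, hq, hx'⟩ := h x hx
  refine ⟨q ∘ e.symm, fun i => hq _, ?_⟩
  rw [hx']
  exact (Equiv.sum_comp e.symm (fun i => q i * m i)).symm

theorem FG_trans (D : ExpD X N₁ N₂ E) (mN : ∀ i, m i ∈ N₂)
    (hexp : ∀ x ∈ N₂, x = ∑ i, E (x * star (m i)) * m i) (h : FG X N₁) : FG X N₂ := by
  obtain ⟨k, a, ha, hk⟩ := h
  refine FG_of X (ι := Fin n × Fin k) (fun z => a z.2 * m z.1)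
    (fun z => mul_mem (D.up (ha _)) (mN _)) ?_
  intro x hx
  have : ∀ i, E (x * star (m i)) ∈ N₁ := fun i => D.mem _ (mul_mem hx (star_mem (mN i)))
  choose q hq hq' using fun i => hk _ (this i)
  refine ⟨fun z => q z.1 z.2, fun z => hq _ _, ?_⟩
  rw [Fintype.sum_prod_type]
  conv_lhs => rw [hexp x hx]
  apply Finset.sum_congr rfl
  intro i _
  rw [hq' i, Finset.sum_mul]
  apply Finset.sum_congr rfl
  intro j _
  simp only [mul_assoc]

theorem FG_base : FG X X.Lg := by
  refine FG_of X (ι := Unit) (fun _ => 1) (fun _ => one_mem _) ?_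
  intro x hx
  exact ⟨fun _ => x, fun _ => hx, by simp⟩

theorem FG_QN {N : VonNeumannAlgebra H} (hL : (X.Lg : Set (H →L[ℂ] H)) ⊆ N)
    (hNM : (N : Set (H →L[ℂ] H)) ⊆ X.M) (h : FG X N) :
    (N : Set (H →L[ℂ] H)) ⊆ QNset (X.M : Set (H →L[ℂ] H)) (X.Lg : Set (H →L[ℂ] H)) := by
  intro x hx
  have hx : x ∈ N := hx
  obtain ⟨k, m, hm, hk⟩ := h
  let e := finSumFinEquiv (m := k) (n := k)
  have hmM : ∀ i, m i ∈ X.M := fun i => hNM (hm i)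
  refine ⟨hNM hx, k + k, Sum.elim m (fun i => star (m i)) ∘ e.symm, ?_, ?_, ?_⟩
  · intro i
    simp only [Function.comp]
    rcases e.symm i with j | j
    · exact hmM j
    · exact star_mem (S := VonNeumannAlgebra H) (hmM j)
  · intro p hp
    have hp' : p ∈ N := hL hp
    obtain ⟨q, hq, hq'⟩ := hk (star (p * x)) (star_mem (mul_mem hp' hx))
    refine ⟨Sum.elim (fun _ => 0) (fun i => star (q i)) ∘ e.symm, ?_, ?_⟩
    · intro i
      simp only [Function.comp]
      rcases e.symm i with j | j
      · exact zero_mem X.Lg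
      · exact star_mem (S := VonNeumannAlgebra H) (hq j)
    · have h2 := congrArg star hq'
      rw [star_star, star_sum] at h2
      rw [h2]
      refine Eq.trans ?_ (Equiv.sum_comp e.symm (fun i => Sum.elim m (fun i => star (m i)) i *
        Sum.elim (fun _ => 0) (fun i => star (q i)) i)).symm
      rw [Fintype.sum_sum_type]
      simp
  · intro p hp
    have hp' : p ∈ N := hL hp
    obtain ⟨q, hq, hq'⟩ := hk (x * p) (mul_mem hx hp')
    refine ⟨Sum.elim q (fun _ => 0) ∘ e.symm, ?_, ?_⟩
    · intro i
      simp only [Function.comp]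
      rcases e.symm i with j | j
      · exact hq j
      · exact zero_mem X.Lg
    · rw [hq']
      refine Eq.trans ?_ (Equiv.sum_comp e.symm (fun i => Sum.elim q (fun _ => 0) i *
        Sum.elim m (fun i => star (m i)) i)).symm
      rw [Fintype.sum_sum_type]
      simp

theorem FG_dense (hicc : IsICC Γ) (nd : NormalData X.tr k α C) {N : VonNeumannAlgebra H}
    (hL : (X.Lg : Set (H →L[ℂ] H)) ⊆ N)
    (hNM : (N : Set (H →L[ℂ] H)) ⊆ X.M) (h : FG X N) :
    ∀ z ∈ N, io X.M X.tr z ∈ KG X.tr (QG X (Ac X)) := fun z hz =>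
  QN_dense X hicc nd (hNM hz) (Set.subset_centralizer_centralizer (FG_QN X hL hNM h hz))

theorem compact_dense (hc : IsCompactAction X) (nd : NormalData X.tr k α C) :
    ∀ z ∈ X.M, io X.M X.tr z ∈ KG X.tr (QG X (Ac X)) := by
  intro z hz
  refine KG_mono (KG_closed _) ?_ (cp_dense X nd hz)
  intro g hg
  apply io_mem_KG
  refine Submodule.span_mono ?_ hg
  rintro _ ⟨a, ha, γ, rfl⟩
  exact ⟨a, compact_Ac X hc ha, γ, rfl⟩

theorem Lg_inf_A (nd : NormalData X.tr k α C) {x : H →L[ℂ] H} (hx : x ∈ X.Lg) (hA : x ∈ X.A) :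
    x = X.tr.τ x • (1 : H →L[ℂ] H) := by
  have hxM := X.A_sub hA
  have h1 : PA X (io X.M X.tr x) = io X.M X.tr x := by
    rw [PA_io X hxM, X.EA.fix x hA]
  have hm : io X.M X.tr x ∈ KG X.tr (ℂ ∙ (1 : H →L[ℂ] H)) := by
    rw [← h1]
    refine KG_map (PA X) ?_ _ (Lg_dense X nd hx)
    intro g hg
    have : UG X ≤ (KG X.tr (ℂ ∙ (1 : H →L[ℂ] H))).comap ((PA X).toLinearMap ∘ₗ io X.M X.tr) := by
      rw [UG, Submodule.span_le]
      rintro _ ⟨γ, rfl⟩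
      change PA X (io X.M X.tr (X.u γ)) ∈ KG X.tr (ℂ ∙ (1 : H →L[ℂ] H))
      rw [PA_io X (X.u_mem γ)]
      by_cases hγ : γ = 1
      · subst hγ
        rw [X.u_one, X.EA.fix 1 (one_mem X.A)]
        exact io_mem_KG (Submodule.mem_span_singleton_self _)
      · rw [X.EA_u γ hγ, map_zero]
        exact Submodule.zero_mem _
    exact this hg
  have hm2 : io X.M X.tr x ∈ (ℂ ∙ (io X.M X.tr 1)) := by
    refine KG_mono (Submodule.closed_of_finiteDimensional _) ?_ hm
    intro g hg
    obtain ⟨c, rfl⟩ := Submodule.mem_span_singleton.1 hg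
    rw [map_smul]
    exact Submodule.smul_mem _ _ (Submodule.mem_span_singleton_self _)
  obtain ⟨c, hc⟩ := Submodule.mem_span_singleton.1 hm2
  have hx1 : x = c • (1 : H →L[ℂ] H) := by
    rw [← map_smul] at hc
    exact (io_inj2 X.tr (vn_smul_mem X.M c (one_mem X.M)) hxM hc).symm
  have : X.tr.τ x = c := by rw [hx1, map_smul, X.tr.unital, smul_eq_mul, mul_one]
  rw [this]; exact hx1

end assembly
end CD

namespace CD

section assembly2
variable {H : Type} [NormedAddCommGroup H] [InnerProductSpace ℂ H] [CompleteSpace H]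
variable {Γ : Type} [Group Γ] (X : CrossedProduct Γ H)
variable {k : ℕ} {α : Fin k → H} {C : ℝ}
variable {N : VonNeumannAlgebra H} {E : (H →L[ℂ] H) →ₗ[ℂ] (H →L[ℂ] H)}

theorem sg_one (x : H →L[ℂ] H) : X.σ 1 x = x := by
  rw [CrossedProduct.σ, X.u_one, star_one, one_mul, mul_one]

theorem sg_comp (γ δ : Γ) (x : H →L[ℂ] H) : X.σ γ (X.σ δ x) = X.σ (γ * δ) x := by
  simp only [CrossedProduct.σ]
  rw [← X.u_mul, star_mul]
  simp only [mul_assoc]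

theorem sg_mul (γ : Γ) (a b : H →L[ℂ] H) : X.σ γ (a * b) = X.σ γ a * X.σ γ b := by
  simp only [CrossedProduct.σ, X.u_star]
  exact sigma_mul X γ a b

theorem sg_star (γ : Γ) (a : H →L[ℂ] H) : X.σ γ (star a) = star (X.σ γ a) := by
  simp only [CrossedProduct.σ, star_mul, star_star, mul_assoc]

theorem sg_smul (γ : Γ) (c : ℂ) (a : H →L[ℂ] H) : X.σ γ (c • a) = c • X.σ γ a := by
  simp only [CrossedProduct.σ, mul_smul_comm, smul_mul_assoc]

theorem sg_sum (γ : Γ) (T : Finset (H →L[ℂ] H)) : X.σ γ (∑ e ∈ T, e) = ∑ e ∈ T, X.σ γ e := by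
  simp only [CrossedProduct.σ, Finset.mul_sum, Finset.sum_mul]

theorem sg_tau (γ : Γ) {a : H →L[ℂ] H} (ha : a ∈ X.M) : X.tr.τ (X.σ γ a) = X.tr.τ a := by
  have hu := X.u_mem γ
  rw [CrossedProduct.σ, X.tr.tracial _ (mul_mem hu ha) _ (star_mem (S := VonNeumannAlgebra H) hu), ← mul_assoc,
    X.u_star, u_inv_mul, one_mul]

theorem sg_inv (γ : Γ) (x : H →L[ℂ] H) : X.σ γ (X.σ γ⁻¹ x) = x := by
  rw [sg_comp, mul_inv_cancel, sg_one]

theorem sg_inv' (γ : Γ) (x : H →L[ℂ] H) : X.σ γ⁻¹ (X.σ γ x) = x := by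
  rw [sg_comp, inv_mul_cancel, sg_one]

theorem sg_zero (γ : Γ) : X.σ γ 0 = 0 := by
  simp [CrossedProduct.σ]

theorem proj_sum {Q : VonNeumannAlgebra H} (T : Finset (H →L[ℂ] H))
    (h1 : ∀ e ∈ T, IsProjIn (Q : Set (H →L[ℂ] H)) e)
    (h2 : ∀ e ∈ T, ∀ e' ∈ T, e ≠ e' → e * e' = 0) :
    IsProjIn (Q : Set (H →L[ℂ] H)) (∑ e ∈ T, e) := by
  induction T using Finset.induction_on with
  | empty => exact ⟨by simpa using zero_mem Q, by simp, by simp⟩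
  | insert a s ha ih =>
    rw [Finset.sum_insert ha]
    refine (proj_add (h1 a (Finset.mem_insert_self _ _))
      (ih (fun e he => h1 e (Finset.mem_insert_of_mem he))
        (fun e he e' he' => h2 e (Finset.mem_insert_of_mem he) e' (Finset.mem_insert_of_mem he'))) ?_).1
    rw [Finset.mul_sum]
    apply Finset.sum_eq_zero
    intro e he
    exact h2 a (Finset.mem_insert_self _ _) e (Finset.mem_insert_of_mem he) (fun h => ha (h ▸ he))

variable {n : ℕ} {m : Fin n → (H →L[ℂ] H)} {r : ℝ}

theorem one_ne (X : CrossedProduct Γ H) : (1 : H →L[ℂ] H) ≠ 0 := by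
  intro h
  have h2 := X.tr.unital
  rw [h, map_zero] at h2
  exact zero_ne_one h2

theorem atom_scalar (nd : NormalData X.tr k α C) (D : IdxD X X.Lg N E n m r)
    {q : H →L[ℂ] H} (hq : q ∈ IdxD.Q X N) : E q = X.tr.τ q • (1 : H →L[ℂ] H) := by
  have h := mem_vnInf.1 (D.EQ hq)
  rw [← D.tre q (IdxD.q1 hq)]
  exact Lg_inf_A X nd h.1 h.2

theorem exists_atom (nd : NormalData X.tr k α C) (D : IdxD X X.Lg N E n m r)
    (habel : IsAbelianSet (X.A : Set (H →L[ℂ] H))) :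
    ∃ f, IsProjIn (IdxD.Q X N : Set (H →L[ℂ] H)) f ∧ f ≠ 0 ∧
      ∀ x ∈ IdxD.Q X N, ∃ c : ℂ, x * f = c • f := by
  obtain ⟨c, hc, hlow⟩ := D.lower
  have hQN : ∀ {f}, IsProjIn (IdxD.Q X N : Set (H →L[ℂ] H)) f → IsProjIn (N : Set (H →L[ℂ] H)) f :=
    fun hf => ⟨IdxD.q1 hf.1, hf.2⟩
  have hQM : ∀ {f}, IsProjIn (IdxD.Q X N : Set (H →L[ℂ] H)) f → IsProjIn (X.M : Set (H →L[ℂ] H)) f :=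
    fun hf => ⟨D.upM (IdxD.q1 hf.1), hf.2⟩
  have hlow' : ∀ f, IsProjIn (IdxD.Q X N : Set (H →L[ℂ] H)) f → f ≠ 0 → c ≤ (X.tr.τ f).re := by
    intro f hf hf0
    have h := hlow f (hQN hf) hf0
    rw [atom_scalar X nd D hf.1, norm_smul] at h
    have h1 : ‖(1 : H →L[ℂ] H)‖ ≤ 1 := ContinuousLinearMap.norm_id_le
    have hp := proj_tau_pos X.tr (hQM hf) hf0
    have h2 : ‖X.tr.τ f‖ = (X.tr.τ f).re := by
      rw [tau_real X.tr (hQM hf).1 hf.2.1, Complex.norm_real, Real.norm_of_nonneg (by simpa using hp.le)]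
      simp
    rw [h2] at h
    nlinarith
  set S : Set ℝ := {t | ∃ f, IsProjIn (IdxD.Q X N : Set (H →L[ℂ] H)) f ∧ f ≠ 0 ∧ t = (X.tr.τ f).re} with hS
  have hne : S.Nonempty := ⟨_, 1, ⟨one_mem (IdxD.Q X N), star_one _, mul_one _⟩, one_ne X, rfl⟩
  have hbdd : BddBelow S := by
    refine ⟨c, ?_⟩
    rintro _ ⟨f, hf, hf0, rfl⟩
    exact hlow' f hf hf0
  obtain ⟨_, ⟨f, hf, hf0, rfl⟩, hlt⟩ := exists_lt_of_csInf_lt hne (lt_add_of_pos_right (sInf S) hc)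
  have hmin : ∀ g, IsProjIn (IdxD.Q X N : Set (H →L[ℂ] H)) g → f * g = g → g = 0 ∨ g = f := by
    intro g hg hfg
    by_contra hcon
    push Not at hcon
    have hp := compl_proj hf hg hfg
    have h1 := hlow' _ hp (sub_ne_zero.2 hcon.2.symm)
    have h2 : sInf S ≤ (X.tr.τ g).re := csInf_le hbdd ⟨g, hg, hcon.1, rfl⟩
    rw [map_sub, Complex.sub_re] at h1
    linarith
  refine ⟨f, hf, hf0, ?_⟩
  intro x hx
  have hB : ∀ g, IsProjIn (IdxD.Q X N : Set (H →L[ℂ] H)) g → f * g = g → E g * f = g * E f := by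
    intro g hg hfg
    rcases hmin g hg hfg with rfl | rfl
    · rw [map_zero, zero_mul, zero_mul]
    · rw [atom_scalar X nd D hg.1, smul_mul_assoc, mul_smul_comm, one_mul, mul_one]
  have h := D.claimC habel hf hB hx
  have hxf : x * f ∈ IdxD.Q X N := mul_mem hx hf.1
  rw [atom_scalar X nd D hf.1, atom_scalar X nd D hxf, smul_mul_assoc, mul_smul_comm, one_mul, mul_one] at h
  have ht : X.tr.τ f ≠ 0 := by
    intro h0
    have := proj_tau_pos X.tr (hQM hf) hf0
    rw [h0] at this
    exact lt_irrefl _ this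
  refine ⟨(X.tr.τ f)⁻¹ * X.tr.τ (x * f), ?_⟩
  rw [mul_smul, h, inv_smul_smul₀ ht]

theorem atoms (nd : NormalData X.tr k α C) (D : IdxD X X.Lg N E n m r)
    (habel : IsAbelianSet (X.A : Set (H →L[ℂ] H))) (herg : IsErgodic X) :
    ∃ (f : H →L[ℂ] H) (T : Finset (H →L[ℂ] H)), (∀ e, e ∈ T ↔ ∃ γ, X.σ γ f = e) ∧
      (∀ e ∈ T, IsProjIn (IdxD.Q X N : Set (H →L[ℂ] H)) e) ∧
      (∀ e ∈ T, ∀ e' ∈ T, e ≠ e' → e * e' = 0) ∧ ∑ e ∈ T, e = 1 ∧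
      ∀ q ∈ IdxD.Q X N, ∃ c : (H →L[ℂ] H) → ℂ, q = ∑ e ∈ T, c e • e := by
  obtain ⟨f, hf, hf0, hmin⟩ := exists_atom X nd D habel
  have hinv := inf_inv X (N := N) (fun x hx => D.h12 hx)
  have hP : ∀ γ, IsProjIn (IdxD.Q X N : Set (H →L[ℂ] H)) (X.σ γ f) := by
    intro γ
    exact ⟨hinv γ f hf.1, by rw [← sg_star, hf.2.1], by rw [← sg_mul, hf.2.2]⟩
  have hP0 : ∀ γ, X.σ γ f ≠ 0 := by
    intro γ h
    apply hf0
    rw [← sg_inv' X γ f, h, sg_zero]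
  have hmin' : ∀ γ, ∀ x ∈ IdxD.Q X N, ∃ c : ℂ, x * X.σ γ f = c • X.σ γ f := by
    intro γ x hx
    obtain ⟨c, hc⟩ := hmin _ (hinv γ⁻¹ x hx)
    refine ⟨c, ?_⟩
    have := congrArg (X.σ γ) hc
    rwa [sg_mul, sg_inv, sg_smul] at this
  have key : ∀ e e' : H →L[ℂ] H, e * e = e → ∀ c : ℂ, e * e' = c • e' → c • e' = 0 ∨ e * e' = e' := by
    intro e e' he c hc
    have h1 : e * (e * e') = e * e' := by rw [← mul_assoc, he]
    rw [hc, mul_smul_comm, hc, smul_smul] at h1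
    have h2 : (c * (c - 1)) • e' = 0 := by
      rw [mul_sub, mul_one, sub_smul, h1, sub_self]
    rcases smul_eq_zero.1 h2 with h | h
    · rcases mul_eq_zero.1 h with h | h
      · left; rw [h, zero_smul]
      · right; rw [hc, sub_eq_zero.1 h, one_smul]
    · left; rw [h, smul_zero]
  have horth : ∀ γ δ, X.σ γ f ≠ X.σ δ f → X.σ γ f * X.σ δ f = 0 := by
    intro γ δ hne
    obtain ⟨c, hc⟩ := hmin' δ _ (hP γ).1
    obtain ⟨d, hd⟩ := hmin' γ _ (hP δ).1
    have hcomm := IdxD.qc habel (hP γ).1 (hP δ).1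
    rcases key _ _ (hP γ).2.2 c hc with h | h
    · rw [hc, h]
    rcases key _ _ (hP δ).2.2 d hd with h' | h'
    · rw [hcomm, hd, h']
    · exact absurd (h'.symm.trans (hcomm.symm.trans h)) hne
  set O : Set (H →L[ℂ] H) := Set.range fun γ => X.σ γ f with hO
  have hOP : ∀ e ∈ O, IsProjIn (IdxD.Q X N : Set (H →L[ℂ] H)) e := by
    rintro _ ⟨γ, rfl⟩; exact hP γ
  have hOO : ∀ e ∈ O, ∀ e' ∈ O, e ≠ e' → e * e' = 0 := by
    rintro _ ⟨γ, rfl⟩ _ ⟨δ, rfl⟩ h; exact horth γ δ h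
  have hQM : ∀ {g}, g ∈ IdxD.Q X N → g ∈ X.M := fun hg => D.upM (IdxD.q1 hg)
  have hpos : 0 < (X.tr.τ f).re := proj_tau_pos X.tr ⟨hQM hf.1, hf.2⟩ hf0
  have hfin : O.Finite := by
    by_contra hinf
    obtain ⟨L, hL⟩ := exists_nat_gt (1 / (X.tr.τ f).re)
    obtain ⟨T, hT, hcard⟩ := Set.Infinite.exists_subset_card_eq hinf L
    have hp := proj_sum T (fun e he => hOP e (hT he)) (fun e he e' he' => hOO e (hT he) e' (hT he'))
    have h1 := proj_le_one_tau X.tr (p := ∑ e ∈ T, e) ⟨hQM hp.1, hp.2⟩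
    rw [map_sum, Complex.re_sum] at h1
    have h2 : ∑ e ∈ T, (X.tr.τ e).re = ∑ e ∈ T, (X.tr.τ f).re := by
      apply Finset.sum_congr rfl
      intro e he
      obtain ⟨γ, rfl⟩ := hT he
      simp only
      rw [sg_tau X γ (hQM hf.1)]
    rw [h2, Finset.sum_const, hcard, nsmul_eq_mul] at h1
    rw [div_lt_iff₀ hpos] at hL
    linarith
  have hTO : ∀ e, e ∈ hfin.toFinset ↔ e ∈ O := fun e => hfin.mem_toFinset
  have hsum : ∑ e ∈ hfin.toFinset, e = 1 := by
    set s := ∑ e ∈ hfin.toFinset, e with hs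
    have hsP := proj_sum hfin.toFinset (fun e he => hOP e ((hTO e).1 he))
      (fun e he e' he' => hOO e ((hTO e).1 he) e' ((hTO e').1 he'))
    have hmap : ∀ γ, ∀ e ∈ hfin.toFinset, X.σ γ e ∈ hfin.toFinset := by
      intro γ e he
      obtain ⟨δ, rfl⟩ := (hTO e).1 he
      apply (hTO _).2
      exact ⟨γ * δ, (sg_comp X γ δ f).symm⟩
    have hsinv : ∀ γ, X.σ γ s = s := by
      intro γ
      rw [hs, sg_sum]
      refine Finset.sum_nbij' (X.σ γ) (X.σ γ⁻¹) (hmap γ) (hmap γ⁻¹) ?_ ?_ ?_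
      · intro e _; exact sg_inv' X γ e
      · intro e _; exact sg_inv X γ e
      · intro e _; rfl
    obtain ⟨c, hc⟩ := herg s (mem_vnInf.1 hsP.1).2 hsinv
    have hfO : f ∈ O := ⟨1, sg_one X f⟩
    have hsf : s * f = f := by
      rw [hs, Finset.sum_mul, Finset.sum_eq_single_of_mem f ((hTO f).2 hfO)]
      · exact hf.2.2
      · intro e he hne
        exact hOO e ((hTO e).1 he) f hfO hne
    rw [hc, smul_mul_assoc, one_mul] at hsf
    have h1 : (c - 1) • f = 0 := by rw [sub_smul, one_smul, hsf, sub_self]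
    rcases smul_eq_zero.1 h1 with h | h
    · rw [hc, sub_eq_zero.1 h, one_smul]
    · exact absurd h hf0
  refine ⟨f, hfin.toFinset, hTO, fun e he => hOP e ((hTO e).1 he),
    fun e he e' he' => hOO e ((hTO e).1 he) e' ((hTO e').1 he'), hsum, ?_⟩
  intro q hq
  have : ∀ e : H →L[ℂ] H, ∃ c : ℂ, e ∈ hfin.toFinset → q * e = c • e := by
    intro e
    by_cases he : e ∈ hfin.toFinset
    · obtain ⟨δ, rfl⟩ := (hTO e).1 he
      obtain ⟨c, hc⟩ := hmin' δ q hq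
      exact ⟨c, fun _ => hc⟩
    · exact ⟨0, fun h => absurd h he⟩
  choose c hc using this
  refine ⟨c, ?_⟩
  calc q = q * ∑ e ∈ hfin.toFinset, e := by rw [hsum, mul_one]
    _ = _ := by
      rw [Finset.mul_sum]
      exact Finset.sum_congr rfl fun e he => hc e he

theorem atoms_transitive (nd : NormalData X.tr k α C) (D : IdxD X X.Lg N E n m r)
    (habel : IsAbelianSet (X.A : Set (H →L[ℂ] H))) (herg : IsErgodic X) :
    IsTransitiveOn X (vnInf N X.A : VonNeumannAlgebra H) := by
  obtain ⟨f, T, hT, hP, hO, hs, hq⟩ := atoms X nd D habel herg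
  let e := T.equivFin
  have hsum : ∀ g : (H →L[ℂ] H) → (H →L[ℂ] H), ∑ i, g (e.symm i : H →L[ℂ] H) = ∑ x ∈ T, g x := by
    intro g
    rw [← Finset.sum_coe_sort T g]
    exact Equiv.sum_comp e.symm (fun i => g (i : H →L[ℂ] H))
  refine ⟨T.card, fun i => (e.symm i : H →L[ℂ] H), ?_, ?_, ?_, ?_, ?_⟩
  · intro i; exact hP _ (e.symm i).2
  · intro i j hij
    apply hO _ (e.symm i).2 _ (e.symm j).2
    intro h
    exact hij (e.symm.injective (Subtype.ext h))
  · rw [← hs]; exact hsum fun x => x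
  · intro q hqQ
    obtain ⟨c, hc⟩ := hq q hqQ
    refine ⟨fun i => c (e.symm i : H →L[ℂ] H), ?_⟩
    rw [hc]
    exact (hsum fun x => c x • x).symm
  · intro i j
    obtain ⟨γ, hγ⟩ := (hT _).1 (e.symm i).2
    obtain ⟨δ, hδ⟩ := (hT _).1 (e.symm j).2
    refine ⟨δ * γ⁻¹, ?_⟩
    simp only
    rw [← hγ, sg_comp, inv_mul_cancel_right, hδ]

theorem trivial_of (nd : NormalData X.tr k α C) (D : IdxD X X.Lg N E n m r)
    (habel : IsAbelianSet (X.A : Set (H →L[ℂ] H))) (herg : IsErgodic X)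
    (hK : ∀ K : Subgroup Γ, K.index ≠ 0 → K = ⊤) :
    (N : Set (H →L[ℂ] H)) = (X.Lg : Set (H →L[ℂ] H)) := by
  obtain ⟨f, T, hT, hP, hO, hs, hq⟩ := atoms X nd D habel herg
  let K : Subgroup Γ :=
    { carrier := {γ | X.σ γ f = f}
      mul_mem' := by
        intro a b ha hb
        change X.σ (a * b) f = f
        rw [← sg_comp, show X.σ b f = f from hb]
        exact ha
      one_mem' := sg_one X f
      inv_mem' := by
        intro a ha
        change X.σ a⁻¹ f = f
        conv_lhs => rw [← show X.σ a f = f from ha]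
        exact sg_inv' X a f }
  have hKm : ∀ γ, γ ∈ K ↔ X.σ γ f = f := fun γ => Iff.rfl
  have hfin : Finite (Γ ⧸ K) := by
    refine Finite.of_injective (fun q : Γ ⧸ K => (⟨X.σ q.out f, (hT _).2 ⟨q.out, rfl⟩⟩ : T)) ?_
    intro q q' h
    have h1 : X.σ q.out f = X.σ q'.out f := congrArg Subtype.val h
    rw [← QuotientGroup.out_eq' q, ← QuotientGroup.out_eq' q', QuotientGroup.eq, hKm, ← sg_comp, ← h1, sg_inv']
  have hidx : K.index ≠ 0 := by
    rw [Subgroup.index]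
    exact Nat.card_pos.ne'
  have hKt := hK K hidx
  have hall : ∀ γ, X.σ γ f = f := fun γ => (hKm γ).1 (hKt ▸ Subgroup.mem_top γ)
  have hTf : T = {f} := by
    ext e
    rw [hT, Finset.mem_singleton]
    constructor
    · rintro ⟨γ, rfl⟩; exact hall γ
    · rintro rfl; exact ⟨1, hall 1⟩
  subst hTf
  rw [Finset.sum_singleton] at hs
  apply Set.Subset.antisymm
  · intro z hz
    apply mem_of_io_mem nd X.Lg_sub (D.h2 hz)
    refine KG_mono (KG_closed _) ?_ (D.dens z hz)
    intro g hg
    apply io_mem_KG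
    refine QG_sub X (N := X.Lg) ?_ (fun x hx => hx) hg
    intro q hqQ
    obtain ⟨c, hc⟩ := hq q hqQ
    rw [Finset.sum_singleton, hs] at hc
    rw [hc]
    exact vn_smul_mem X.Lg _ (one_mem X.Lg)
  · exact D.h12

end assembly2
end CD

end helpers

open CD in
/-- Corollary `intsubgenmain`. Let `Γ` be an icc group, `Γ ↷ X` a
free ergodic pmp action, and `M = L^∞(X) ⋊ Γ`. Then:
(1) every intermediate von Neumann subalgebra `L(Γ) ⊆ N ⊆ M` with
`N ⊆ QN_M(L(Γ))''` is of the form `L^∞(X₀) ⋊ Γ` for a factor (quotient) `Γ ↷ X₀` of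
`Γ ↷ X` (i.e. a `Γ`-invariant von Neumann subalgebra `L^∞(X₀) ⊆ L^∞(X)`);
(2) every intermediate subfactor `L(Γ) ⊆ N ⊆ M` of finite Jones index over `L(Γ)`
arises from a finite transitive factor `Γ ↷ X₀`, and `[N : L(Γ)] ∈ ℕ`; consequently
for subfactors `L(Γ) ⊆ N₁ ⊆ N₂ ⊆ M` with `[N₁ : L(Γ)] < ∞` or `Γ ↷ X` compact, one
has `[N₂ : N₁] ∈ ℕ ∪ {∞}`;
(3) if `Γ` has no proper finite index subgroups, there are no nontrivial intermediate
subfactors of finite index over `L(Γ)`. -/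
theorem stmt3_intermediate_subfactors_above_group_algebra
    (Γ : Type) [Group Γ] [Countable Γ] (hicc : IsICC Γ)
    (H : Type) [NormedAddCommGroup H] [InnerProductSpace ℂ H] [CompleteSpace H]
    -- the group measure space algebra `M = L^∞(X) ⋊ Γ` of a free ergodic pmp action
    (X : CrossedProduct Γ H)
    (habel : IsAbelianSet (X.A : Set (H →L[ℂ] H)))
    (hfree : IsFree X) (herg : IsErgodic X) :
    -- (1)
    (∀ N : VonNeumannAlgebra H,
      (X.Lg : Set (H →L[ℂ] H)) ⊆ (N : Set (H →L[ℂ] H)) →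
      (N : Set (H →L[ℂ] H)) ⊆ (X.M : Set (H →L[ℂ] H)) →
      (N : Set (H →L[ℂ] H)) ⊆
        vnGen (QNset (X.M : Set (H →L[ℂ] H)) (X.Lg : Set (H →L[ℂ] H))) →
      ∃ Q : VonNeumannAlgebra H,
        (Q : Set (H →L[ℂ] H)) ⊆ (X.A : Set (H →L[ℂ] H)) ∧
        InvariantUnder X (Q : Set (H →L[ℂ] H)) ∧
        (N : Set (H →L[ℂ] H)) = midCP X (Q : Set (H →L[ℂ] H))) ∧
    -- (2), first half
    (∀ N : VonNeumannAlgebra H,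
      (X.Lg : Set (H →L[ℂ] H)) ⊆ (N : Set (H →L[ℂ] H)) →
      (N : Set (H →L[ℂ] H)) ⊆ (X.M : Set (H →L[ℂ] H)) →
      IsFactorSet (N : Set (H →L[ℂ] H)) →
      FiniteIndexIn X.tr (N : Set (H →L[ℂ] H)) (X.Lg : Set (H →L[ℂ] H)) →
      ∃ Q : VonNeumannAlgebra H,
        (Q : Set (H →L[ℂ] H)) ⊆ (X.A : Set (H →L[ℂ] H)) ∧
        InvariantUnder X (Q : Set (H →L[ℂ] H)) ∧
        IsTransitiveOn X (Q : Set (H →L[ℂ] H)) ∧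
        (N : Set (H →L[ℂ] H)) = midCP X (Q : Set (H →L[ℂ] H)) ∧
        -- `[N : L(Γ)] ∈ ℕ`
        (∃ n : ℕ, HasPPIndex X.tr (N : Set (H →L[ℂ] H)) (X.Lg : Set (H →L[ℂ] H)) n)) ∧
    -- (2), second half
    (∀ N₁ N₂ : VonNeumannAlgebra H,
      (X.Lg : Set (H →L[ℂ] H)) ⊆ (N₁ : Set (H →L[ℂ] H)) →
      (N₁ : Set (H →L[ℂ] H)) ⊆ (N₂ : Set (H →L[ℂ] H)) →
      (N₂ : Set (H →L[ℂ] H)) ⊆ (X.M : Set (H →L[ℂ] H)) →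
      IsFactorSet (N₁ : Set (H →L[ℂ] H)) → IsFactorSet (N₂ : Set (H →L[ℂ] H)) →
      (FiniteIndexIn X.tr (N₁ : Set (H →L[ℂ] H)) (X.Lg : Set (H →L[ℂ] H)) ∨
        IsCompactAction X) →
      ((∃ n : ℕ, HasPPIndex X.tr (N₂ : Set (H →L[ℂ] H)) (N₁ : Set (H →L[ℂ] H)) n) ∨
        ¬ FiniteIndexIn X.tr (N₂ : Set (H →L[ℂ] H)) (N₁ : Set (H →L[ℂ] H)))) ∧
    -- (3)
    ((∀ K : Subgroup Γ, K.index ≠ 0 → K = ⊤) →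
      ∀ N : VonNeumannAlgebra H,
        (X.Lg : Set (H →L[ℂ] H)) ⊆ (N : Set (H →L[ℂ] H)) →
        (N : Set (H →L[ℂ] H)) ⊆ (X.M : Set (H →L[ℂ] H)) →
        IsFactorSet (N : Set (H →L[ℂ] H)) →
        FiniteIndexIn X.tr (N : Set (H →L[ℂ] H)) (X.Lg : Set (H →L[ℂ] H)) →
        (N : Set (H →L[ℂ] H)) = (X.Lg : Set (H →L[ℂ] H))) := by
  obtain ⟨k, α, C, nd⟩ := exists_normalData X.tr (cp_factor X habel hfree herg)
  refine ⟨?_, ?_, ?_, ?_⟩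
  · intro N hL hNM hQN
    exact ⟨vnInf N X.A, inf_sub X, inf_inv X hL,
      N_eq X hicc nd hNM hL fun z hz => QN_dense X hicc nd (hNM hz) (hQN hz)⟩
  · intro N hL hNM hfac hfin
    obtain ⟨r, E, mem, fix, bim, tre, n, m, p, mN, hp, hmp, hexp, hr⟩ := hfin
    have D : ExpD X X.Lg N E := ⟨hL, hNM, mem, fix, bim, tre⟩
    have hd := FG_dense X hicc nd hL hNM (FG_trans X D mN hexp (FG_base X))
    have D' := mkIdx X hicc nd D (fun x hx => hx) hd hfac mN hmp hexp hr
    obtain ⟨l, hl⟩ := D'.nat_index habel nd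
    refine ⟨vnInf N X.A, inf_sub X, inf_inv X hL, atoms_transitive X nd D' habel herg,
      N_eq X hicc nd hNM hL hd, l, ?_⟩
    rw [← hl]
    exact ⟨E, mem, fix, bim, tre, n, m, p, mN, hp, hmp, hexp, hr⟩
  · intro N₁ N₂ hL h12 h2 hf1 hf2 hor
    by_cases hfin : FiniteIndexIn X.tr (N₂ : Set (H →L[ℂ] H)) (N₁ : Set (H →L[ℂ] H))
    · left
      obtain ⟨r, E, mem, fix, bim, tre, n, m, p, mN, hp, hmp, hexp, hr⟩ := hfin
      have D : ExpD X N₁ N₂ E := ⟨h12, h2, mem, fix, bim, tre⟩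
      have hd : ∀ z ∈ N₂, io X.M X.tr z ∈ KG X.tr (QG X (Ac X)) := by
        rcases hor with h | h
        · obtain ⟨r', E', mem', fix', bim', tre', n', m', p', mN', hp', hmp', hexp', hr'⟩ := h
          have D1 : ExpD X X.Lg N₁ E' := ⟨hL, fun x hx => h2 (h12 hx), mem', fix', bim', tre'⟩
          exact FG_dense X hicc nd (fun x hx => h12 (hL hx)) h2
            (FG_trans X D mN hexp (FG_trans X D1 mN' hexp' (FG_base X)))
        · exact fun z hz => compact_dense X h nd z (h2 hz)
      have D' := mkIdx X hicc nd D hL hd hf2 mN hmp hexp hr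
      obtain ⟨l, hl⟩ := D'.nat_index habel nd
      refine ⟨l, ?_⟩
      rw [← hl]
      exact ⟨E, mem, fix, bim, tre, n, m, p, mN, hp, hmp, hexp, hr⟩
    · right; exact hfin
  · intro hK N hL hNM hfac hfin
    obtain ⟨r, E, mem, fix, bim, tre, n, m, p, mN, hp, hmp, hexp, hr⟩ := hfin
    have D : ExpD X X.Lg N E := ⟨hL, hNM, mem, fix, bim, tre⟩
    have hd := FG_dense X hicc nd hL hNM (FG_trans X D mN hexp (FG_base X))
    have D' := mkIdx X hicc nd D (fun x hx => hx) hd hfac mN hmp hexp hr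
    exact trivial_of X nd D' habel herg hK
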